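/- There exists a positive integer n₀ such that every oriented graph G on n ≥ n₀ vertices with minimum semi-degree δ⁰(G) ≥ ⌈(3n−4)/8⌉ contains a Hamilton cycle. -/

import Mathlib

open Set

namespace ArxivOG

variable {V : Type*}

/-- An oriented graph: at most one directed edge between any two vertices (and no loops). -/
def IsOriented (G : V → V → Prop) : Prop := ∀ x y : V, G x y → ¬ G y x

/-- Out-neighbourhood of a vertex. -/
def outN (G : V → V → Prop) (x : V) : Set V := {y | G x y}

/-- In-neighbourhood of a vertex. -/
def inN (G : V → V → Prop) (x : V) : Set V := {y | G y x}

/-- Outdegree of a vertex. -/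
noncomputable def outDeg (G : V → V → Prop) (x : V) : ℕ := (outN G x).ncard

/-- Indegree of a vertex. -/
noncomputable def inDeg (G : V → V → Prop) (x : V) : ℕ := (inN G x).ncard

/-- The set of all outneighbours of vertices in `S`. -/
def outNSet (G : V → V → Prop) (S : Set V) : Set V := {y | ∃ x ∈ S, G x y}

/-- Minimum outdegree `δ⁺`. -/
noncomputable def minOutDeg (G : V → V → Prop) : ℕ := sInf (Set.range (outDeg G))

/-- Minimum indegree `δ⁻`. -/
noncomputable def minInDeg (G : V → V → Prop) : ℕ := sInf (Set.range (inDeg G))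

/-- Minimum semi-degree `δ⁰ = min (δ⁺, δ⁻)`. -/
noncomputable def minSemiDeg (G : V → V → Prop) : ℕ := min (minOutDeg G) (minInDeg G)

/-- A Hamilton cycle of a digraph, encoded as a permutation `σ` of the vertex set all of whose
vertices lie on a single cycle and such that every vertex sends an edge to its successor. -/
def IsHamCycle (G : V → V → Prop) (σ : Equiv.Perm V) : Prop :=
  (∀ v, G v (σ v)) ∧ ∀ v w : V, σ.SameCycle v w

/-- The number of edges directed from `A` to `B`. -/
noncomputable def eCnt (G : V → V → Prop) (A B : Set V) : ℕ :=
  {p : V × V | p.1 ∈ A ∧ p.2 ∈ B ∧ G p.1 p.2}.ncard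

/-- The density of the bipartite graph of all `A`–`B` edges. -/
noncomputable def dens (G : V → V → Prop) (A B : Set V) : ℝ :=
  (eCnt G A B : ℝ) / ((A.ncard : ℝ) * (B.ncard : ℝ))

/-- The pair `(A,B)` is `ε`-regular. -/
def EpsRegular (ε : ℝ) (G : V → V → Prop) (A B : Set V) : Prop :=
  ∀ X ⊆ A, ∀ Y ⊆ B, ε * A.ncard < (X.ncard : ℝ) → ε * B.ncard < (Y.ncard : ℝ) →
    |dens G X Y - dens G A B| < ε

/-- The pair `(A,B)` is `(ε,d)`-super-regular. -/
def SuperRegular (ε d : ℝ) (G : V → V → Prop) (A B : Set V) : Prop :=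
  EpsRegular ε G A B ∧
  (∀ a ∈ A, (d - ε) * B.ncard ≤ ((outN G a ∩ B).ncard : ℝ)) ∧
  (∀ b ∈ B, (d - ε) * A.ncard ≤ ((inN G b ∩ A).ncard : ℝ))

/-- The cluster `V_i` of a partition encoded by `P : V → Option (Fin k)`. -/
def cluster {k : ℕ} (P : V → Option (Fin k)) (i : Fin k) : Set V := {x | P x = some i}

/-- The exceptional set `V₀` of a partition encoded by `P : V → Option (Fin k)`. -/
def cluster0 {k : ℕ} (P : V → Option (Fin k)) : Set V := {x | P x = none}

section Core
open scoped Classical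

/-- A cyclic list through all vertices is a Hamilton cycle. -/
theorem exists_isHamCycle_of_list {V : Type*} (G : V → V → Prop) (l : List V)
    (hne : l ≠ []) (hnd : l.Nodup) (hall : ∀ v, v ∈ l) (hch : l.IsChain G)
    (hcl : G (l.getLast hne) (l.head hne)) : ∃ σ : Equiv.Perm V, IsHamCycle G σ := by
  refine ⟨l.formPerm, ?_, ?_⟩
  · intro v
    obtain ⟨i, hi, rfl⟩ := List.getElem_of_mem (hall v)
    rw [List.formPerm_apply_getElem l hnd i hi]
    by_cases h : i + 1 < l.length
    · have := List.isChain_iff_getElem.1 hch i h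
      simpa [Nat.mod_eq_of_lt h] using this
    · have h' : i + 1 = l.length := by omega
      have h0 : i = l.length - 1 := by omega
      subst h0
      rw [List.getLast_eq_getElem, List.head_eq_getElem] at hcl
      simpa [h'] using hcl
  · intro v w
    exact (List.Nodup.isCycleOn_formPerm hnd).2 (hall v) (hall w)

/-- A permutation with a single cycle, listed. -/
theorem exists_list_of_isHamCycle {ι : Type*} [Fintype ι] [Nonempty ι] (H : ι → ι → Prop)
    (τ : Equiv.Perm ι) (hτ : IsHamCycle H τ) (hirr : 2 ≤ Fintype.card ι) :
    ∃ l : List ι, ∃ hne : l ≠ [], l.Nodup ∧ (∀ i, i ∈ l) ∧ l.IsChain H ∧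
      H (l.getLast hne) (l.head hne) := by
  obtain ⟨i⟩ := ‹Nonempty ι›
  have hmove : τ i ≠ i := by
    intro h
    obtain ⟨j, hj⟩ := Fintype.exists_ne_of_one_lt_card (by omega : 1 < Fintype.card ι) i
    obtain ⟨k, hk⟩ := hτ.2 i j
    have : (τ ^ k) i = i := Equiv.Perm.zpow_apply_eq_self_of_apply_eq_self h k
    exact hj (by rw [← hk, this])
  have hmem : i ∈ τ.support := by simpa using hmove
  have hlen : (τ.toList i).length ≠ 0 := by
    have := Equiv.Perm.two_le_length_toList_iff_mem_support.2 hmem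
    omega
  have hne : τ.toList i ≠ [] := by
    intro h; rw [h] at hlen; simp at hlen
  refine ⟨τ.toList i, hne, Equiv.Perm.nodup_toList τ i, ?_, ?_, ?_⟩
  · intro j
    rw [Equiv.Perm.mem_toList_iff]
    exact ⟨hτ.2 i j, hmem⟩
  · rw [List.isChain_iff_getElem]
    intro k hk
    rw [Equiv.Perm.getElem_toList, Equiv.Perm.getElem_toList, pow_succ', Equiv.Perm.mul_apply]
    exact hτ.1 _
  · rw [List.getLast_eq_getElem, List.head_eq_getElem, Equiv.Perm.getElem_toList,
      Equiv.Perm.getElem_toList]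
    have h1 : (τ ^ (0:ℕ)) i = τ ((τ ^ ((τ.toList i).length - 1)) i) := by
      rw [← Equiv.Perm.mul_apply, ← pow_succ', Nat.sub_add_cancel (by omega)]
      rw [Equiv.Perm.length_toList]
      have := Equiv.Perm.SameCycle.refl τ i
      have hc := Equiv.Perm.isCycle_cycleOf τ hmove
      have := hc.orderOf
      rw [← this, pow_zero, Equiv.Perm.one_apply]
      rw [← Equiv.Perm.cycleOf_pow_apply_self, pow_orderOf_eq_one, Equiv.Perm.one_apply]
    rw [h1]
    exact hτ.1 _

/-- Disjoint paths covering the vertex set, together with a Hamilton cycle in the digraph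
obtained by contracting them, give a Hamilton cycle. -/
theorem exists_isHamCycle_of_paths {V ι : Type*} [Fintype ι] (G : V → V → Prop)
    (P : ι → List V) (hne : ∀ i, P i ≠ []) (hnd : ∀ i, (P i).Nodup)
    (hch : ∀ i, (P i).IsChain G) (hdis : ∀ i j, i ≠ j → List.Disjoint (P i) (P j))
    (hall : ∀ v, ∃ i, v ∈ P i) (hcard : 2 ≤ Fintype.card ι) (τ : Equiv.Perm ι)
    (hτ : IsHamCycle (fun i j => G ((P i).getLast (hne i)) ((P j).head (hne j))) τ) :
    ∃ σ : Equiv.Perm V, IsHamCycle G σ := by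
  have : Nonempty ι := by
    rw [← Fintype.card_pos_iff]; omega
  obtain ⟨l, hl, h1, h2, h3, h4⟩ := exists_list_of_isHamCycle _ τ hτ hcard
  have hnil : [] ∉ l.map P := by
    simp only [List.mem_map, not_exists, not_and]
    intro i _ h
    exact hne i h
  obtain ⟨a, l', rfl⟩ := List.exists_cons_of_ne_nil hl
  have hflat : ((a :: l').map P).flatten ≠ [] := by
    simp [hne a]
  refine exists_isHamCycle_of_list G ((a :: l').map P).flatten hflat ?_ ?_ ?_ ?_
  · rw [List.nodup_flatten]
    constructor
    · intro x hx
      obtain ⟨i, _, rfl⟩ := List.mem_map.1 hx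
      exact hnd i
    · rw [List.pairwise_map]
      exact h1.imp (fun {i j} hij => hdis i j hij)
  · intro v
    obtain ⟨i, hi⟩ := hall v
    rw [List.mem_flatten]
    exact ⟨P i, List.mem_map_of_mem (h2 i), hi⟩
  · rw [List.isChain_flatten hnil]
    constructor
    · intro x hx
      obtain ⟨i, _, rfl⟩ := List.mem_map.1 hx
      exact hch i
    · rw [List.isChain_map]
      refine h3.imp ?_
      intro i j hij x hx y hy
      rw [List.getLast?_eq_some_getLast (hne i)] at hx
      rw [List.head?_eq_some_head (hne j)] at hy
      simp only [Option.mem_def, Option.some.injEq] at hx hy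
      subst hx; subst hy; exact hij
  · have e1 : (((a :: l').map P).flatten).head hflat = (P a).head (hne a) := by
      simp only [List.map_cons, List.flatten_cons]
      rw [List.head_append_of_ne_nil]
    have e2 : (((a :: l').map P).flatten).getLast hflat
        = (P ((a :: l').getLast hl)).getLast (hne _) := by
      have hdl := List.dropLast_append_getLast hl
      have : ((a :: l').map P).flatten
          = (((a :: l').dropLast).map P).flatten ++ P ((a :: l').getLast hl) := by
        conv_lhs => rw [← hdl]
        simp
      simp only [this]
      rw [List.getLast_append_of_ne_nil]
    rw [e1, e2]
    exact h4

end Core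

section Core
open scoped Classical

/-- A bipartite graph with equal sides in which every vertex misses at most half of the other side
has a perfect matching. -/
theorem exists_equiv_of_few_missing {α β : Type*} [Fintype α] [Fintype β] (r : α → β → Prop)
    (hcard : Fintype.card α = Fintype.card β)
    (hα : ∀ a, 2 * (Finset.univ.filter fun b => ¬ r a b).card ≤ Fintype.card β)
    (hβ : ∀ b, 2 * (Finset.univ.filter fun a => ¬ r a b).card ≤ Fintype.card β) :
    ∃ e : α ≃ β, ∀ a, r a (e a) := by
  have key : ∀ X : Finset α,
      X.card ≤ (X.biUnion fun a => Finset.univ.filter fun b => r a b).card := by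
    intro X
    rcases X.eq_empty_or_nonempty with rfl | ⟨a, ha⟩
    · simp
    by_cases hX : 2 * X.card ≤ Fintype.card β
    · have h1 : (Finset.univ.filter fun b => r a b) ⊆
          X.biUnion fun a => Finset.univ.filter fun b => r a b :=
        Finset.subset_biUnion_of_mem (fun a => Finset.univ.filter fun b => r a b) ha
      have h2 := Finset.card_le_card h1
      have h3 := Finset.card_filter_add_card_filter_not (s := (Finset.univ : Finset β))
        (fun b => r a b)
      have h4 := hα a
      rw [Finset.card_univ] at h3
      omega
    · have : (X.biUnion fun a => Finset.univ.filter fun b => r a b) = Finset.univ := by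
        rw [Finset.eq_univ_iff_forall]
        intro b
        by_contra hb
        have hsub : X ⊆ Finset.univ.filter fun a => ¬ r a b := by
          intro a' ha'
          simp only [Finset.mem_filter, Finset.mem_univ, true_and]
          intro h
          exact hb (Finset.mem_biUnion.2 ⟨a', ha', by simpa using h⟩)
        have h2 := Finset.card_le_card hsub
        have h3 := hβ b
        omega
      rw [this, Finset.card_univ, ← hcard]
      exact Finset.card_le_univ X
  obtain ⟨f, hf, hr⟩ := (Finset.all_card_le_biUnion_card_iff_exists_injective _).1 key
  refine ⟨Equiv.ofBijective f ((Fintype.bijective_iff_injective_and_card f).2 ⟨hf, hcard⟩), ?_⟩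
  intro a
  simpa using hr a

/-- Exchanging the images of two points on different cycles merges the two cycles. -/
theorem sameCycle_mul_swap {ι : Type*} (σ : Equiv.Perm ι) {x y z : ι}
    (hxy : ¬ σ.SameCycle x y) (hz : σ.SameCycle x z) [Finite ι] :
    (σ * Equiv.swap x y).SameCycle y z := by
  set σ' := σ * Equiv.swap x y with hσ'
  have hy : σ' y = σ x := by simp [hσ']
  have key : ∀ k : ℕ, σ'.SameCycle y ((σ ^ (k + 1)) x) := by
    intro k
    induction k with
    | zero =>
      simp only [zero_add, pow_one]
      rw [← hy]
      exact Equiv.Perm.sameCycle_apply_right.2 (Equiv.Perm.SameCycle.refl _ _)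
    | succ k ih =>
      by_cases h : (σ ^ (k + 1)) x = x
      · rw [pow_succ', Equiv.Perm.mul_apply, h, ← hy]
        exact Equiv.Perm.sameCycle_apply_right.2 (Equiv.Perm.SameCycle.refl _ _)
      · have h2 : (σ ^ (k + 1)) x ≠ y := by
          intro h3
          exact hxy ⟨(k + 1 : ℕ), by rw [zpow_natCast]; exact h3⟩
        rw [pow_succ', Equiv.Perm.mul_apply]
        have : σ' ((σ ^ (k + 1)) x) = σ ((σ ^ (k + 1)) x) := by
          simp [hσ', Equiv.swap_apply_of_ne_of_ne h h2]
        rw [← this]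
        exact Equiv.Perm.sameCycle_apply_right.2 ih
  obtain ⟨k, hk0, hk, rfl⟩ := hz.exists_pow_eq'
  · have h := key (k + (orderOf σ) - 1)
    have hpos := orderOf_pos σ
    rw [Nat.sub_add_cancel (by omega), pow_add, pow_orderOf_eq_one, mul_one] at h
    exact h

/-- A digraph in which every vertex misses at most a tenth of the vertices in each direction has a
Hamilton cycle. -/
theorem exists_isHamCycle_of_few_missing {ι : Type*} [Fintype ι] [Nonempty ι] (H : ι → ι → Prop)
    (hout : ∀ i, 10 * (Finset.univ.filter fun j => ¬ H i j).card ≤ Fintype.card ι)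
    (hin : ∀ j, 10 * (Finset.univ.filter fun i => ¬ H i j).card ≤ Fintype.card ι) :
    ∃ τ, IsHamCycle H τ := by
  obtain ⟨e, he⟩ := exists_equiv_of_few_missing H rfl (fun a => by have := hout a; omega)
    (fun a => by have := hin a; omega)
  obtain ⟨v₀⟩ := ‹Nonempty ι›
  let C : Equiv.Perm ι → Finset ι := fun σ => Finset.univ.filter fun j => σ.SameCycle v₀ j
  obtain ⟨σ, hσ, hmax⟩ := Finset.exists_max_image
    (Finset.univ.filter fun σ : Equiv.Perm ι => ∀ i, H i (σ i)) (fun σ => (C σ).card)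
    ⟨e, by simpa using he⟩
  simp only [Finset.mem_filter, Finset.mem_univ, true_and] at hσ hmax
  refine ⟨σ, hσ, ?_⟩
  suffices hC : C σ = Finset.univ by
    intro v w
    have hv : v ∈ C σ := hC ▸ Finset.mem_univ v
    have hw : w ∈ C σ := hC ▸ Finset.mem_univ w
    simp only [C, Finset.mem_filter, Finset.mem_univ, true_and] at hv hw
    exact hv.symm.trans hw
  by_contra hC
  -- a vertex of one of the two sides, and a small side to avoid
  have pick : ∀ (x : ι) (D : Finset ι), 2 * D.card ≤ Fintype.card ι →
      ∃ y, y ∉ D ∧ H x (σ y) ∧ H y (σ x) := by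
    intro x D hD
    by_contra hno
    push Not at hno
    have hsub : (Finset.univ : Finset ι) ⊆
        D ∪ (((Finset.univ.filter fun j => ¬ H x j).map σ.symm.toEmbedding) ∪
          (Finset.univ.filter fun i => ¬ H i (σ x))) := by
      intro y _
      by_cases h1 : y ∈ D
      · simp [h1]
      · by_cases h2 : H x (σ y)
        · simp [hno y h1 h2]
        · simp [h2]
    have h1 := Finset.card_le_card hsub
    have h2 := Finset.card_union_le D
      (((Finset.univ.filter fun j => ¬ H x j).map σ.symm.toEmbedding) ∪
          (Finset.univ.filter fun i => ¬ H i (σ x)))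
    have h3 := Finset.card_union_le
      ((Finset.univ.filter fun j => ¬ H x j).map σ.symm.toEmbedding)
      (Finset.univ.filter fun i => ¬ H i (σ x))
    rw [Finset.card_map] at h3
    have h4 := hout x
    have h5 := hin (σ x)
    rw [Finset.card_univ] at h1
    have h6 : 0 < Fintype.card ι := Fintype.card_pos_iff.2 ⟨x⟩
    omega
  have main : ∃ x y, x ∈ C σ ∧ y ∉ C σ ∧ H x (σ y) ∧ H y (σ x) := by
    by_cases h : 2 * (C σ).card ≤ Fintype.card ι
    · obtain ⟨y, h1, h2, h3⟩ := pick v₀ (C σ) h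
      exact ⟨v₀, y, by simp [C, Equiv.Perm.SameCycle.refl], h1, h2, h3⟩
    · obtain ⟨x, hx⟩ : ∃ x, x ∉ C σ := by
        by_contra hno
        push Not at hno
        exact hC (Finset.eq_univ_iff_forall.2 hno)
      obtain ⟨y, h1, h2, h3⟩ := pick x (C σ)ᶜ (by rw [Finset.card_compl]; omega)
      exact ⟨y, x, by simpa using h1, hx, h3, h2⟩
  obtain ⟨x, y, hx, hy, hxy, hyx⟩ := main
  have hx' : σ.SameCycle v₀ x := by simpa [C] using hx
  have hns : ¬ σ.SameCycle x y := by
    intro h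
    exact hy (by simpa [C] using hx'.trans h)
  set σ' := σ * Equiv.swap x y with hσ'
  have hH : ∀ i, H i (σ' i) := by
    intro i
    by_cases h1 : i = x
    · subst h1; simpa [hσ'] using hxy
    · by_cases h2 : i = y
      · subst h2; simpa [hσ'] using hyx
      · simpa [hσ', Equiv.swap_apply_of_ne_of_ne h1 h2] using hσ i
  have hmain : ∀ z, σ.SameCycle x z → σ'.SameCycle y z := fun z hz => sameCycle_mul_swap σ hns hz
  have hsub : insert y (C σ) ⊆ C σ' := by
    intro z hz
    have hv : σ'.SameCycle y v₀ := hmain v₀ hx'.symm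
    rcases Finset.mem_insert.1 hz with rfl | hz
    · simpa [C] using hv.symm
    · have hz' : σ.SameCycle v₀ z := by simpa [C] using hz
      simpa [C] using hv.symm.trans (hmain z (hx'.symm.trans hz'))
  have h1 := Finset.card_le_card hsub
  rw [Finset.card_insert_of_notMem hy] at h1
  have h2 := hmax σ' hH
  omega

/-- Greedy choice of pairwise disjoint objects. -/
theorem exists_disjoint_family {V O : Type*} [Inhabited O] (supp : O → Finset V) (L : ℕ) (N : ℕ)
    (W : Finset V) (good : ℕ → O → Prop)
    (h : ∀ i < N, ∀ W' : Finset V, W ⊆ W' → W'.card ≤ W.card + N * L →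
      ∃ o, good i o ∧ Disjoint (supp o) W' ∧ (supp o).card ≤ L) :
    ∃ f : ℕ → O, (∀ i < N, good i (f i) ∧ Disjoint (supp (f i)) W ∧ (supp (f i)).card ≤ L) ∧
      ∀ i < N, ∀ j < N, i ≠ j → Disjoint (supp (f i)) (supp (f j)) := by
  have key : ∀ k ≤ N, ∃ f : ℕ → O,
      (∀ i < k, good i (f i) ∧ Disjoint (supp (f i)) W ∧ (supp (f i)).card ≤ L) ∧
      ∀ i < k, ∀ j < k, i ≠ j → Disjoint (supp (f i)) (supp (f j)) := by
    intro k
    induction k with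
    | zero => intro _; exact ⟨fun _ => default, by simp, by simp⟩
    | succ k ih =>
      intro hk
      obtain ⟨f, hf1, hf2⟩ := ih (by omega)
      set W' := W ∪ (Finset.range k).biUnion fun i => supp (f i) with hW'
      have hc : W'.card ≤ W.card + N * L := by
        refine (Finset.card_union_le _ _).trans (Nat.add_le_add_left ?_ _)
        refine (Finset.card_biUnion_le_card_mul _ _ L ?_).trans ?_
        · intro i hi
          exact (hf1 i (Finset.mem_range.1 hi)).2.2
        · rw [Finset.card_range]
          exact Nat.mul_le_mul_right _ (by omega)
      obtain ⟨o, ho1, ho2, ho3⟩ := h k (by omega) W' Finset.subset_union_left hc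
      have hdW : Disjoint (supp o) W := ho2.mono_right Finset.subset_union_left
      have hdf : ∀ i < k, Disjoint (supp o) (supp (f i)) := by
        intro i hi
        refine ho2.mono_right (subset_trans ?_ Finset.subset_union_right)
        exact Finset.subset_biUnion_of_mem (fun i => supp (f i)) (Finset.mem_range.2 hi)
      refine ⟨Function.update f k o, ?_, ?_⟩
      · intro i hi
        by_cases hik : i = k
        · subst hik; simpa using ⟨ho1, hdW, ho3⟩
        · simpa [hik] using hf1 i (by omega)
      · intro i hi j hj hij
        by_cases hik : i = k
        · subst hik
          have : j ≠ i := fun h => hij h.symm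
          simpa [this] using hdf j (by omega)
        · by_cases hjk : j = k
          · subst hjk
            simpa [hik] using (hdf i (by omega)).symm
          · simpa [hik, hjk] using hf2 i (by omega) j (by omega) hij
  exact key N le_rfl

end Core

section Core
open scoped Classical

variable {V : Type*} [Fintype V]

/-- The out-neighbourhood as a finset. -/
noncomputable def No (G : V → V → Prop) (x : V) : Finset V := Finset.univ.filter fun y => G x y

/-- The in-neighbourhood as a finset. -/
noncomputable def Ni (G : V → V → Prop) (x : V) : Finset V := Finset.univ.filter fun y => G y x

@[simp] theorem mem_No {G : V → V → Prop} {x y : V} : y ∈ No G x ↔ G x y := by simp [No]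

@[simp] theorem mem_Ni {G : V → V → Prop} {x y : V} : y ∈ Ni G x ↔ G y x := by simp [Ni]

/-- The minimum semi-degree is at least `(3n-4)/8`. -/
def DegCond (G : V → V → Prop) : Prop :=
  ∀ x, 3 * Fintype.card V ≤ 8 * (No G x).card + 4 ∧ 3 * Fintype.card V ≤ 8 * (Ni G x).card + 4

theorem DegCond.out {G : V → V → Prop} (h : DegCond G) (x : V) :
    3 / 8 * (Fintype.card V : ℝ) - 1 / 2 ≤ (No G x).card := by
  have h1 : (3 * Fintype.card V : ℝ) ≤ 8 * (No G x).card + 4 := by exact_mod_cast (h x).1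
  linarith

theorem DegCond.inn {G : V → V → Prop} (h : DegCond G) (x : V) :
    3 / 8 * (Fintype.card V : ℝ) - 1 / 2 ≤ (Ni G x).card := by
  have h1 : (3 * Fintype.card V : ℝ) ≤ 8 * (Ni G x).card + 4 := by exact_mod_cast (h x).2
  linarith

/-- The vertices with at least `ν n` in-neighbours in `S`. -/
noncomputable def rn (ν : ℝ) (G : V → V → Prop) (S : Finset V) : Finset V :=
  Finset.univ.filter fun v => ν * Fintype.card V ≤ ((Ni G v ∩ S).card : ℝ)

/-- Robust out-expansion for sets of size between `n/4` and `3n/4`. -/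
def Expander (ν : ℝ) (G : V → V → Prop) : Prop :=
  ∀ S : Finset V, Fintype.card V ≤ 4 * S.card → 4 * S.card ≤ 3 * Fintype.card V →
    (S.card : ℝ) + ν * Fintype.card V ≤ (rn ν G S).card

theorem card_le_card_sdiff_add {α : Type*} (s t : Finset α) :
    (s.card : ℝ) ≤ (s \ t).card + t.card := by
  have := Finset.card_le_card_sdiff_add_card (s := s) (t := t)
  exact_mod_cast this

theorem card_add_card_sub_le_inter (s t : Finset V) :
    (s.card : ℝ) + t.card - Fintype.card V ≤ (s ∩ t).card := by
  have h1 := Finset.card_union_add_card_inter s t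
  have h2 := Finset.card_le_univ (s ∪ t)
  have h3 : ((s ∪ t).card : ℝ) + (s ∩ t).card = s.card + t.card := by exact_mod_cast h1
  have h4 : ((s ∪ t).card : ℝ) ≤ Fintype.card V := by exact_mod_cast h2
  linarith

/-- Vertices reachable from `x` in at most `k + 1` steps outside `W`. -/
noncomputable def reach (G : V → V → Prop) (x : V) (W : Finset V) : ℕ → Finset V
  | 0 => No G x \ W
  | k + 1 => reach G x W k ∪ (Finset.univ.filter fun z => ∃ w ∈ reach G x W k, G w z) \ W

theorem exists_list_of_mem_reach (G : V → V → Prop) (x : V) (W : Finset V) (k : ℕ) (z : V)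
    (hz : z ∈ reach G x W k) :
    ∃ p : List V, p.Nodup ∧ (∀ v ∈ p, v ∉ W) ∧ p.length ≤ k + 1 ∧ (x :: p).IsChain G ∧
      (∀ v ∈ p, v ∈ reach G x W k) ∧ p.getLast? = some z := by
  induction k generalizing z with
  | zero =>
    refine ⟨[z], by simp, ?_, by simp, ?_, by simpa using hz, by simp⟩
    · simpa [reach] using (Finset.mem_sdiff.1 hz).2
    · simpa [reach] using (Finset.mem_sdiff.1 hz).1
  | succ k ih =>
    by_cases h : z ∈ reach G x W k
    · obtain ⟨p, h1, h2, h3, h4, h5, h6⟩ := ih z h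
      exact ⟨p, h1, h2, by omega, h4, fun v hv => Finset.mem_union_left _ (h5 v hv), h6⟩
    · have hz0 := hz
      rw [reach, Finset.mem_union] at hz
      rcases hz with hz | hz
      · exact absurd hz h
      rw [Finset.mem_sdiff, Finset.mem_filter] at hz
      obtain ⟨⟨-, w, hw, hwz⟩, hzW⟩ := hz
      obtain ⟨p, h1, h2, h3, h4, h5, h6⟩ := ih w hw
      have hzp : z ∉ p := fun hh => h (h5 z hh)
      refine ⟨p ++ [z], ?_, ?_, by simp; omega, ?_, ?_, by simp⟩
      · rw [List.nodup_append]
        refine ⟨h1, by simp, ?_⟩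
        intro a ha b hb
        simp only [List.mem_singleton] at hb
        rintro rfl
        exact hzp (hb ▸ ha)
      · intro v hv
        rcases List.mem_append.1 hv with hv | hv
        · exact h2 v hv
        · simp only [List.mem_singleton] at hv
          exact hv ▸ hzW
      · rw [← List.cons_append, List.isChain_append]
        refine ⟨h4, by simp, ?_⟩
        intro a ha b hb
        have : (x :: p).getLast? = some w := by
          cases p with
          | nil => simp at h6
          | cons c p => simpa using h6
        rw [this] at ha
        simp at ha hb
        subst ha; subst hb; exact hwz
      · intro v hv
        rcases List.mem_append.1 hv with hv | hv
        · exact Finset.mem_union_left _ (h5 v hv)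
        · simp only [List.mem_singleton] at hv
          exact hv ▸ hz0

/-- In a robust expander any two vertices are joined by a short path avoiding a small set. -/
theorem exists_connecting_path {G : V → V → Prop} {ν : ℝ} (hν : 0 < ν) (hν1 : ν ≤ 1 / 10)
    (hd : DegCond G) (hE : Expander ν G) (hn : 100 ≤ Fintype.card V) {L : ℕ} (hL : 2 ≤ ν * L)
    (x y : V) (W : Finset V) (hW : (W.card : ℝ) ≤ ν / 2 * Fintype.card V) :
    ∃ p : List V, p.Nodup ∧ (∀ v ∈ p, v ∉ W) ∧ p.length ≤ L + 1 ∧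
      (x :: (p ++ [y])).IsChain G := by
  set n : ℝ := (Fintype.card V : ℝ) with hndef
  have hn' : (100 : ℝ) ≤ n := by rw [hndef]; exact_mod_cast hn
  have hgrow : ∀ k : ℕ, min (3 / 4 * n) (n / 4 + k * (ν / 2 * n)) ≤ (reach G x W k).card := by
    intro k
    induction k with
    | zero =>
      have h1 := hd.out x
      have h2 := card_le_card_sdiff_add (No G x) W
      refine (min_le_right _ _).trans ?_
      simp only [reach, Nat.cast_zero, zero_mul, add_zero]
      have : ν * n ≤ 1 / 10 * n := by gcongr
      rw [← hndef] at h1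
      linarith
    | succ k ih =>
      set R := reach G x W k with hR
      have hsub : R ⊆ reach G x W (k + 1) := Finset.subset_union_left
      have hmono : (R.card : ℝ) ≤ (reach G x W (k + 1)).card := by
        exact_mod_cast Finset.card_le_card hsub
      by_cases hbig : 3 / 4 * n ≤ R.card
      · exact (min_le_left _ _).trans (hbig.trans hmono)
      push Not at hbig
      have h1 : n / 4 + k * (ν / 2 * n) ≤ R.card := by
        rcases min_le_iff.1 ih with h | h
        · linarith
        · exact h
      have h2 : (n : ℝ) ≤ 4 * R.card := by
        have : 0 ≤ k * (ν / 2 * n) := by positivity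
        linarith
      have h3 := hE R (by rw [hndef] at h2; exact_mod_cast h2)
        (by
          have : 4 * (R.card : ℝ) ≤ 3 * n := by linarith
          rw [hndef] at this; exact_mod_cast this)
      have h4 : rn ν G R \ W ⊆ reach G x W (k + 1) := by
        intro v hv
        rw [Finset.mem_sdiff, rn, Finset.mem_filter] at hv
        obtain ⟨⟨-, hv1⟩, hv2⟩ := hv
        have hpos : (0 : ℝ) < ((Ni G v ∩ R).card : ℝ) := lt_of_lt_of_le (by positivity) hv1
        have hpos' : 0 < (Ni G v ∩ R).card := by exact_mod_cast hpos
        obtain ⟨w, hw⟩ := Finset.card_pos.1 hpos'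
        rw [Finset.mem_inter, mem_Ni] at hw
        rw [reach, Finset.mem_union, Finset.mem_sdiff, Finset.mem_filter]
        exact Or.inr ⟨⟨Finset.mem_univ _, w, hw.2, hw.1⟩, hv2⟩
      have h5 : ((rn ν G R \ W).card : ℝ) ≤ (reach G x W (k + 1)).card := by
        exact_mod_cast Finset.card_le_card h4
      have h6 := card_le_card_sdiff_add (rn ν G R) W
      refine (min_le_right _ _).trans ?_
      push_cast
      rw [← hndef] at h3
      linarith
  have h1 := hgrow L
  have h2 : 3 / 4 * n ≤ (reach G x W L).card := by
    refine le_trans (le_min le_rfl ?_) h1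
    nlinarith
  have h3 := card_add_card_sub_le_inter (reach G x W L) (Ni G y)
  have h4 := hd.inn y
  have h5 : (0 : ℝ) < ((reach G x W L ∩ Ni G y).card : ℝ) := by
    rw [← hndef] at h3 h4
    linarith
  have h5' : 0 < (reach G x W L ∩ Ni G y).card := by exact_mod_cast h5
  obtain ⟨z, hz⟩ := Finset.card_pos.1 h5'
  rw [Finset.mem_inter, mem_Ni] at hz
  obtain ⟨p, q1, q2, q3, q4, -, q6⟩ := exists_list_of_mem_reach G x W L z hz.1
  refine ⟨p, q1, q2, q3, ?_⟩
  rw [← List.cons_append, List.isChain_append]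
  refine ⟨q4, by simp, ?_⟩
  intro a ha b hb
  have : (x :: p).getLast? = some z := by
    cases p with
    | nil => simp at q6
    | cons c p => simpa using q6
  rw [this] at ha
  simp at ha hb
  subst ha; subst hb; exact hz.2

end Core

section Core
open scoped Classical

variable {V : Type*} [Fintype V]

/-- Counting pairs by their first coordinate. -/
theorem mul_le_card_filter_prod {α β : Type*} [Fintype α] [Fintype β] (P : α → Prop)
    (Q : α → β → Prop) [DecidablePred P] [∀ a, DecidablePred (Q a)]
    [DecidablePred fun t : α × β => P t.1 ∧ Q t.1 t.2] {p q : ℝ} (hq0 : 0 ≤ q)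
    (hp : p ≤ (Finset.univ.filter P).card)
    (hq : ∀ a, P a → q ≤ (Finset.univ.filter (Q a)).card) :
    p * q ≤ (Finset.univ.filter fun t : α × β => P t.1 ∧ Q t.1 t.2).card := by
  have h1 : (Finset.univ.filter fun t : α × β => P t.1 ∧ Q t.1 t.2).card =
      ∑ a ∈ Finset.univ.filter P, (Finset.univ.filter (Q a)).card := by
    rw [Finset.card_eq_sum_card_fiberwise (f := Prod.fst) (t := Finset.univ.filter P)]
    · refine Finset.sum_congr rfl fun a ha => ?_
      symm
      refine Finset.card_bij (fun b _ => (a, b)) ?_ ?_ ?_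
      · intro b hb
        simp only [Finset.mem_filter, Finset.mem_univ, true_and] at ha hb ⊢
        exact ⟨⟨ha, hb⟩, trivial⟩
      · intro b _ b' _ h
        exact (Prod.ext_iff.1 h).2
      · rintro ⟨a', b⟩ hb
        simp only [Finset.mem_filter, Finset.mem_univ, true_and] at hb ⊢
        obtain ⟨⟨h1, h2⟩, rfl⟩ := hb
        exact ⟨b, h2, rfl⟩
    · rintro ⟨a, b⟩ h
      simp only [Finset.coe_filter, Finset.mem_univ, true_and, Set.mem_ofPred_eq] at h ⊢
      exact h.1
  rw [h1]
  push_cast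
  calc p * q ≤ ((Finset.univ.filter P).card : ℝ) * q := by gcongr
    _ = ∑ a ∈ Finset.univ.filter P, q := by simp
    _ ≤ _ := Finset.sum_le_sum fun a ha => hq a (Finset.mem_filter.1 ha).2

/-- `u` and `w` have at least `β n` common out-neighbours. -/
def Cod (β : ℝ) (G : V → V → Prop) (u w : V) : Prop :=
  β * Fintype.card V ≤ ((No G u ∩ No G w).card : ℝ)

theorem Cod.symm {β : ℝ} {G : V → V → Prop} {u w : V} (h : Cod β G u w) : Cod β G w u := by
  rw [Cod, Finset.inter_comm]; exact h

theorem cod_of_three {β : ℝ} {G : V → V → Prop} (hβ : β ≤ 1 / 40) (hd : DegCond G)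
    (hn : 100 ≤ Fintype.card V) (p q r : V) : Cod β G p q ∨ Cod β G q r ∨ Cod β G p r := by
  by_contra! h
  simp only [Cod, not_le] at h
  obtain ⟨h1, h2, h3⟩ := h
  have hn' : (100 : ℝ) ≤ (Fintype.card V : ℝ) := by exact_mod_cast hn
  have e1 := hd.out p
  have e2 := hd.out q
  have e3 := hd.out r
  have a1 : (No G p ∪ No G q).card + (No G p ∩ No G q).card = (No G p).card + (No G q).card :=
    Finset.card_union_add_card_inter _ _
  have a2 := Finset.card_union_add_card_inter (No G p ∪ No G q) (No G r)
  have a3 : ((No G p ∪ No G q) ∩ No G r).card ≤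
      (No G p ∩ No G r).card + (No G q ∩ No G r).card := by
    rw [Finset.union_inter_distrib_right]; exact Finset.card_union_le _ _
  have a4 := Finset.card_le_univ (No G p ∪ No G q ∪ No G r)
  have a5 : (No G p).card + (No G q).card + (No G r).card ≤ Fintype.card V +
      ((No G p ∩ No G q).card + ((No G p ∩ No G r).card + (No G q ∩ No G r).card)) := by omega
  have a6 : ((No G p).card + (No G q).card + (No G r).card : ℝ) ≤ Fintype.card V +
      ((No G p ∩ No G q).card + ((No G p ∩ No G r).card + (No G q ∩ No G r).card)) := by
    exact_mod_cast a5
  have a7 : β * Fintype.card V ≤ 1 / 40 * Fintype.card V := by gcongr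
  linarith

theorem cod_pairs_of_large {β : ℝ} {G : V → V → Prop} (hβ : β ≤ 1 / 40) (hd : DegCond G)
    (hn : 100 ≤ Fintype.card V) (M : Finset V) :
    (M.card : ℝ) ^ 2 / 4 ≤
      (Finset.univ.filter fun t : V × V => t.1 ∈ M ∧ t.2 ∈ M ∧ Cod β G t.1 t.2).card := by
  by_cases h : ∀ p ∈ M, (M.card : ℝ) / 2 ≤ (M.filter fun q => Cod β G p q).card
  · have := mul_le_card_filter_prod (p := M.card) (q := (M.card : ℝ) / 2) (fun p => p ∈ M)
      (fun p q => q ∈ M ∧ Cod β G p q) (by positivity) (by simp)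
      (fun p hp => by
        refine (h p hp).trans (le_of_eq ?_)
        congr 2; ext; simp)
    refine le_trans ?_ this
    nlinarith [sq_nonneg (M.card : ℝ)]
  · push Not at h
    obtain ⟨p, hp, h⟩ := h
    set R := M.filter fun q => ¬ Cod β G p q with hR
    have h1 := Finset.card_filter_add_card_filter_not (s := M) (fun q => Cod β G p q)
    have h2 : ((M.filter fun q => Cod β G p q).card : ℝ) + R.card = M.card := by
      exact_mod_cast h1
    have h3 : (M.card : ℝ) / 2 ≤ R.card := by linarith
    have h4 : (R ×ˢ R) ⊆
        Finset.univ.filter fun t : V × V => t.1 ∈ M ∧ t.2 ∈ M ∧ Cod β G t.1 t.2 := by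
      rintro ⟨a, b⟩ hab
      simp only [hR, Finset.mem_product, Finset.mem_filter, Finset.mem_univ, true_and] at hab ⊢
      refine ⟨hab.1.1, hab.2.1, ?_⟩
      rcases cod_of_three hβ hd hn p a b with h | h | h
      · exact absurd h hab.1.2
      · exact h
      · exact absurd h hab.2.2
    have h5 := Finset.card_le_card h4
    rw [Finset.card_product] at h5
    have h6 : (R.card : ℝ) * R.card ≤
      (Finset.univ.filter fun t : V × V => t.1 ∈ M ∧ t.2 ∈ M ∧ Cod β G t.1 t.2).card := by
      exact_mod_cast h5
    nlinarith [sq_nonneg (M.card : ℝ)]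

theorem cod_degree {β : ℝ} {G : V → V → Prop} (hβ0 : 0 ≤ β) (hβ : β ≤ 1 / 40) (hd : DegCond G)
    (hn : 100 ≤ Fintype.card V) (y : V) :
    (Fintype.card V : ℝ) / 4 ≤ (Finset.univ.filter fun u => Cod β G y u).card := by
  set n : ℝ := (Fintype.card V : ℝ) with hndef
  have hn' : (100 : ℝ) ≤ n := by rw [hndef]; exact_mod_cast hn
  have h1 : ∑ u, ((No G y ∩ No G u).card : ℝ) = ∑ v ∈ No G y, ((Ni G v).card : ℝ) := by
    have : ∑ u, (No G y ∩ No G u).card = ∑ v ∈ No G y, (Ni G v).card := by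
      have := Finset.sum_card_bipartiteAbove_eq_sum_card_bipartiteBelow (s := Finset.univ)
        (t := No G y) (fun u v => G u v)
      convert this using 2
      · congr 1; ext v; simp [Finset.bipartiteAbove]
      · congr 1
    exact_mod_cast this
  set d : ℝ := ((No G y).card : ℝ) with hdd
  have hd1 := hd.out y
  rw [← hdd, ← hndef] at hd1
  have h2 : d * (3 / 8 * n - 1 / 2) ≤ ∑ v ∈ No G y, ((Ni G v).card : ℝ) := by
    calc d * (3 / 8 * n - 1 / 2) = ∑ v ∈ No G y, (3 / 8 * n - 1 / 2) := by
          rw [Finset.sum_const, nsmul_eq_mul]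
      _ ≤ _ := Finset.sum_le_sum fun v _ => hd.inn v
  have h3 : ∑ u, ((No G y ∩ No G u).card : ℝ) ≤
      (Finset.univ.filter fun u => Cod β G y u).card * d + n * (β * n) := by
    calc ∑ u, ((No G y ∩ No G u).card : ℝ) ≤
        ∑ u, ((if Cod β G y u then d else 0) + β * n) := by
          refine Finset.sum_le_sum fun u _ => ?_
          split_ifs with h
          · have : ((No G y ∩ No G u).card : ℝ) ≤ d := by
              rw [hdd]; exact_mod_cast Finset.card_le_card Finset.inter_subset_left
            have : 0 ≤ β * n := by positivity
            linarith
          · rw [Cod, not_le] at h; linarith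
      _ = _ := by
          rw [Finset.sum_add_distrib, ← Finset.sum_filter]; simp [hndef]
  by_contra! hc
  have h4 : d * (3 / 8 * n - 1 / 2) ≤ n / 4 * d + n * (β * n) := by
    refine h2.trans (h1 ▸ h3.trans ?_)
    have : 0 ≤ d := by positivity
    gcongr
  have h5 : n * (β * n) ≤ n * (1 / 40 * n) := by gcongr
  nlinarith

/-- The vertices with many `Cod`-neighbours among the in-neighbours of `x`. -/
noncomputable def zSet (β : ℝ) (G : V → V → Prop) (x : V) : Finset V :=
  Finset.univ.filter fun w => β * Fintype.card V ≤ (((Ni G x).filter fun u => Cod β G w u).card : ℝ)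

theorem cod_pairs {ν : ℝ} {G : V → V → Prop} (hν : 0 < ν) (hν1 : ν ≤ 1 / 100)
    (hd : DegCond G) (hE : Expander ν G) (hn : 100 ≤ Fintype.card V) (x y : V) :
    ν ^ 3 * (Fintype.card V : ℝ) ^ 2 ≤ (Finset.univ.filter fun t : V × V =>
      Cod (ν ^ 3) G y t.1 ∧ t.2 ∈ zSet (ν ^ 3) G x ∧ Cod (ν ^ 3) G t.1 t.2).card := by
  set n : ℝ := (Fintype.card V : ℝ) with hndef
  have hn' : (100 : ℝ) ≤ n := by rw [hndef]; exact_mod_cast hn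
  set β : ℝ := ν ^ 3 with hβdef
  have hβ0 : 0 < β := by positivity
  have hβ1 : β ≤ 1 / 10000 := by
    calc β ≤ (1 / 100 : ℝ) ^ 3 := by rw [hβdef]; gcongr
      _ ≤ _ := by norm_num
  have hβ : β ≤ 1 / 40 := by linarith
  have hβn : β * n ≤ 1 / 10000 * n := by gcongr
  set Y := Finset.univ.filter fun u => Cod β G y u with hY
  set Z := zSet β G x with hZ
  set X := Ni G x with hX
  have hXc := hd.inn x
  rw [← hndef, ← hX] at hXc
  have hYc : n / 4 ≤ Y.card := cod_degree hβ0.le hβ hd hn y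
  have hYq : ∀ p q, p ∉ Y → q ∉ Y → Cod β G p q := by
    intro p q hp hq
    simp only [hY, Finset.mem_filter, Finset.mem_univ, true_and] at hp hq
    rcases cod_of_three hβ hd hn y p q with h | h | h
    · exact absurd h hp
    · exact h
    · exact absurd h hq
  have hZq : ∀ p q, p ∉ Z → q ∉ Z → Cod β G p q := by
    intro p q hp hq
    simp only [hZ, zSet, Finset.mem_filter, Finset.mem_univ, true_and, not_le] at hp hq
    by_contra hpq
    have : X ⊆ (X.filter fun u => Cod β G p u) ∪ (X.filter fun u => Cod β G q u) := by
      intro w hw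
      rw [Finset.mem_union, Finset.mem_filter, Finset.mem_filter]
      rcases cod_of_three hβ hd hn p q w with h | h | h
      · exact absurd h hpq
      · exact Or.inr ⟨hw, h⟩
      · exact Or.inl ⟨hw, h⟩
    have h1 := (Finset.card_le_card this).trans (Finset.card_union_le _ _)
    have h2 : (X.card : ℝ) ≤ (X.filter fun u => Cod β G p u).card +
        (X.filter fun u => Cod β G q u).card := by exact_mod_cast h1
    linarith
  have hXZ : ((X \ Z).card : ℝ) < β * n := by
    rcases (X \ Z).eq_empty_or_nonempty with h | ⟨p, hp⟩
    · rw [h]; simp; positivity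
    · have hp2 := (Finset.mem_sdiff.1 hp).2
      have h1 : X \ Z ⊆ X.filter fun u => Cod β G p u := by
        intro q hq
        rw [Finset.mem_filter]
        exact ⟨(Finset.mem_sdiff.1 hq).1, hZq p q hp2 (Finset.mem_sdiff.1 hq).2⟩
      have h2 : ((X \ Z).card : ℝ) ≤ (X.filter fun u => Cod β G p u).card := by
        exact_mod_cast Finset.card_le_card h1
      simp only [hZ, zSet, Finset.mem_filter, Finset.mem_univ, true_and, not_le] at hp2
      exact lt_of_le_of_lt h2 hp2
  by_cases hM : n / 20 ≤ (Y ∩ Z).card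
  · have h1 := cod_pairs_of_large hβ hd hn (Y ∩ Z)
    have h2 : ((Finset.univ.filter fun t : V × V => t.1 ∈ Y ∩ Z ∧ t.2 ∈ Y ∩ Z ∧
        Cod β G t.1 t.2).card : ℝ) ≤ (Finset.univ.filter fun t : V × V =>
      Cod β G y t.1 ∧ t.2 ∈ Z ∧ Cod β G t.1 t.2).card := by
      norm_cast
      refine Finset.card_le_card fun t ht => ?_
      simp only [Finset.mem_filter, Finset.mem_univ, true_and, Finset.mem_inter, hY] at ht ⊢
      exact ⟨ht.1.1, ht.2.1.2, ht.2.2⟩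
    refine le_trans ?_ (h1.trans h2)
    have h3 : (n / 20) ^ 2 ≤ ((Y ∩ Z).card : ℝ) ^ 2 := by gcongr
    have h4 : β * n ^ 2 ≤ 1 / 10000 * n ^ 2 := by gcongr
    nlinarith [sq_nonneg n]
  push Not at hM
  have hXZ2 := card_le_card_sdiff_add X Z
  have hcover : ∀ w, w ∉ Y → w ∈ Z := by
    intro w hw
    by_contra hwZ
    have h1 : X \ Y ⊆ X.filter fun u => Cod β G w u := by
      intro q hq
      rw [Finset.mem_filter]
      exact ⟨(Finset.mem_sdiff.1 hq).1, hYq w q hw (Finset.mem_sdiff.1 hq).2⟩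
    have h2 : ((X \ Y).card : ℝ) ≤ (X.filter fun u => Cod β G w u).card := by
      exact_mod_cast Finset.card_le_card h1
    simp only [hZ, zSet, Finset.mem_filter, Finset.mem_univ, true_and, not_le] at hwZ
    have h3 : X ⊆ (X \ Y) ∪ ((X \ Z) ∪ (Y ∩ Z)) := by
      intro q hq
      simp only [Finset.mem_union, Finset.mem_sdiff, Finset.mem_inter]
      tauto
    have h4 := (Finset.card_le_card h3).trans ((Finset.card_union_le _ _).trans
      (Nat.add_le_add_left (Finset.card_union_le _ _) _))
    have h5 : (X.card : ℝ) ≤ (X \ Y).card + ((X \ Z).card + (Y ∩ Z).card) := by exact_mod_cast h4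
    linarith
  have hYZ : (Y.card : ℝ) ≤ 3 / 4 * n := by
    have h1 := Finset.card_union_add_card_inter Y Z
    have h2 := Finset.card_le_univ (Y ∪ Z)
    have h3 : ((Y ∪ Z).card : ℝ) + (Y ∩ Z).card = Y.card + Z.card := by exact_mod_cast h1
    have h4 : ((Y ∪ Z).card : ℝ) ≤ n := by rw [hndef]; exact_mod_cast h2
    linarith
  have hYcc : (Yᶜ.card : ℝ) = n - Y.card := by
    rw [Finset.card_compl, Nat.cast_sub (Finset.card_le_univ _)]
  have e1 := hE Y (by have : n ≤ 4 * (Y.card : ℝ) := by linarith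
                      rw [hndef] at this; exact_mod_cast this)
    (by have : 4 * (Y.card : ℝ) ≤ 3 * n := by linarith
        rw [hndef] at this; exact_mod_cast this)
  have e2 := hE Yᶜ (by have : n ≤ 4 * (Yᶜ.card : ℝ) := by linarith
                       rw [hndef] at this; exact_mod_cast this)
    (by have : 4 * (Yᶜ.card : ℝ) ≤ 3 * n := by linarith
        rw [hndef] at this; exact_mod_cast this)
  rw [← hndef] at e1 e2
  have e3 := card_add_card_sub_le_inter (rn ν G Y) (rn ν G Yᶜ)
  rw [← hndef] at e3
  have e4 : 2 * ν * n ≤ ((rn ν G Y ∩ rn ν G Yᶜ).card : ℝ) := by linarith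
  set R := rn ν G Y ∩ rn ν G Yᶜ with hR
  have e5 : (2 * ν * n) * (ν * n) ^ 2 ≤ ∑ v ∈ R, (((Ni G v ∩ Y) ×ˢ (Ni G v ∩ Yᶜ)).card : ℝ) := by
    calc (2 * ν * n) * (ν * n) ^ 2 ≤ R.card * (ν * n) ^ 2 := by gcongr
      _ = ∑ v ∈ R, (ν * n) ^ 2 := by simp
      _ ≤ _ := by
        refine Finset.sum_le_sum fun v hv => ?_
        rw [hR, Finset.mem_inter, rn, rn, Finset.mem_filter, Finset.mem_filter] at hv
        rw [Finset.card_product, pow_two]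
        push_cast
        exact mul_le_mul hv.1.2 hv.2.2 (by positivity) (by positivity)
  have e6 : ∑ v ∈ R, (((Ni G v ∩ Y) ×ˢ (Ni G v ∩ Yᶜ)).card : ℝ) ≤
      ∑ t ∈ Y ×ˢ Yᶜ, ((No G t.1 ∩ No G t.2).card : ℝ) := by
    have := Finset.sum_card_bipartiteAbove_eq_sum_card_bipartiteBelow (s := R)
        (t := Y ×ˢ Yᶜ) (fun v t => G t.1 v ∧ G t.2 v)
    have h2 : ∑ v ∈ R, (((Ni G v ∩ Y) ×ˢ (Ni G v ∩ Yᶜ)).card) =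
        ∑ v ∈ R, (Finset.bipartiteAbove (fun v t => G t.1 v ∧ G t.2 v) (Y ×ˢ Yᶜ) v).card := by
      refine Finset.sum_congr rfl fun v _ => ?_
      congr 1; ext t
      simp only [Finset.mem_product, Finset.mem_inter, mem_Ni, Finset.bipartiteAbove,
        Finset.mem_filter]
      tauto
    have h3 : ∑ t ∈ Y ×ˢ Yᶜ, (Finset.bipartiteBelow (fun v t => G t.1 v ∧ G t.2 v) R t).card ≤
        ∑ t ∈ Y ×ˢ Yᶜ, (No G t.1 ∩ No G t.2).card := by
      refine Finset.sum_le_sum fun t _ => Finset.card_le_card fun v hv => ?_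
      simp only [Finset.bipartiteBelow, Finset.mem_filter, Finset.mem_inter, mem_No] at hv ⊢
      exact hv.2
    exact_mod_cast (h2.trans this).le.trans h3
  set P := (Y ×ˢ Yᶜ).filter fun t => Cod β G t.1 t.2 with hP
  have e7 : ∑ t ∈ Y ×ˢ Yᶜ, ((No G t.1 ∩ No G t.2).card : ℝ) ≤ P.card * n + n ^ 2 / 4 * (β * n) := by
    calc ∑ t ∈ Y ×ˢ Yᶜ, ((No G t.1 ∩ No G t.2).card : ℝ) ≤
        ∑ t ∈ Y ×ˢ Yᶜ, ((if Cod β G t.1 t.2 then n else 0) + β * n) := by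
          refine Finset.sum_le_sum fun u _ => ?_
          split_ifs with h
          · have : ((No G u.1 ∩ No G u.2).card : ℝ) ≤ n := by
              rw [hndef]; exact_mod_cast Finset.card_le_univ _
            have : 0 ≤ β * n := by positivity
            linarith
          · rw [Cod, not_le] at h; linarith
      _ = P.card * n + (Y.card * Yᶜ.card) * (β * n) := by
          rw [Finset.sum_add_distrib, ← Finset.sum_filter]; simp [hP]
      _ ≤ _ := by
          gcongr
          rw [hYcc]
          nlinarith [sq_nonneg ((Y.card : ℝ) - n / 2)]
  have e8 : β * n ^ 2 ≤ P.card := by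
    have h1 : 2 * β * n ^ 3 ≤ P.card * n + n ^ 2 / 4 * (β * n) := by
      refine le_trans (le_of_eq ?_) (e5.trans (e6.trans e7))
      rw [hβdef]; ring
    have h2 : β * n ^ 2 * n ≤ P.card * n := by
      have : 0 ≤ β * n ^ 3 := by positivity
      linarith
    exact le_of_mul_le_mul_right h2 (by positivity)
  refine e8.trans ?_
  norm_cast
  refine Finset.card_le_card fun t ht => ?_
  simp only [hP, hY, Finset.mem_filter, Finset.mem_product, Finset.mem_univ, true_and,
    Finset.mem_compl] at ht ⊢
  refine ⟨ht.1.1, hcover _ ?_, ht.2⟩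
  simpa [hY] using ht.1.2

/-- Six distinct vertices `((((u₂, u₃), u₁), v₂), v₃), v₁`. -/
abbrev Tup (V : Type*) := ((((V × V) × V) × V) × V) × V

/-- The vertices of a tuple in the order `u₁, v₁, u₂, v₂, u₃, v₃`. -/
def tl (t : Tup V) : List V :=
  [t.1.1.1.2, t.2, t.1.1.1.1.1, t.1.1.2, t.1.1.1.1.2, t.1.2]

/-- The tuple consists of three disjoint edges `u₁v₁, u₂v₂, u₃v₃`. -/
def TupValid (G : V → V → Prop) (t : Tup V) : Prop :=
  (tl t).Nodup ∧ G t.1.1.1.2 t.2 ∧ G t.1.1.1.1.1 t.1.1.2 ∧ G t.1.1.1.1.2 t.1.2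

/-- The tuple can absorb a path from `x` to `y`. -/
def Absorbs (G : V → V → Prop) (p : V × V) (t : Tup V) : Prop :=
  G t.1.1.1.2 p.1 ∧ G p.2 t.1.1.2 ∧ G t.1.1.1.1.1 t.1.2 ∧ G t.1.1.1.1.2 t.2

theorem card_filter_avoid {P : V → Prop} [DecidablePred P] (W : Finset V) (l : List V)
    [DecidablePred fun v => P v ∧ v ∉ W ∧ v ∉ l] {b : ℝ}
    (h : b + W.card + l.length ≤ (Finset.univ.filter P).card) :
    b ≤ (Finset.univ.filter fun v => P v ∧ v ∉ W ∧ v ∉ l).card := by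
  have h1 : Finset.univ.filter P ⊆
      (Finset.univ.filter fun v => P v ∧ v ∉ W ∧ v ∉ l) ∪ (W ∪ l.toFinset) := by
    intro v hv
    simp only [Finset.mem_filter, Finset.mem_univ, true_and, Finset.mem_union,
      List.mem_toFinset] at hv ⊢
    tauto
  have h2 := (Finset.card_le_card h1).trans ((Finset.card_union_le _ _).trans
    (Nat.add_le_add_left ((Finset.card_union_le _ _).trans
      (Nat.add_le_add_left l.toFinset_card_le _)) _))
  have h3 : ((Finset.univ.filter P).card : ℝ) ≤
    (Finset.univ.filter fun v => P v ∧ v ∉ W ∧ v ∉ l).card + (W.card + l.length) := by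
    exact_mod_cast h2
  linarith

/-- Every pair has many absorbing tuples avoiding a given small set. -/
theorem many_absorbers {ν : ℝ} {G : V → V → Prop} (hν : 0 < ν) (hν1 : ν ≤ 1 / 100)
    (hd : DegCond G) (hE : Expander ν G) (hn : 100 ≤ Fintype.card V)
    (hn2 : 100 ≤ ν ^ 3 * Fintype.card V) (p : V × V) (W : Finset V)
    (hW : (W.card : ℝ) ≤ ν ^ 3 / 8 * Fintype.card V) :
    (ν ^ 3 / 2) ^ 5 * (Fintype.card V : ℝ) ^ 6 ≤ (Finset.univ.filter fun t : Tup V =>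
      Absorbs G p t ∧ TupValid G t ∧ ∀ v ∈ tl t, v ∉ W).card := by
  set n : ℝ := (Fintype.card V : ℝ) with hndef
  have hn' : (100 : ℝ) ≤ n := by rw [hndef]; exact_mod_cast hn
  set β : ℝ := ν ^ 3 with hβdef
  have hβ0 : 0 < β := by positivity
  obtain ⟨x, y⟩ := p
  let P1 : V × V → Prop := fun t => (Cod β G y t.1 ∧ t.2 ∈ zSet β G x ∧ Cod β G t.1 t.2) ∧
    t.1 ∉ W ∧ t.2 ∉ W ∧ t.1 ≠ t.2
  have c1 : β / 2 * n ^ 2 ≤ (Finset.univ.filter P1).card := by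
    have h1 := cod_pairs hν hν1 hd hE hn x y
    rw [← hβdef, ← hndef] at h1
    set Q := Finset.univ.filter fun t : V × V =>
      Cod β G y t.1 ∧ t.2 ∈ zSet β G x ∧ Cod β G t.1 t.2 with hQ
    have h2 : Q ⊆ Finset.univ.filter P1 ∪ ((W ×ˢ Finset.univ) ∪ ((Finset.univ ×ˢ W) ∪
        (Finset.univ.image fun v : V => (v, v)))) := by
      rintro ⟨a, b⟩ ht
      simp only [hQ, P1, Finset.mem_filter, Finset.mem_univ, true_and, Finset.mem_union,
        Finset.mem_product, Finset.mem_image, Prod.mk.injEq] at ht ⊢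
      by_cases h : a = b
      · subst h
        simp
      · tauto
    have h3 := (Finset.card_le_card h2).trans ((Finset.card_union_le _ _).trans
      (Nat.add_le_add_left ((Finset.card_union_le _ _).trans
      (Nat.add_le_add_left ((Finset.card_union_le _ _).trans
      (Nat.add_le_add_left Finset.card_image_le _)) _)) _))
    simp only [Finset.card_product, Finset.card_univ] at h3
    have h4 : (Q.card : ℝ) ≤ (Finset.univ.filter P1).card + (W.card * n + (n * W.card + n)) := by
      rw [hndef]; exact_mod_cast h3
    nlinarith
  let P2 : V × V → V → Prop := fun t v => (v ∈ Ni G x ∧ Cod β G t.2 v) ∧ v ∉ W ∧ v ∉ [t.1, t.2]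
  let P3 : (V × V) × V → V → Prop := fun t v => v ∈ No G y ∩ No G t.1.1 ∧ v ∉ W ∧
    v ∉ [t.1.1, t.1.2, t.2]
  let P4 : ((V × V) × V) × V → V → Prop := fun t v => v ∈ No G t.1.1.1 ∩ No G t.1.1.2 ∧ v ∉ W ∧
    v ∉ [t.1.1.1, t.1.1.2, t.1.2, t.2]
  let P5 : (((V × V) × V) × V) × V → V → Prop := fun t v =>
    v ∈ No G t.1.1.1.2 ∩ No G t.1.1.2 ∧ v ∉ W ∧ v ∉ [t.1.1.1.1, t.1.1.1.2, t.1.1.2, t.1.2, t.2]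
  have hq : (0 : ℝ) ≤ β / 2 * n := by positivity
  have c2 := mul_le_card_filter_prod P1 P2 hq c1 (by
    rintro ⟨a, b⟩ ⟨⟨h1, h2, h3⟩, -⟩
    refine card_filter_avoid W _ ?_
    simp only [zSet, Finset.mem_filter, Finset.mem_univ, true_and] at h2
    have : (Ni G x).filter (fun u => Cod β G b u) =
      Finset.univ.filter fun v => v ∈ Ni G x ∧ Cod β G b v := by ext; simp
    rw [this] at h2
    simp only [List.length_cons, List.length_nil]
    push_cast
    linarith)
  have c3 := mul_le_card_filter_prod _ P3 hq c2 (by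
    rintro ⟨⟨a, b⟩, c⟩ ⟨⟨⟨h1, h2, h3⟩, -⟩, -⟩
    refine card_filter_avoid W _ ?_
    rw [Finset.filter_mem_eq_inter, Finset.univ_inter]
    simp only [List.length_cons, List.length_nil]
    rw [Cod] at h1
    push_cast
    linarith)
  have c4 := mul_le_card_filter_prod _ P4 hq c3 (by
    rintro ⟨⟨⟨a, b⟩, c⟩, d⟩ ⟨⟨⟨⟨h1, h2, h3⟩, -⟩, -⟩, -⟩
    refine card_filter_avoid W _ ?_
    rw [Finset.filter_mem_eq_inter, Finset.univ_inter]
    simp only [List.length_cons, List.length_nil]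
    rw [Cod] at h3
    push_cast
    linarith)
  have c5 := mul_le_card_filter_prod _ P5 hq c4 (by
    rintro ⟨⟨⟨⟨a, b⟩, c⟩, d⟩, e⟩ ⟨⟨⟨-, ⟨-, h1⟩, -⟩, -⟩, -⟩
    refine card_filter_avoid W _ ?_
    rw [Finset.filter_mem_eq_inter, Finset.univ_inter]
    simp only [List.length_cons, List.length_nil]
    rw [Cod] at h1
    push_cast
    linarith)
  have c6 : (β / 2) ^ 5 * n ^ 6 = β / 2 * n ^ 2 * (β / 2 * n) * (β / 2 * n) * (β / 2 * n) *
      (β / 2 * n) := by ring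
  rw [c6]
  refine c5.trans ?_
  norm_cast
  refine Finset.card_le_card fun t ht => ?_
  obtain ⟨⟨⟨⟨⟨a, b⟩, c⟩, d⟩, e⟩, f⟩ := t
  simp only [P1, P2, P3, P4, P5, Finset.mem_filter, Finset.mem_univ, true_and, Finset.mem_inter,
    mem_No, mem_Ni, List.mem_cons, List.not_mem_nil, or_false, not_or] at ht
  simp only [Absorbs, TupValid, tl, Finset.mem_filter, Finset.mem_univ, true_and, List.nodup_cons,
    List.mem_cons, List.not_mem_nil, or_false, not_or, List.nodup_nil, forall_eq_or_imp, forall_eq,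
    not_false_eq_true, and_true]
  grind

end Core

section Core
open scoped Classical

/-- Greedy selection of disjoint objects by multiplicative weights: if every index is served by a
proportion `κ` of the objects, we can select `k` objects such that few indices are served rarely. -/
theorem exists_list_weights {I T V : Type*} [Fintype I] [Nonempty I] [Fintype T]
    (r : I → T → Prop) (valid : T → Prop) (supp : T → List V) (s N : ℕ) {κ : ℝ} (hκ : 0 < κ)
    (hκ1 : κ ≤ 1) [Nonempty T]
    (hs : ∀ t, (supp t).length ≤ s)
    (h : ∀ W : Finset V, W.card ≤ s * N → ∀ i, κ * Fintype.card T ≤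
      (Finset.univ.filter fun t => r i t ∧ valid t ∧ ∀ v ∈ supp t, v ∉ W).card) (k : ℕ)
    (hk : k ≤ N) :
    ∃ l : List T, l.length = k ∧ (∀ t ∈ l, valid t) ∧
      l.Pairwise (fun a b => (supp a).Disjoint (supp b)) ∧
      ∑ i, (1 / 2 : ℝ) ^ (l.countP fun t => r i t) ≤ Fintype.card I * (1 - κ / 2) ^ k := by
  induction k with
  | zero => exact ⟨[], by simp⟩
  | succ k ih =>
    obtain ⟨l, h1, h2, h3, h4⟩ := ih (by omega)
    set W : Finset V := (l.flatMap supp).toFinset with hW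
    have hWc : W.card ≤ s * N := by
      refine (List.toFinset_card_le _).trans ?_
      rw [List.length_flatMap]
      refine (List.sum_le_card_nsmul _ s ?_).trans ?_
      · intro x hx
        obtain ⟨t, -, rfl⟩ := List.mem_map.1 hx
        exact hs t
      · rw [List.length_map, h1, smul_eq_mul, mul_comm]
        exact Nat.mul_le_mul_left _ (by omega)
    set w : I → ℝ := fun i => (1 / 2 : ℝ) ^ (l.countP fun t => r i t) with hw
    have hwpos : ∀ i, 0 < w i := fun i => by positivity
    set A := Finset.univ.filter fun t => valid t ∧ ∀ v ∈ supp t, v ∉ W with hA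
    have e1 : κ * Fintype.card T * ∑ i, w i ≤ ∑ t ∈ A, ∑ i, if r i t then w i else 0 := by
      rw [Finset.sum_comm, Finset.mul_sum]
      refine Finset.sum_le_sum fun i _ => ?_
      rw [← Finset.sum_filter, Finset.sum_const, nsmul_eq_mul]
      refine mul_le_mul_of_nonneg_right ((h W hWc i).trans (le_of_eq ?_)) (hwpos i).le
      congr 2
      ext t
      simp only [hA, Finset.mem_filter, Finset.mem_univ, true_and]
      tauto
    obtain ⟨i0⟩ := ‹Nonempty I›
    have hTpos : (0 : ℝ) < Fintype.card T := by exact_mod_cast Fintype.card_pos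
    have hAne : A.Nonempty := by
      have := (mul_pos hκ hTpos).trans_le (h W hWc i0)
      have h0 : 0 < (Finset.univ.filter fun t => r i0 t ∧ valid t ∧ ∀ v ∈ supp t, v ∉ W).card := by
        exact_mod_cast this
      obtain ⟨t, ht⟩ := Finset.card_pos.1 h0
      refine ⟨t, ?_⟩
      simp only [hA, Finset.mem_filter, Finset.mem_univ, true_and] at ht ⊢
      exact ht.2
    have hsum : 0 ≤ ∑ i, w i := Finset.sum_nonneg fun i _ => (hwpos i).le
    obtain ⟨t, htA, ht⟩ : ∃ t ∈ A, κ * ∑ i, w i ≤ ∑ i, if r i t then w i else 0 := by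
      by_contra! hcon
      have e2 := Finset.sum_lt_sum_of_nonempty hAne hcon
      rw [Finset.sum_const, nsmul_eq_mul] at e2
      have e3 : (A.card : ℝ) ≤ Fintype.card T := by exact_mod_cast Finset.card_le_univ _
      have e4 : (A.card : ℝ) * (κ * ∑ i, w i) ≤ Fintype.card T * (κ * ∑ i, w i) := by gcongr
      nlinarith
    simp only [hA, Finset.mem_filter, Finset.mem_univ, true_and] at htA
    refine ⟨t :: l, by simp [h1], ?_, ?_, ?_⟩
    · intro t' ht'
      rcases List.mem_cons.1 ht' with rfl | ht'
      · exact htA.1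
      · exact h2 _ ht'
    · rw [List.pairwise_cons]
      refine ⟨fun b hb v hv hvb => htA.2 v hv ?_, h3⟩
      rw [hW, List.mem_toFinset, List.mem_flatMap]
      exact ⟨b, hb, hvb⟩
    · have e5 : ∀ i, (1 / 2 : ℝ) ^ ((t :: l).countP fun t => r i t) =
          w i - 1 / 2 * if r i t then w i else 0 := by
        intro i
        rw [List.countP_cons]
        by_cases hr : r i t
        · simp only [hr, decide_true, if_true, pow_succ, hw]; ring
        · simp [hr, hw]
      calc ∑ i, (1 / 2 : ℝ) ^ ((t :: l).countP fun t => r i t)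
          = ∑ i, w i - 1 / 2 * ∑ i, if r i t then w i else 0 := by
            rw [Finset.mul_sum, ← Finset.sum_sub_distrib]
            exact Finset.sum_congr rfl fun i _ => e5 i
        _ ≤ (1 - κ / 2) * ∑ i, w i := by linarith
        _ ≤ (1 - κ / 2) * (Fintype.card I * (1 - κ / 2) ^ k) := by
            gcongr; linarith
        _ = _ := by ring

/-- A term in a sum of powers of `1/2` bounded by an exponentially small quantity has a large
exponent. -/
theorem le_exponent_of_pow_le {c N : ℕ} {κ M : ℝ} (hκ1 : κ ≤ 1) (hM : 0 < M)
    (h : (1 / 2 : ℝ) ^ c ≤ M * (1 - κ / 2) ^ N) : κ / 2 * N - Real.log M ≤ c := by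
  have h1 : (1 - κ / 2) ^ N ≤ Real.exp (-(κ / 2 * N)) := by
    calc (1 - κ / 2) ^ N ≤ (Real.exp (-(κ / 2))) ^ N := by
          gcongr
          · linarith
          · have := Real.add_one_le_exp (-(κ / 2)); linarith
      _ = _ := by rw [← Real.exp_nat_mul]; ring_nf
  have h2 : Real.exp (-(c : ℝ)) ≤ (1 / 2 : ℝ) ^ c := by
    have h3 : Real.exp (-1) ≤ 1 / 2 := by
      rw [Real.exp_neg, one_div]
      have := Real.add_one_le_exp (1 : ℝ)
      gcongr
      linarith
    calc Real.exp (-(c : ℝ)) = Real.exp (-1) ^ c := by rw [← Real.exp_nat_mul]; ring_nf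
      _ ≤ _ := by gcongr
  have h3 : Real.exp (-(c : ℝ)) ≤ Real.exp (Real.log M + -(κ / 2 * N)) := by
    rw [Real.exp_add, Real.exp_log hM]
    exact h2.trans (h.trans (by gcongr))
  have h4 := Real.exp_le_exp.1 h3
  linarith

end Core

section Core
open scoped Classical

variable {V : Type*} [Fintype V]

/-- The centred indicator of the event `f y = f x + s`. -/
noncomputable def xi {t : ℕ} (s : ZMod t) (x : V) (f : V → ZMod t) (y : V) : ℝ :=
  (if f y = f x + s then 1 else 0) - 1 / t

theorem sum_xi_mul_xi {t : ℕ} [NeZero t] (s : ZMod t) {x y z : V} (hyx : y ≠ x) (hyz : y ≠ z) :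
    ∑ f : V → ZMod t, xi s x f y * xi s x f z = 0 := by
  have ht : (t : ℝ) ≠ 0 := by exact_mod_cast NeZero.ne t
  have h1 : ∀ c : ZMod t, ∑ f : V → ZMod t, xi s x f y * xi s x f z =
      ∑ f : V → ZMod t, ((if c = f x + s - f y then 1 else 0) - 1 / (t : ℝ)) * xi s x f z := by
    intro c
    rw [← Equiv.sum_comp (Equiv.addRight (Pi.single y c : V → ZMod t))]
    refine Finset.sum_congr rfl fun f _ => ?_
    have e : f y + c = f x + s ↔ c = f x + s - f y := by
      rw [eq_sub_iff_add_eq, add_comm]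
    simp only [xi, Equiv.coe_addRight, Pi.add_apply, Pi.single_eq_same,
      Pi.single_eq_of_ne hyx.symm, Pi.single_eq_of_ne hyz.symm, add_zero, e]
  have h2 : (t : ℝ) * ∑ f : V → ZMod t, xi s x f y * xi s x f z = 0 := by
    calc (t : ℝ) * ∑ f : V → ZMod t, xi s x f y * xi s x f z
        = ∑ c : ZMod t, ∑ f : V → ZMod t, xi s x f y * xi s x f z := by
          simp [ZMod.card]
      _ = ∑ c : ZMod t, ∑ f : V → ZMod t,
          ((if c = f x + s - f y then 1 else 0) - 1 / (t : ℝ)) * xi s x f z :=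
          Finset.sum_congr rfl fun c _ => h1 c
      _ = ∑ f : V → ZMod t, ∑ c : ZMod t,
          ((if c = f x + s - f y then 1 else 0) - 1 / (t : ℝ)) * xi s x f z := Finset.sum_comm
      _ = 0 := by
          refine Finset.sum_eq_zero fun f _ => ?_
          rw [← Finset.sum_mul, Finset.sum_sub_distrib]
          simp [ZMod.card, ht]
  exact (mul_eq_zero.1 h2).resolve_left ht

theorem sum_sq_sum_xi_le {t : ℕ} [NeZero t] (s : ZMod t) {x : V} (A : Finset V) (hx : x ∉ A) :
    ∑ f : V → ZMod t, (∑ y ∈ A, xi s x f y) ^ 2 ≤ Fintype.card (V → ZMod t) * A.card := by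
  have h1 : ∑ f : V → ZMod t, (∑ y ∈ A, xi s x f y) ^ 2 =
      ∑ y ∈ A, ∑ z ∈ A, ∑ f : V → ZMod t, xi s x f y * xi s x f z := by
    calc ∑ f : V → ZMod t, (∑ y ∈ A, xi s x f y) ^ 2
        = ∑ f : V → ZMod t, ∑ y ∈ A, ∑ z ∈ A, xi s x f y * xi s x f z := by
          refine Finset.sum_congr rfl fun f _ => ?_
          rw [pow_two, Finset.sum_mul_sum]
      _ = _ := by
          rw [Finset.sum_comm]
          refine Finset.sum_congr rfl fun y _ => ?_
          rw [Finset.sum_comm]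
  rw [h1]
  calc ∑ y ∈ A, ∑ z ∈ A, ∑ f : V → ZMod t, xi s x f y * xi s x f z
      ≤ ∑ y ∈ A, (Fintype.card (V → ZMod t) : ℝ) := by
        refine Finset.sum_le_sum fun y hy => ?_
        rw [Finset.sum_eq_single_of_mem y hy]
        · calc ∑ f : V → ZMod t, xi s x f y * xi s x f y ≤ ∑ f : V → ZMod t, (1 : ℝ) := by
                refine Finset.sum_le_sum fun f _ => ?_
                have ht : (1 : ℝ) ≤ t := by exact_mod_cast NeZero.one_le
                have h0 : (0 : ℝ) ≤ 1 / t := by positivity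
                have h2 : (1 : ℝ) / t ≤ 1 := by rw [div_le_one (by linarith)]; exact ht
                unfold xi
                split_ifs <;> nlinarith
            _ = _ := by simp
        · intro z _ hz
          exact sum_xi_mul_xi s (fun h => hx (h ▸ hy)) (Ne.symm hz)
    _ = _ := by rw [Finset.sum_const, nsmul_eq_mul, mul_comm]

/-- A random `ZMod t`-labelling splits a regular digraph evenly. -/
theorem exists_even_labelling {F : V → V → Prop} {U : Finset V} {r t : ℕ} [NeZero t]
    (hF : ∀ x ∈ U, (No F x).card = r ∧ (Ni F x).card = r) (hl : ∀ x, ¬ F x x) :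
    ∃ f : V → ZMod t, ∑ x ∈ U, ((∑ y ∈ No F x, xi 1 x f y) ^ 2 + (∑ y ∈ Ni F x, xi (-1) x f y) ^ 2)
      ≤ 2 * U.card * r := by
  have h1 : ∑ f : V → ZMod t, ∑ x ∈ U,
      ((∑ y ∈ No F x, xi 1 x f y) ^ 2 + (∑ y ∈ Ni F x, xi (-1) x f y) ^ 2) ≤
      ∑ f : V → ZMod t, (2 * U.card * r : ℝ) := by
    rw [Finset.sum_comm]
    calc _ ≤ ∑ x ∈ U, (2 * (Fintype.card (V → ZMod t) : ℝ) * r) := by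
          refine Finset.sum_le_sum fun x hx => ?_
          rw [Finset.sum_add_distrib]
          have a1 := sum_sq_sum_xi_le (1 : ZMod t) (No F x) (x := x) (by simpa using hl x)
          have a2 := sum_sq_sum_xi_le (-1 : ZMod t) (Ni F x) (x := x) (by simpa using hl x)
          rw [(hF x hx).1] at a1
          rw [(hF x hx).2] at a2
          linarith
      _ = _ := by
          rw [Finset.sum_const, Finset.sum_const, nsmul_eq_mul, nsmul_eq_mul, Finset.card_univ]
          ring
  obtain ⟨f, -, hf⟩ := Finset.exists_le_of_sum_le Finset.univ_nonempty h1
  exact ⟨f, hf⟩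

/-- Hall's theorem with deficiency. -/
theorem exists_partial_matching {R : V → V → Prop} {U : Finset V} {D : ℕ}
    (h : ∀ S ⊆ U, S.card ≤ (Finset.univ.filter fun y => ∃ x ∈ S, R x y).card + D) :
    ∃ E : V → V → Prop, (∀ x y, E x y → R x y) ∧ (∀ x y y', E x y → E x y' → y = y') ∧
      (∀ x x' y, E x y → E x' y → x = x') ∧ (U.filter fun x => ∀ y, ¬ E x y).card ≤ D := by
  let t : U → Finset (V ⊕ Fin D) := fun x =>
    (Finset.univ.filter fun y => R x y).disjSum Finset.univ
  have hall : ∀ S : Finset U, S.card ≤ (S.biUnion t).card := by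
    intro S
    rcases S.eq_empty_or_nonempty with rfl | ⟨s0, hs0⟩
    · simp
    have h1 := h (S.map (Function.Embedding.subtype _)) (by
      intro v hv
      rw [Finset.mem_map] at hv
      obtain ⟨w, -, rfl⟩ := hv
      exact w.2)
    rw [Finset.card_map] at h1
    have h2 : (Finset.univ.filter fun y =>
        ∃ x ∈ S.map (Function.Embedding.subtype _), R x y).disjSum (Finset.univ : Finset (Fin D))
        ⊆ S.biUnion t := by
      intro z hz
      rw [Finset.mem_biUnion]
      rw [Finset.mem_disjSum] at hz
      rcases hz with ⟨y, hy, rfl⟩ | ⟨d, -, rfl⟩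
      · simp only [Finset.mem_filter, Finset.mem_univ, true_and, Finset.mem_map] at hy
        obtain ⟨x, ⟨x', hx', rfl⟩, hR⟩ := hy
        exact ⟨x', hx', by simpa [t] using hR⟩
      · exact ⟨s0, hs0, by simp [t]⟩
    have h3 := Finset.card_le_card h2
    rw [Finset.card_disjSum, Finset.card_univ, Fintype.card_fin] at h3
    omega
  obtain ⟨g, hg, hgt⟩ := (Finset.all_card_le_biUnion_card_iff_exists_injective t).1 hall
  refine ⟨fun x y => ∃ hx : x ∈ U, g ⟨x, hx⟩ = Sum.inl y, ?_, ?_, ?_, ?_⟩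
  · rintro x y ⟨hx, hxy⟩
    have := hgt ⟨x, hx⟩
    rw [hxy] at this
    simpa [t] using this
  · rintro x y y' ⟨hx, h1⟩ ⟨hx', h2⟩
    rw [h1] at h2
    exact Sum.inl_injective h2
  · rintro x x' y ⟨hx, h1⟩ ⟨hx', h2⟩
    have := hg (h1.trans h2.symm)
    exact congrArg Subtype.val this
  · have key : ∀ x : V, ∃ d : Option (Fin D), x ∈ U.filter (fun x => ∀ y,
        ¬ ∃ hx : x ∈ U, g ⟨x, hx⟩ = Sum.inl y) → ∃ hx : x ∈ U, ∃ d', d = some d' ∧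
        g ⟨x, hx⟩ = Sum.inr d' := by
      intro x
      by_cases hx : x ∈ U
      · rcases hgx : g ⟨x, hx⟩ with y | d
        · refine ⟨none, fun h => ?_⟩
          exact absurd ⟨hx, hgx⟩ ((Finset.mem_filter.1 h).2 y)
        · exact ⟨some d, fun _ => ⟨hx, d, rfl, hgx⟩⟩
      · exact ⟨none, fun h => absurd (Finset.mem_filter.1 h).1 hx⟩
    choose d hd using key
    have h1 : (U.filter (fun x => ∀ y, ¬ ∃ hx : x ∈ U, g ⟨x, hx⟩ = Sum.inl y)).card ≤
        ((Finset.univ : Finset (Fin D)).map Function.Embedding.some).card := by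
      refine Finset.card_le_card_of_injOn d ?_ ?_
      · intro x hx
        obtain ⟨_, d', h, _⟩ := hd x hx
        simp [h]
      · intro x hx x' hx' hxx
        obtain ⟨h1, d1, h2, h3⟩ := hd x hx
        obtain ⟨h1', d1', h2', h3'⟩ := hd x' hx'
        rw [h2, h2'] at hxx
        cases hxx
        exact congrArg Subtype.val (hg (h3.trans h3'.symm))
    simpa using h1

/-- A relation with in- and out-degrees at most one along which a height increases decomposes into
paths. -/
theorem exists_path_decomposition {α : Type*} {E : α → α → Prop} (hgt : α → ℕ)
    (h1 : ∀ x y y', E x y → E x y' → y = y')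
    (h3 : ∀ x y, E x y → hgt x < hgt y) (s : Finset α) :
    ∃ Ls : List (List α), (∀ l ∈ Ls, l ≠ [] ∧ l.IsChain E) ∧ Ls.flatten.Nodup ∧
      (∀ v, v ∈ Ls.flatten ↔ v ∈ s) ∧ Ls.length = (s.filter fun y => ∀ x ∈ s, ¬ E x y).card ∧
      ∀ x ∈ s, (∀ y ∈ s, ¬ E x y) → ∃ l ∈ Ls, l.getLast? = some x := by
  induction s using Finset.induction_on_max_value hgt with
  | empty => exact ⟨[], by simp⟩
  | insert y s hys hmax ih =>
    obtain ⟨Ls, a1, a2, a3, a4, a5⟩ := ih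
    have hno : ∀ x ∈ insert y s, ¬ E y x := by
      intro x hx hyx
      have := h3 _ _ hyx
      rcases Finset.mem_insert.1 hx with rfl | hx
      · omega
      · have := hmax x hx; omega
    have hfil : ∀ z ∈ s, ((∀ x ∈ insert y s, ¬ E x z) ↔ ∀ x ∈ s, ¬ E x z) := by
      intro z hz
      rw [Finset.forall_mem_insert]
      exact ⟨fun h => h.2, fun h => ⟨hno z (Finset.mem_insert_of_mem hz), h⟩⟩
    have hyy : ¬ E y y := hno y (Finset.mem_insert_self _ _)
    by_cases hpred : ∃ x ∈ s, E x y
    · obtain ⟨x, hx, hxy⟩ := hpred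
      obtain ⟨l, hl, hlx⟩ := a5 x hx (fun z hz hxz => hys (h1 x y z hxy hxz ▸ hz))
      have hperm := List.perm_cons_erase hl
      have hfp : Ls.flatten.Perm (l ++ (Ls.erase l).flatten) := by
        simpa using hperm.flatten
      have hperm2 : (((l ++ [y]) :: Ls.erase l).flatten).Perm (y :: Ls.flatten) := by
        simp only [List.flatten_cons, List.append_assoc, List.singleton_append]
        exact List.perm_middle.trans ((hfp.symm).cons y)
      refine ⟨(l ++ [y]) :: Ls.erase l, ?_, ?_, ?_, ?_, ?_⟩
      · intro l' hl'
        rcases List.mem_cons.1 hl' with rfl | hl'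
        · refine ⟨by simp, ?_⟩
          rw [List.isChain_append]
          refine ⟨(a1 l hl).2, by simp, ?_⟩
          intro a ha b hb
          rw [hlx] at ha
          simp at ha hb
          subst ha; subst hb; exact hxy
        · exact a1 l' (List.mem_of_mem_erase hl')
      · rw [hperm2.nodup_iff, List.nodup_cons]
        exact ⟨fun h => hys ((a3 y).1 h), a2⟩
      · intro v
        rw [hperm2.mem_iff, List.mem_cons, a3, Finset.mem_insert]
      · have e1 : (insert y s).filter (fun y' => ∀ x ∈ insert y s, ¬ E x y') =
            s.filter (fun y => ∀ x ∈ s, ¬ E x y) := by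
          ext z
          rw [Finset.mem_filter, Finset.mem_filter, Finset.mem_insert]
          constructor
          · rintro ⟨rfl | hz, hz2⟩
            · exact absurd hxy (hz2 x (Finset.mem_insert_of_mem hx))
            · exact ⟨hz, (hfil z hz).1 hz2⟩
          · rintro ⟨hz, hz2⟩
            exact ⟨Or.inr hz, (hfil z hz).2 hz2⟩
        rw [e1, ← a4, hperm.length_eq]; simp
      · intro z hz hz2
        rcases Finset.mem_insert.1 hz with rfl | hz
        · exact ⟨l ++ [z], by simp, by simp⟩
        · obtain ⟨l', hl', hlz⟩ := a5 z hz (fun w hw => hz2 w (Finset.mem_insert_of_mem hw))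
          refine ⟨l', ?_, hlz⟩
          have hne : l' ≠ l := by
            rintro rfl
            rw [hlx] at hlz
            cases hlz
            exact hz2 y (Finset.mem_insert_self _ _) hxy
          exact List.mem_cons_of_mem _ ((List.mem_erase_of_ne hne).2 hl')
    · push Not at hpred
      refine ⟨[y] :: Ls, ?_, ?_, ?_, ?_, ?_⟩
      · intro l' hl'
        rcases List.mem_cons.1 hl' with rfl | hl'
        · simp
        · exact a1 l' hl'
      · simp only [List.flatten_cons, List.singleton_append, List.nodup_cons]
        exact ⟨fun h => hys ((a3 y).1 h), a2⟩
      · intro v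
        simp only [List.flatten_cons, List.singleton_append, List.mem_cons, a3, Finset.mem_insert]
      · have e1 : (insert y s).filter (fun y' => ∀ x ∈ insert y s, ¬ E x y') =
            insert y (s.filter (fun y => ∀ x ∈ s, ¬ E x y)) := by
          ext z
          rw [Finset.mem_filter, Finset.mem_insert, Finset.mem_insert, Finset.mem_filter]
          constructor
          · rintro ⟨rfl | hz, hz2⟩
            · exact Or.inl rfl
            · exact Or.inr ⟨hz, (hfil z hz).1 hz2⟩
          · rintro (rfl | ⟨hz, hz2⟩)
            · refine ⟨Or.inl rfl, ?_⟩
              rw [Finset.forall_mem_insert]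
              exact ⟨hyy, hpred⟩
            · exact ⟨Or.inr hz, (hfil z hz).2 hz2⟩
        rw [e1, Finset.card_insert_of_notMem (fun h => hys (Finset.mem_filter.1 h).1), ← a4]
        simp
      · intro z hz hz2
        rcases Finset.mem_insert.1 hz with rfl | hz
        · exact ⟨[z], by simp, by simp⟩
        · obtain ⟨l', hl', hlz⟩ := a5 z hz (fun w hw => hz2 w (Finset.mem_insert_of_mem hw))
          exact ⟨l', List.mem_cons_of_mem _ hl', hlz⟩

end Core

section Core
open scoped Classical

variable {V : Type*} [Fintype V]

theorem card_filter_eq_add_sum_xi {α : Type*} {t : ℕ} (s : ZMod t) (x : α) (f : α → ZMod t)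
    (A : Finset α) :
    ((A.filter fun y => f y = f x + s).card : ℝ) = A.card / t + ∑ y ∈ A, xi s x f y := by
  simp only [xi, Finset.sum_sub_distrib, Finset.sum_const, nsmul_eq_mul]
  rw [Finset.sum_ite, Finset.sum_const_zero, Finset.sum_const, nsmul_eq_mul]
  ring

theorem val_lt_val_add_one {t : ℕ} [NeZero t] (a : ZMod t) (h : a + 1 ≠ 0) :
    a.val < (a + 1).val := by
  have e : a + 1 = ((a.val + 1 : ℕ) : ZMod t) := by push_cast; rw [ZMod.natCast_zmod_val]
  have hlt := ZMod.val_lt a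
  rcases Nat.lt_or_ge (a.val + 1) t with h1 | h1
  · rw [e, ZMod.val_cast_of_lt h1]; omega
  · have h2 : a.val + 1 = t := by omega
    rw [h2, ZMod.natCast_self] at e
    exact absurd e h

theorem abs_le_half_add {a c : ℝ} (hc : 0 < c) : |a| ≤ c / 2 + a ^ 2 / (2 * c) := by
  have h : 0 ≤ (|a| - c) ^ 2 / (2 * c) := by positivity
  have e : (|a| - c) ^ 2 / (2 * c) = c / 2 + a ^ 2 / (2 * c) - |a| := by
    rw [sub_sq, sq_abs]; field_simp; ring
  linarith

/-- A regular digraph of linear degree has a spanning linear forest with few components. -/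
theorem exists_path_cover {F : V → V → Prop} {U : Finset V} {r t : ℕ} [NeZero t] (hr : 0 < r)
    (hF : ∀ x ∈ U, (No F x).card = r ∧ (Ni F x).card = r) (hU : ∀ x y, F x y → x ∈ U ∧ y ∈ U)
    (hl : ∀ x, ¬ F x x) {c : ℝ} (hc : 0 < c) :
    ∃ Ls : List (List V), (∀ l ∈ Ls, l ≠ [] ∧ l.IsChain F) ∧ Ls.flatten.Nodup ∧
      (∀ v, v ∈ Ls.flatten ↔ v ∈ U) ∧
      (Ls.length : ℝ) ≤ t / r * (U.card * c + U.card * r / c) + U.card / t := by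
  obtain ⟨f, hf⟩ := exists_even_labelling (t := t) hF hl
  set m : ℝ := (U.card : ℝ) with hm
  have ht0 : (0 : ℝ) < t := by exact_mod_cast Nat.pos_of_neZero t
  have hr0 : (0 : ℝ) < r := by exact_mod_cast hr
  set dp : V → ℝ := fun x => ∑ y ∈ No F x, xi 1 x f y with hdp
  set dm : V → ℝ := fun x => ∑ y ∈ Ni F x, xi (-1) x f y with hdm
  have hdev : ∑ x ∈ U, (|dp x| + |dm x|) ≤ m * c + m * r / c := by
    calc ∑ x ∈ U, (|dp x| + |dm x|) ≤ ∑ x ∈ U, (c + (dp x ^ 2 + dm x ^ 2) / (2 * c)) := by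
          refine Finset.sum_le_sum fun x _ => ?_
          have h1 := abs_le_half_add (a := dp x) hc
          have h2 := abs_le_half_add (a := dm x) hc
          rw [add_div]; linarith
      _ = m * c + (∑ x ∈ U, (dp x ^ 2 + dm x ^ 2)) / (2 * c) := by
          rw [Finset.sum_add_distrib, Finset.sum_div]; simp [hm]
      _ ≤ m * c + (2 * m * r) / (2 * c) := by gcongr
      _ = _ := by rw [mul_assoc, mul_div_mul_left _ _ two_ne_zero]
  set B : ℝ := t / r * (m * c + m * r / c) with hB
  have hB0 : 0 ≤ B := by positivity
  obtain ⟨E, E1, -, E3, E4⟩ := exists_partial_matching (R := fun x y => F y x ∧ f x = f y + 1)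
    (U := U) (D := ⌊B⌋₊) (by
      intro S hS
      set N := Finset.univ.filter fun y => ∃ x ∈ S, F y x ∧ f x = f y + 1 with hN
      have hNU : N ⊆ U := by
        intro y hy
        obtain ⟨x, -, hx, -⟩ := (Finset.mem_filter.1 hy).2
        exact (hU _ _ hx).1
      have k1 : ∑ x ∈ S, (((Ni F x).filter fun y => f y = f x + -1).card : ℝ) ≤
          ∑ y ∈ N, (((No F y).filter fun x => f x = f y + 1).card : ℝ) := by
        have e := Finset.sum_card_bipartiteAbove_eq_sum_card_bipartiteBelow (s := S) (t := N)
          (fun x y => F y x ∧ f x = f y + 1)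
        have e1 : ∑ x ∈ S, ((Ni F x).filter fun y => f y = f x + -1).card =
            ∑ x ∈ S, (Finset.bipartiteAbove (fun x y => F y x ∧ f x = f y + 1) N x).card := by
          refine Finset.sum_congr rfl fun x hx => ?_
          congr 1; ext y
          have e3 : f y = f x + -1 ↔ f x = f y + 1 := by
            rw [← sub_eq_add_neg, eq_sub_iff_add_eq, eq_comm]
          simp only [Finset.mem_filter, mem_Ni, Finset.bipartiteAbove, hN, Finset.mem_univ,
            true_and, e3]
          exact ⟨fun h => ⟨⟨x, hx, h⟩, h⟩, fun h => h.2⟩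
        have e2 : ∑ y ∈ N, (Finset.bipartiteBelow (fun x y => F y x ∧ f x = f y + 1) S y).card ≤
            ∑ y ∈ N, ((No F y).filter fun x => f x = f y + 1).card := by
          refine Finset.sum_le_sum fun y _ => Finset.card_le_card fun x hx => ?_
          simp only [Finset.bipartiteBelow, Finset.mem_filter, mem_No] at hx ⊢
          exact hx.2
        exact_mod_cast (e1.trans e).le.trans e2
      have k2 : ∑ x ∈ S, (((Ni F x).filter fun y => f y = f x + -1).card : ℝ) =
          S.card * (r / t) + ∑ x ∈ S, dm x := by
        rw [← nsmul_eq_mul, ← Finset.sum_const, ← Finset.sum_add_distrib]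
        refine Finset.sum_congr rfl fun x hx => ?_
        rw [card_filter_eq_add_sum_xi, (hF x (hS hx)).2]
      have k3 : ∑ y ∈ N, (((No F y).filter fun x => f x = f y + 1).card : ℝ) =
          N.card * (r / t) + ∑ y ∈ N, dp y := by
        rw [← nsmul_eq_mul, ← Finset.sum_const, ← Finset.sum_add_distrib]
        refine Finset.sum_congr rfl fun y hy => ?_
        rw [card_filter_eq_add_sum_xi, (hF y (hNU hy)).1]
      rw [k2, k3] at k1
      have k4 : -∑ x ∈ S, dm x ≤ ∑ x ∈ U, |dm x| := by
        rw [← Finset.sum_neg_distrib]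
        calc ∑ x ∈ S, -dm x ≤ ∑ x ∈ S, |dm x| := Finset.sum_le_sum fun x _ => neg_le_abs _
          _ ≤ _ := Finset.sum_le_sum_of_subset_of_nonneg hS fun _ _ _ => abs_nonneg _
      have k5 : ∑ y ∈ N, dp y ≤ ∑ x ∈ U, |dp x| := by
        calc ∑ y ∈ N, dp y ≤ ∑ y ∈ N, |dp y| := Finset.sum_le_sum fun x _ => le_abs_self _
          _ ≤ _ := Finset.sum_le_sum_of_subset_of_nonneg hNU fun _ _ _ => abs_nonneg _
      rw [Finset.sum_add_distrib] at hdev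
      have k6 : ((S.card : ℝ) - N.card) * (r / t) ≤ m * c + m * r / c := by linarith
      have k7 : (S.card : ℝ) - N.card ≤ B := by
        rw [hB]
        calc (S.card : ℝ) - N.card = t / r * (((S.card : ℝ) - N.card) * (r / t)) := by
              field_simp
          _ ≤ _ := by gcongr
      suffices hSN : S.card ≤ N.card + ⌊B⌋₊ by convert hSN
      rcases le_total S.card N.card with h | h
      · omega
      · have k8 : ((S.card - N.card : ℕ) : ℝ) ≤ B := by rw [Nat.cast_sub h]; exact k7
        have := Nat.le_floor k8
        omega)
  obtain ⟨a, -, ha⟩ : ∃ a ∈ (Finset.univ : Finset (ZMod t)),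
      (t : ℝ) * (U.filter fun x => f x = a).card ≤ m := by
    by_contra! hcon
    have h1 := Finset.sum_lt_sum_of_nonempty Finset.univ_nonempty hcon
    rw [← Finset.mul_sum, Finset.sum_const, nsmul_eq_mul, Finset.card_univ, ZMod.card] at h1
    have h2 := Finset.card_eq_sum_card_fiberwise (f := f) (s := U) (t := Finset.univ) (by simp)
    have h3 : (U.card : ℝ) = ∑ b : ZMod t, ((U.filter fun x => f x = b).card : ℝ) := by
      exact_mod_cast h2
    rw [← h3] at h1
    exact lt_irrefl _ h1
  obtain ⟨Ls, b1, b2, b3, b4, -⟩ := exists_path_decomposition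
    (E := fun x y => E y x ∧ f y ≠ a) (fun x => (f x - a).val)
    (fun x y y' h h' => E3 _ _ _ h.1 h'.1)
    (by
      rintro x y ⟨h1, h2⟩
      have h3 := (E1 _ _ h1).2
      have h4 : f y - a = (f x - a) + 1 := by rw [h3]; ring
      rw [h4]
      refine val_lt_val_add_one _ ?_
      rw [← h4]
      exact sub_ne_zero.2 h2) U
  refine ⟨Ls, fun l hl => ⟨(b1 l hl).1, (b1 l hl).2.imp fun x y h => (E1 _ _ h.1).1⟩, b2, b3, ?_⟩
  have h1 : (U.filter fun y => ∀ x ∈ U, ¬ (E y x ∧ f y ≠ a)) ⊆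
      (U.filter fun y => ∀ x, ¬ E y x) ∪ U.filter fun x => f x = a := by
    intro y hy
    simp only [Finset.mem_filter, Finset.mem_union] at hy ⊢
    by_cases h : f y = a
    · exact Or.inr ⟨hy.1, h⟩
    · refine Or.inl ⟨hy.1, fun x hx => hy.2 x ?_ ⟨hx, h⟩⟩
      exact (hU _ _ (E1 _ _ hx).1).1
  have h2 : Ls.length ≤ ⌊B⌋₊ + (U.filter fun x => f x = a).card := by
    rw [b4]
    refine le_trans (le_of_eq (by congr)) <| (Finset.card_le_card h1).trans ((Finset.card_union_le _ _).trans
      (Nat.add_le_add_right E4 _))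
  have h3 : (Ls.length : ℝ) ≤ ⌊B⌋₊ + (U.filter fun x => f x = a).card := by exact_mod_cast h2
  have h4 := Nat.floor_le hB0
  have h5 : ((U.filter fun x => f x = a).card : ℝ) ≤ m / t := by
    rw [le_div_iff₀ ht0, mul_comm]; exact ha
  linarith

/-- After deleting a few vertices, a robust expander has a regular spanning subgraph. -/
theorem exists_regular_subgraph {G : V → V → Prop} {ν : ℝ} (hν : 0 < ν) (hν1 : ν ≤ 1 / 100)
    (hd : DegCond G) (hE : Expander ν G) (hn : 100 ≤ Fintype.card V) (U : Finset V)
    (hU : (Uᶜ.card : ℝ) ≤ ν / 8 * Fintype.card V) (r : ℕ) (hr : (r : ℝ) ≤ ν / 8 * Fintype.card V) :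
    ∃ F : V → V → Prop, (∀ x y, F x y → G x y ∧ x ∈ U ∧ y ∈ U) ∧
      ∀ x ∈ U, (No F x).card = r ∧ (Ni F x).card = r := by
  set n : ℝ := (Fintype.card V : ℝ) with hndef
  have hn' : (100 : ℝ) ≤ n := by rw [hndef]; exact_mod_cast hn
  have hνn : ν * n ≤ 1 / 100 * n := by gcongr
  induction r with
  | zero =>
    exact ⟨fun _ _ => False, by simp, by simp [No, Ni]⟩
  | succ r ih =>
    push_cast at hr
    obtain ⟨F, F1, F2⟩ := ih (by linarith)
    let t : U → Finset V := fun u => (No G u ∩ U) \ No F u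
    have hall : ∀ S : Finset U, S.card ≤ (S.biUnion t).card := by
      intro S
      rcases S.eq_empty_or_nonempty with rfl | ⟨s0, hs0⟩
      · simp
      set S' : Finset V := S.map (Function.Embedding.subtype _) with hS'
      have hSc : S'.card = S.card := Finset.card_map _
      have hS'U : S' ⊆ U := by
        intro v hv
        rw [hS', Finset.mem_map] at hv
        obtain ⟨w, -, rfl⟩ := hv
        exact w.2
      have hmem : ∀ v ∈ U, (r : ℝ) < (Ni G v ∩ S').card → v ∈ S.biUnion t := by
        intro v hvU hv
        have h1 : ¬ (Ni G v ∩ S' ⊆ Ni F v) := by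
          intro h
          have := Finset.card_le_card h
          rw [(F2 v hvU).2] at this
          have : ((Ni G v ∩ S').card : ℝ) ≤ r := by exact_mod_cast this
          linarith
        obtain ⟨w, hw, hwF⟩ := Finset.not_subset.1 h1
        rw [Finset.mem_inter, mem_Ni, hS', Finset.mem_map] at hw
        obtain ⟨hwv, w', hw', rfl⟩ := hw
        rw [Finset.mem_biUnion]
        refine ⟨w', hw', ?_⟩
        simp only [t, Finset.mem_sdiff, Finset.mem_inter, mem_No]
        exact ⟨⟨hwv, hvU⟩, by simpa using hwF⟩
      by_cases hsmall : (S.card : ℝ) < n / 4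
      · have h1 : t s0 ⊆ S.biUnion t := Finset.subset_biUnion_of_mem t hs0
        have h2 : No G s0 ⊆ (t s0) ∪ (Uᶜ ∪ No F s0) := by
          intro v hv
          simp only [t, Finset.mem_union, Finset.mem_sdiff, Finset.mem_inter, Finset.mem_compl]
          tauto
        have h3 := (Finset.card_le_card h2).trans ((Finset.card_union_le _ _).trans
          (Nat.add_le_add_left (Finset.card_union_le _ _) _))
        rw [(F2 _ s0.2).1] at h3
        have h4 : ((No G s0).card : ℝ) ≤ (t s0).card + (Uᶜ.card + r) := by exact_mod_cast h3
        have h5 := hd.out s0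
        rw [← hndef] at h5
        have h6 : (S.card : ℝ) ≤ (t s0).card := by linarith
        have h7 : S.card ≤ (t s0).card := by exact_mod_cast h6
        exact h7.trans (Finset.card_le_card h1)
      push Not at hsmall
      have hUc : (U.card : ℝ) = n - Uᶜ.card := by
        rw [Finset.card_compl, Nat.cast_sub (Finset.card_le_univ _)]; ring
      by_cases hmid : 4 * (S.card : ℝ) ≤ 3 * n
      · have h1 := hE S' (by
          have : n ≤ 4 * (S'.card : ℝ) := by rw [hSc]; linarith
          rw [hndef] at this; exact_mod_cast this) (by
          rw [hSc]; rw [hndef] at hmid; exact_mod_cast hmid)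
        have h2 : rn ν G S' \ Uᶜ ⊆ S.biUnion t := by
          intro v hv
          rw [Finset.mem_sdiff, rn, Finset.mem_filter, Finset.mem_compl, not_not] at hv
          refine hmem v hv.2 (lt_of_lt_of_le ?_ hv.1.2)
          rw [← hndef]
          nlinarith
        have h3 : ((rn ν G S' \ Uᶜ).card : ℝ) ≤ (S.biUnion t).card := by
          exact_mod_cast Finset.card_le_card h2
        have h4 := card_le_card_sdiff_add (rn ν G S') Uᶜ
        rw [hSc, ← hndef] at h1
        have h5 : (S.card : ℝ) ≤ (S.biUnion t).card := by nlinarith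
        exact_mod_cast h5
      · push Not at hmid
        have h2 : U ⊆ S.biUnion t := by
          intro v hv
          refine hmem v hv ?_
          have h3 := card_add_card_sub_le_inter (Ni G v) S'
          have h4 := hd.inn v
          rw [hSc, ← hndef] at h3
          rw [← hndef] at h4
          linarith
        rw [← hSc]
        exact (Finset.card_le_card hS'U).trans (Finset.card_le_card h2)
    obtain ⟨g, hg, hgt⟩ := (Finset.all_card_le_biUnion_card_iff_exists_injective t).1 hall
    have hgU : ∀ u, g u ∈ U := fun u => (Finset.mem_inter.1 (Finset.mem_sdiff.1 (hgt u)).1).2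
    let e : U → U := fun u => ⟨g u, hgU u⟩
    have he : Function.Injective e := fun a b h => hg (congrArg Subtype.val h)
    have hes : Function.Surjective e := Finite.injective_iff_surjective.1 he
    refine ⟨fun x y => F x y ∨ ∃ hx : x ∈ U, g ⟨x, hx⟩ = y, ?_, ?_⟩
    · rintro x y (h | ⟨hx, rfl⟩)
      · exact F1 x y h
      · have := hgt ⟨x, hx⟩
        simp only [t, Finset.mem_sdiff, Finset.mem_inter, mem_No] at this
        exact ⟨this.1.1, hx, this.1.2⟩
    · intro x hx
      constructor
      · have h1 : No (fun x y => F x y ∨ ∃ hx : x ∈ U, g ⟨x, hx⟩ = y) x =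
            insert (g ⟨x, hx⟩) (No F x) := by
          ext y
          simp only [mem_No, Finset.mem_insert]
          constructor
          · rintro (h | ⟨_, rfl⟩)
            · exact Or.inr h
            · exact Or.inl rfl
          · rintro (rfl | h)
            · exact Or.inr ⟨hx, rfl⟩
            · exact Or.inl h
        rw [h1, Finset.card_insert_of_notMem (Finset.mem_sdiff.1 (hgt ⟨x, hx⟩)).2, (F2 x hx).1]
      · obtain ⟨w, hw⟩ := hes ⟨x, hx⟩
        have hw' : g w = x := congrArg Subtype.val hw
        have h1 : Ni (fun x y => F x y ∨ ∃ hx : x ∈ U, g ⟨x, hx⟩ = y) x =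
            insert (w : V) (Ni F x) := by
          ext y
          simp only [mem_Ni, Finset.mem_insert]
          constructor
          · rintro (h | ⟨hy, hyx⟩)
            · exact Or.inr h
            · refine Or.inl ?_
              have := hg (hyx.trans hw'.symm)
              exact congrArg Subtype.val this
          · rintro (rfl | h)
            · exact Or.inr ⟨w.2, hw'⟩
            · exact Or.inl h
        have h2 : (w : V) ∉ Ni F x := by
          have := (Finset.mem_sdiff.1 (hgt w)).2
          rw [hw'] at this
          simpa using this
        rw [h1, Finset.card_insert_of_notMem h2, (F2 x hx).2]

end Core

section Core
open scoped Classical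

variable {V : Type*}

/-- The cyclic block spanned by a tuple and its connecting paths, with the path `P` absorbed if it
is nonempty. -/
def blk (t : Tup V) (c₁ c₂ c₃ P : List V) : List V :=
  if P = [] then
    t.1.1.1.2 :: t.2 :: (c₁ ++ t.1.1.1.1.1 :: t.1.1.2 :: (c₂ ++ t.1.1.1.1.2 :: t.1.2 :: c₃))
  else
    t.1.1.1.2 :: (P ++ t.1.1.2 :: (c₂ ++ t.1.1.1.1.2 :: t.2 ::
      (c₁ ++ t.1.1.1.1.1 :: t.1.2 :: c₃)))

theorem blk_ne_nil (t : Tup V) (c₁ c₂ c₃ P : List V) : blk t c₁ c₂ c₃ P ≠ [] := by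
  unfold blk; split_ifs <;> simp

theorem head_blk (t : Tup V) (c₁ c₂ c₃ P : List V) :
    (blk t c₁ c₂ c₃ P).head (blk_ne_nil t c₁ c₂ c₃ P) = t.1.1.1.2 := by
  unfold blk; split_ifs <;> simp

theorem blk_perm (t : Tup V) (c₁ c₂ c₃ P : List V) :
    (blk t c₁ c₂ c₃ P).Perm (tl t ++ (c₁ ++ (c₂ ++ (c₃ ++ P)))) := by
  rw [List.perm_iff_count]
  intro a
  unfold blk tl
  split_ifs with h
  · subst h
    simp only [List.count_append, List.count_cons, List.count_nil]; omega
  · simp only [List.count_append, List.count_cons, List.count_nil]; omega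

theorem isChain_blk {G : V → V → Prop} {t : Tup V} {c₁ c₂ c₃ P : List V} {z : V}
    (hv : TupValid G t) (h₁ : (t.2 :: (c₁ ++ [t.1.1.1.1.1])).IsChain G)
    (h₂ : (t.1.1.2 :: (c₂ ++ [t.1.1.1.1.2])).IsChain G) (h₃ : (t.1.2 :: (c₃ ++ [z])).IsChain G)
    (hP : ∀ h : P ≠ [], P.IsChain G ∧ Absorbs G (P.head h, P.getLast h) t) :
    (blk t c₁ c₂ c₃ P ++ [z]).IsChain G := by
  have split : ∀ (l₁ : List V) (c : V) (l₂ : List V), (l₁ ++ [c]).IsChain G →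
      (c :: l₂).IsChain G → (l₁ ++ c :: l₂).IsChain G := fun l₁ c l₂ a b =>
    List.isChain_split.2 ⟨a, b⟩
  obtain ⟨-, g1, g2, g3⟩ := hv
  unfold blk
  split_ifs with h
  · simp only [List.cons_append, List.append_assoc]
    rw [List.isChain_cons_cons]
    refine ⟨g1, split (_ :: _) _ _ h₁ ?_⟩
    rw [List.isChain_cons_cons]
    refine ⟨g2, split (_ :: _) _ _ h₂ ?_⟩
    rw [List.isChain_cons_cons]
    exact ⟨g3, h₃⟩
  · obtain ⟨hc, a1, a2, a3, a4⟩ := hP h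
    simp only [List.cons_append, List.append_assoc]
    refine split (_ :: _) _ _ ?_ (split (_ :: _) _ _ h₂ ?_)
    · rw [List.cons_append, List.isChain_cons, List.isChain_append]
      refine ⟨?_, hc, by simp, ?_⟩
      · intro y hy
        rw [List.head?_append_of_ne_nil _ h, List.head?_eq_some_head h] at hy
        simp at hy
        exact hy ▸ a1
      · intro x hx y hy
        rw [List.getLast?_eq_some_getLast h] at hx
        simp at hx hy
        subst hx; subst hy; exact a2
    · rw [List.isChain_cons_cons]
      refine ⟨a4, split (_ :: _) _ _ h₁ ?_⟩
      rw [List.isChain_cons_cons]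
      exact ⟨a3, h₃⟩

theorem isChain_flatMap_range {G : V → V → Prop} (b : ℕ → List V) (hd : ℕ → V) (N : ℕ)
    (hne : ∀ j, b j ≠ []) (hhd : ∀ j, (b j).head (hne j) = hd j)
    (hch : ∀ j < N, (b j ++ [hd (j + 1)]).IsChain G) :
    ((List.range N).flatMap b ++ [hd N]).IsChain G := by
  induction N with
  | zero => simp
  | succ N ih =>
    have h1 := ih fun j hj => hch j (by omega)
    have h2 := hch N (by omega)
    rw [List.range_succ, List.flatMap_append, List.flatMap_singleton, List.append_assoc]
    obtain ⟨x, b', hb⟩ := List.exists_cons_of_ne_nil (hne N)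
    have hx : x = hd N := by
      have := hhd N
      simp only [hb, List.head_cons] at this
      exact this
    rw [hb] at h2 ⊢
    subst hx
    exact List.isChain_split.2 ⟨h1, h2⟩

/-- Assembling tuples, connecting paths and absorbed paths into a Hamilton cycle. -/
theorem exists_isHamCycle_of_blocks [Fintype V] {G : V → V → Prop} {N : ℕ} (hN : 0 < N)
    (a : ℕ → Tup V) (c P : ℕ → List V) (haN : a N = a 0)
    (hval : ∀ j < N, TupValid G (a j))
    (hadis : ∀ i < N, ∀ j < N, i ≠ j → (tl (a i)).Disjoint (tl (a j)))
    (hc1 : ∀ j < N, ((a j).2 :: (c (3 * j) ++ [(a j).1.1.1.1.1])).IsChain G)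
    (hc2 : ∀ j < N, ((a j).1.1.2 :: (c (3 * j + 1) ++ [(a j).1.1.1.1.2])).IsChain G)
    (hc3 : ∀ j < N, ((a j).1.2 :: (c (3 * j + 2) ++ [(a (j + 1)).1.1.1.2])).IsChain G)
    (hcn : ∀ i < 3 * N, (c i).Nodup)
    (hcdis : ∀ i < 3 * N, ∀ j < 3 * N, i ≠ j → (c i).Disjoint (c j))
    (hac : ∀ i < N, ∀ j < 3 * N, (tl (a i)).Disjoint (c j))
    (hPn : ∀ j < N, (P j).Nodup)
    (hPdis : ∀ i < N, ∀ j < N, i ≠ j → (P i).Disjoint (P j))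
    (haP : ∀ i < N, ∀ j < N, (tl (a i)).Disjoint (P j))
    (hcP : ∀ i < 3 * N, ∀ j < N, (c i).Disjoint (P j))
    (hP : ∀ j < N, ∀ h : P j ≠ [], (P j).IsChain G ∧ Absorbs G ((P j).head h, (P j).getLast h) (a j))
    (hcov : ∀ v, (∃ j < N, v ∈ tl (a j)) ∨ (∃ i < 3 * N, v ∈ c i) ∨ ∃ j < N, v ∈ P j) :
    ∃ σ : Equiv.Perm V, IsHamCycle G σ := by
  set b : ℕ → List V := fun j => blk (a j) (c (3 * j)) (c (3 * j + 1)) (c (3 * j + 2)) (P j) with hb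
  have hbm : ∀ j v, v ∈ b j ↔ v ∈ tl (a j) ∨ v ∈ c (3 * j) ∨ v ∈ c (3 * j + 1) ∨
      v ∈ c (3 * j + 2) ∨ v ∈ P j := by
    intro j v
    rw [hb, (blk_perm _ _ _ _ _).mem_iff]
    simp only [List.mem_append]
  have hch := isChain_flatMap_range (G := G) b (fun j => (a j).1.1.1.2) N
    (fun j => blk_ne_nil _ _ _ _ _) (fun j => head_blk _ _ _ _ _)
    (fun j hj => isChain_blk (hval j hj) (hc1 j hj) (hc2 j hj) (hc3 j hj) (hP j hj))
  have hne : (List.range N).flatMap b ≠ [] := by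
    intro h
    rw [List.flatMap_eq_nil_iff] at h
    exact blk_ne_nil _ _ _ _ _ (h 0 (List.mem_range.2 hN))
  rw [List.isChain_append] at hch
  refine exists_isHamCycle_of_list G _ hne ?_ ?_ hch.1 ?_
  · rw [List.nodup_flatMap]
    constructor
    · intro j hj
      have hj := List.mem_range.1 hj
      rw [hb, (blk_perm _ _ _ _ _).nodup_iff]
      simp only [List.nodup_append', List.disjoint_append_right]
      refine ⟨(hval j hj).1, ⟨hcn _ (by omega), ⟨hcn _ (by omega), ⟨hcn _ (by omega), hPn j hj, ?_⟩,
        ?_⟩, ?_⟩, ?_⟩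
      · exact hcP _ (by omega) j hj
      · exact ⟨hcdis _ (by omega) _ (by omega) (by omega), hcP _ (by omega) j hj⟩
      · exact ⟨hcdis _ (by omega) _ (by omega) (by omega),
          hcdis _ (by omega) _ (by omega) (by omega), hcP _ (by omega) j hj⟩
      · exact ⟨hac j hj _ (by omega), hac j hj _ (by omega), hac j hj _ (by omega), haP j hj j hj⟩
    · rw [List.pairwise_iff_getElem]
      intro i j hi hj hij
      rw [List.length_range] at hi hj
      simp only [List.getElem_range, Function.onFun]
      intro v hvi hvj
      rw [hbm] at hvi hvj
      have hij' : i ≠ j := hij.ne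
      rcases hvi with h | h | h | h | h <;> rcases hvj with h' | h' | h' | h' | h' <;>
      first
        | exact hadis i hi j hj hij' h h'
        | exact hac i hi _ (by omega) h h'
        | exact hac j hj _ (by omega) h' h
        | exact haP i hi j hj h h'
        | exact haP j hj i hi h' h
        | exact hPdis i hi j hj hij' h h'
        | exact hcP _ (by omega) j hj h h'
        | exact hcP _ (by omega) i hi h' h
        | exact hcdis _ (by omega) _ (by omega) (by omega) h h'
  · intro v
    rw [List.mem_flatMap]
    rcases hcov v with ⟨j, hj, h⟩ | ⟨i, hi, h⟩ | ⟨j, hj, h⟩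
    · exact ⟨j, List.mem_range.2 hj, (hbm _ _).2 (Or.inl h)⟩
    · refine ⟨i / 3, List.mem_range.2 (by omega), (hbm _ _).2 ?_⟩
      have : i = 3 * (i / 3) ∨ i = 3 * (i / 3) + 1 ∨ i = 3 * (i / 3) + 2 := by omega
      rcases this with e | e | e <;> rw [e] at h
      · exact Or.inr (Or.inl h)
      · exact Or.inr (Or.inr (Or.inl h))
      · exact Or.inr (Or.inr (Or.inr (Or.inl h)))
    · exact ⟨j, List.mem_range.2 hj, (hbm _ _).2 (Or.inr (Or.inr (Or.inr (Or.inr h))))⟩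
  · refine hch.2.2 _ (List.getLast_mem_getLast? hne) _ ?_
    have h1 : ((List.range N).flatMap b).head hne = (a 0).1.1.1.2 := by
      obtain ⟨M, rfl⟩ : ∃ M, N = M + 1 := ⟨N - 1, by omega⟩
      simp only [List.range_succ_eq_map, List.flatMap_cons]
      rw [List.head_append_of_ne_nil (blk_ne_nil _ _ _ _ _)]
      exact head_blk _ _ _ _ _
    rw [h1]
    simp [haN]

end Core

section Core
open scoped Classical

theorem exists_isHamCycle_of_expander_aux {V : Type*} [Fintype V] {G : V → V → Prop} {ν c : ℝ}
    {L N r t : ℕ} [NeZero t] (hν : 0 < ν) (hν1 : ν ≤ 1 / 100) (hG : ∀ x, ¬ G x x)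
    (hd : DegCond G) (hE : Expander ν G) (hn : 100 ≤ Fintype.card V)
    (hn2 : 100 ≤ ν ^ 3 * Fintype.card V) (hL : 2 ≤ ν * L) (hN : 0 < N)
    (hNn : ((6 + 3 * (L + 1)) * N : ℕ) ≤ ν ^ 3 / 8 * Fintype.card V) (hr : 0 < r)
    (hrn : (r : ℝ) ≤ ν / 8 * Fintype.card V) (hc : 0 < c)
    (hfin : t / r * (Fintype.card V * c + Fintype.card V * r / c) + Fintype.card V / t +
      Real.log ((Fintype.card V : ℝ) ^ 2) ≤ (ν ^ 3 / 2) ^ 5 / 2 * N) :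
    ∃ σ : Equiv.Perm V, IsHamCycle G σ := by
  set n : ℝ := (Fintype.card V : ℝ) with hndef
  have hn' : (100 : ℝ) ≤ n := by rw [hndef]; exact_mod_cast hn
  have hVne : Nonempty V := Fintype.card_pos_iff.1 (by omega)
  have hν3 : ν ^ 3 ≤ ν := by
    calc ν ^ 3 = ν * (ν * ν) := by ring
      _ ≤ ν * 1 := by gcongr; nlinarith
      _ = ν := mul_one _
  have hν3n : ν ^ 3 * n ≤ ν * n := by gcongr
  set κ : ℝ := (ν ^ 3 / 2) ^ 5 with hκ
  have hκ0 : 0 < κ := by positivity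
  have hκ1 : κ ≤ 1 := pow_le_one₀ (by positivity) (by linarith)
  have hcardT : (Fintype.card (Tup V) : ℝ) = n ^ 6 := by
    simp only [Fintype.card_prod]; push_cast; ring
  have h6N : ((6 * N : ℕ) : ℝ) ≤ ν ^ 3 / 8 * n := by
    refine le_trans ?_ hNn
    exact_mod_cast Nat.mul_le_mul_right _ (by omega)
  obtain ⟨l, hl1, hl2, hl3, hl4⟩ := exists_list_weights (I := V × V) (T := Tup V) (Absorbs G)
    (TupValid G) tl 6 N hκ0 hκ1 (by simp [tl]) (by
      intro W hW p
      rw [hcardT]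
      have h := many_absorbers hν hν1 hd hE hn hn2 p W (le_trans (by exact_mod_cast hW) h6N)
      convert h) N le_rfl
  have hcount : ∀ p : V × V, κ / 2 * N - Real.log (n ^ 2) ≤ (l.countP fun t => Absorbs G p t) := by
    intro p
    refine le_exponent_of_pow_le hκ1 (by positivity) (le_trans ?_ (hl4.trans (le_of_eq ?_)))
    · exact Finset.single_le_sum (f := fun i => (1 / 2 : ℝ) ^ (l.countP fun t => Absorbs G i t))
        (fun i _ => by positivity) (Finset.mem_univ p)
    · rw [Fintype.card_prod]; push_cast; ring
  -- the cyclic sequence of tuples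
  let a : ℕ → Tup V := fun j => l[j % N]'(by rw [hl1]; exact Nat.mod_lt _ hN)
  have haj : ∀ j (hj : j < N), a j = l[j]'(hl1 ▸ hj) := by
    intro j hj
    simp only [a, Nat.mod_eq_of_lt hj]
  have haN : a N = a 0 := by simp only [a, Nat.mod_self, Nat.zero_mod]
  have haval : ∀ j, TupValid G (a j) := fun j => hl2 _ (List.getElem_mem _)
  have hadis : ∀ i < N, ∀ j < N, i ≠ j → (tl (a i)).Disjoint (tl (a j)) := by
    intro i hi j hj hij
    rw [List.pairwise_iff_getElem] at hl3
    rw [haj i hi, haj j hj]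
    rcases lt_or_gt_of_ne hij with h | h
    · exact hl3 _ _ _ _ h
    · exact (hl3 _ _ _ _ h).symm
  set W : Finset V := (l.flatMap tl).toFinset with hW
  have hWa : ∀ j < N, ∀ v ∈ tl (a j), v ∈ W := by
    intro j hj v hv
    rw [hW, List.mem_toFinset, List.mem_flatMap]
    exact ⟨_, List.getElem_mem _, hv⟩
  have hWm : ∀ v ∈ W, ∃ j < N, v ∈ tl (a j) := by
    intro v hv
    rw [hW, List.mem_toFinset, List.mem_flatMap] at hv
    obtain ⟨t, ht, hv⟩ := hv
    obtain ⟨j, hj, rfl⟩ := List.getElem_of_mem ht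
    exact ⟨j, hl1 ▸ hj, by rw [haj j (hl1 ▸ hj)]; exact hv⟩
  have hWc : W.card ≤ 6 * N := by
    refine (List.toFinset_card_le _).trans ?_
    rw [List.length_flatMap]
    refine (List.sum_le_card_nsmul _ 6 ?_).trans ?_
    · intro x hx
      obtain ⟨t, -, rfl⟩ := List.mem_map.1 hx
      simp [tl]
    · rw [List.length_map, hl1, smul_eq_mul, mul_comm]
  -- the connecting paths
  let src : ℕ → V := fun i => if i % 3 = 0 then (a (i / 3)).2 else
    if i % 3 = 1 then (a (i / 3)).1.1.2 else (a (i / 3)).1.2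
  let tgt : ℕ → V := fun i => if i % 3 = 0 then (a (i / 3)).1.1.1.1.1 else
    if i % 3 = 1 then (a (i / 3)).1.1.1.1.2 else (a (i / 3 + 1)).1.1.1.2
  obtain ⟨C, hC1, hC2⟩ := exists_disjoint_family (O := List V) (fun p => p.toFinset) (L + 1) (3 * N) W
    (fun i p => p.Nodup ∧ (src i :: (p ++ [tgt i])).IsChain G) (by
      intro i _ W' _ hW'
      have hW2 : (W'.card : ℝ) ≤ ν / 2 * n := by
        have h1 : W'.card ≤ (6 + 3 * (L + 1)) * N := hW'.trans (by
          calc W.card + 3 * N * (L + 1) ≤ 6 * N + 3 * N * (L + 1) := by omega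
            _ = _ := by ring)
        have h2 : (W'.card : ℝ) ≤ ν ^ 3 / 8 * n := le_trans (by exact_mod_cast h1) hNn
        linarith
      obtain ⟨p, q1, q2, q3, q4⟩ := exists_connecting_path hν (by linarith) hd hE hn hL (src i)
        (tgt i) W' hW2
      refine ⟨p, ⟨q1, q4⟩, ?_, (List.toFinset_card_le _).trans q3⟩
      rw [Finset.disjoint_left]
      intro v hv
      exact q2 v (List.mem_toFinset.1 hv))
  have hCdis : ∀ i < 3 * N, ∀ j < 3 * N, i ≠ j → (C i).Disjoint (C j) := by
    intro i hi j hj hij v hv hv'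
    exact Finset.disjoint_left.1 (hC2 i hi j hj hij) (List.mem_toFinset.2 hv)
      (List.mem_toFinset.2 hv')
  have hCW : ∀ i < 3 * N, ∀ v ∈ C i, v ∉ W := by
    intro i hi v hv
    exact Finset.disjoint_left.1 (hC1 i hi).2.1 (List.mem_toFinset.2 hv)
  -- the remaining vertices
  set X : Finset V := W ∪ (Finset.range (3 * N)).biUnion fun i => (C i).toFinset with hX
  have hXc : (X.card : ℝ) ≤ ν / 8 * n := by
    have h1 : X.card ≤ (6 + 3 * (L + 1)) * N := by
      refine (Finset.card_union_le _ _).trans ?_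
      have h2 := Finset.card_biUnion_le_card_mul (Finset.range (3 * N)) (fun i => (C i).toFinset)
        (L + 1) (fun i hi => (hC1 i (Finset.mem_range.1 hi)).2.2)
      rw [Finset.card_range] at h2
      calc _ ≤ 6 * N + 3 * N * (L + 1) := by omega
        _ = _ := by ring
    have h2 : (X.card : ℝ) ≤ ν ^ 3 / 8 * n := le_trans (by exact_mod_cast h1) hNn
    linarith
  obtain ⟨F, hF1, hF2⟩ := exists_regular_subgraph hν hν1 hd hE hn Xᶜ (by rwa [compl_compl]) r hrn
  obtain ⟨Ls, p1, p2, p3, p4⟩ := exists_path_cover (t := t) hr hF2 (fun x y h => (hF1 x y h).2)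
    (fun x h => hG x (hF1 x x h).1) hc
  have hLs : (Ls.length : ℝ) ≤ κ / 2 * N - Real.log (n ^ 2) := by
    have h1 : (Xᶜ.card : ℝ) ≤ n := by rw [hndef]; exact_mod_cast Finset.card_le_univ _
    have h2 : t / r * (Xᶜ.card * c + Xᶜ.card * r / c) + Xᶜ.card / t ≤
      t / r * (n * c + n * r / c) + n / t := by gcongr
    linarith
  -- assigning absorbers to paths
  have hend : ∀ k : Fin Ls.length, ∃ p : V × V, ∀ h : Ls[k] ≠ [],
      p = ((Ls[k]).head h, (Ls[k]).getLast h) := fun k =>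
    ⟨((Ls[k]).head (p1 _ (List.getElem_mem _)).1, (Ls[k]).getLast (p1 _ (List.getElem_mem _)).1),
      fun _ => rfl⟩
  choose e he using hend
  let T : Fin Ls.length → Finset ℕ := fun k => (Finset.range N).filter fun j => Absorbs G (e k) (a j)
  have hTc : ∀ k, Ls.length ≤ (T k).card := by
    intro k
    have h1 := hLs.trans (hcount (e k))
    have h2 : l.countP (fun t => Absorbs G (e k) t) = (T k).card := by
      have h3 : l = (List.range N).map a := by
        refine List.ext_getElem (by simp [hl1]) fun j h1 h2 => ?_
        rw [List.getElem_map, List.getElem_range, haj j (hl1 ▸ h1)]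
      rw [h3, List.countP_map, List.countP_eq_length_filter]
      simp only [T, Finset.card_def, Finset.filter_val, Finset.range_val, Multiset.range,
        Multiset.filter_coe, Multiset.coe_card]
      rfl
    rw [h2] at h1
    exact_mod_cast h1
  obtain ⟨g, hg, hgT⟩ := (Finset.all_card_le_biUnion_card_iff_exists_injective T).1 (by
    intro S
    rcases S.eq_empty_or_nonempty with rfl | ⟨s0, hs0⟩
    · simp
    · calc S.card ≤ Ls.length := by simpa using Finset.card_le_univ S
        _ ≤ (T s0).card := hTc s0
        _ ≤ _ := Finset.card_le_card (Finset.subset_biUnion_of_mem T hs0))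
  have hgN : ∀ k, g k < N := fun k => by
    have := hgT k
    simp only [T, Finset.mem_filter, Finset.mem_range] at this
    exact this.1
  let P : ℕ → List V := fun j => if h : ∃ k, g k = j then Ls[h.choose] else []
  have hPg : ∀ k, P (g k) = Ls[k] := by
    intro k
    have h : ∃ k', g k' = g k := ⟨k, rfl⟩
    simp only [P, dif_pos h]
    exact congrArg (fun k => Ls[k]) (hg h.choose_spec)
  have hPcases : ∀ j, P j = [] ∨ ∃ k, g k = j := by
    intro j
    by_cases h : ∃ k, g k = j
    · exact Or.inr h
    · exact Or.inl (by simp only [P, dif_neg h])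
  have hPX : ∀ j, ∀ v ∈ P j, v ∉ X := by
    intro j v hv
    rcases hPcases j with h | ⟨k, rfl⟩
    · rw [h] at hv; simp at hv
    · rw [hPg] at hv
      have := (p3 v).1 (List.mem_flatten.2 ⟨_, List.getElem_mem _, hv⟩)
      exact Finset.mem_compl.1 this
  rw [List.nodup_flatten] at p2
  refine exists_isHamCycle_of_blocks hN a C P haN (fun j _ => haval j) hadis ?_ ?_ ?_
    (fun i hi => (hC1 i hi).1.1) hCdis ?_ ?_ ?_ ?_ ?_ ?_ ?_
  · intro j hj
    have := (hC1 (3 * j) (by omega)).1.2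
    have e1 : 3 * j / 3 = j := by omega
    simpa [src, tgt, e1] using this
  · intro j hj
    have := (hC1 (3 * j + 1) (by omega)).1.2
    have e1 : (3 * j + 1) / 3 = j := by omega
    have e2 : (3 * j + 1) % 3 = 1 := by omega
    simpa [src, tgt, e1, e2] using this
  · intro j hj
    have := (hC1 (3 * j + 2) (by omega)).1.2
    have e1 : (3 * j + 2) / 3 = j := by omega
    have e2 : (3 * j + 2) % 3 = 2 := by omega
    simpa [src, tgt, e1, e2] using this
  · intro i hi j hj v hv hv'
    exact hCW j hj v hv' (hWa i hi v hv)
  · intro j _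
    rcases hPcases j with h | ⟨k, rfl⟩
    · rw [h]; simp
    · rw [hPg]; exact p2.1 _ (List.getElem_mem _)
  · intro i _ j _ hij
    rcases hPcases i with h | ⟨k, rfl⟩
    · rw [h]; simp
    rcases hPcases j with h | ⟨k', rfl⟩
    · rw [h]; simp
    rw [hPg, hPg]
    have hkk : (k : ℕ) ≠ k' := fun h => hij (by rw [Fin.ext h])
    have h2 := List.pairwise_iff_getElem.1 p2.2
    rcases lt_or_gt_of_ne hkk with h | h
    · exact h2 _ _ k.2 k'.2 h
    · exact (h2 _ _ k'.2 k.2 h).symm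
  · intro i hi j _ v hv hv'
    exact hPX j v hv' (Finset.mem_union_left _ (hWa i hi v hv))
  · intro i hi j _ v hv hv'
    refine hPX j v hv' (Finset.mem_union_right _ ?_)
    rw [Finset.mem_biUnion]
    exact ⟨i, Finset.mem_range.2 hi, List.mem_toFinset.2 hv⟩
  · intro j _ hne
    rcases hPcases j with h | ⟨k, hk⟩
    · exact absurd h hne
    subst hk
    have hT := hgT k
    simp only [T, Finset.mem_filter] at hT
    have hk := hPg k
    refine ⟨?_, ?_⟩
    · rw [hk]
      exact (p1 _ (List.getElem_mem _)).2.imp fun x y h => (hF1 x y h).1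
    · have h1 := he k (p1 _ (List.getElem_mem _)).1
      have h2 : ((P (g k)).head hne, (P (g k)).getLast hne) = e k := by
        rw [h1]; simp only [hk]
      rw [h2]; exact hT.2
  · intro v
    by_cases hv : v ∈ X
    · rw [hX, Finset.mem_union, Finset.mem_biUnion] at hv
      rcases hv with hv | ⟨i, hi, hv⟩
      · exact Or.inl (hWm v hv)
      · exact Or.inr (Or.inl ⟨i, Finset.mem_range.1 hi, List.mem_toFinset.1 hv⟩)
    · right; right
      have := (p3 v).2 (Finset.mem_compl.2 hv)
      rw [List.mem_flatten] at this
      obtain ⟨q, hq, hvq⟩ := this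
      obtain ⟨k, hk, rfl⟩ := List.getElem_of_mem hq
      exact ⟨g ⟨k, hk⟩, hgN _, by rw [hPg]; exact hvq⟩

/-- Large robustly expanding oriented graphs satisfying the degree condition are Hamiltonian. -/
theorem exists_isHamCycle_of_expander {ν : ℝ} (hν : 0 < ν) (hν1 : ν ≤ 1 / 100) :
    ∃ n₀ : ℕ, ∀ (V : Type) [Fintype V] (G : V → V → Prop), n₀ ≤ Fintype.card V → (∀ x, ¬ G x x) →
      DegCond G → Expander ν G → ∃ σ : Equiv.Perm V, IsHamCycle G σ := by
  set κ : ℝ := (ν ^ 3 / 2) ^ 5 with hκ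
  have hκ0 : 0 < κ := by positivity
  set L : ℕ := ⌈2 / ν⌉₊ with hLdef
  have hL : 2 ≤ ν * L := by
    have := Nat.le_ceil (2 / ν)
    rw [div_le_iff₀ hν] at this
    linarith
  set K : ℝ := ((6 + 3 * (L + 1) : ℕ) : ℝ) with hK
  have hK0 : 0 < K := by rw [hK]; positivity
  set ρ : ℝ := ν ^ 3 / (8 * K) with hρ
  have hρ0 : 0 < ρ := by positivity
  set ε : ℝ := κ * ρ / 8 with hε
  have hε0 : 0 < ε := by positivity
  set t : ℕ := ⌈4 / ε⌉₊ + 1 with ht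
  have ht1 : 4 / ε ≤ t := by
    have := Nat.le_ceil (4 / ε)
    rw [ht]; push_cast; linarith
  have ht0 : (0 : ℝ) < t := by rw [ht]; positivity
  have hlog : ∀ᶠ x : ℝ in Filter.atTop, Real.log x ≤ ε / 2 * x := by
    have h := Real.isLittleO_log_id_atTop.bound (c := ε / 2) (by positivity)
    filter_upwards [h, Filter.eventually_ge_atTop 0] with x hx hx0
    simp only [Real.norm_eq_abs, id, abs_of_nonneg hx0] at hx
    exact (le_abs_self _).trans hx
  have hall : ∀ᶠ m : ℕ in Filter.atTop, Real.log m ≤ ε / 2 * m ∧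
      100 + 100 / ν ^ 3 + 16 / ν + 2 / ρ + 256 * t ^ 2 / (ε ^ 2 * ν) ≤ m :=
    (tendsto_natCast_atTop_atTop.eventually hlog).and
      (tendsto_natCast_atTop_atTop.eventually (Filter.eventually_ge_atTop _))
  obtain ⟨n₀, hn₀⟩ := Filter.eventually_atTop.1 hall
  refine ⟨n₀, fun V _ G hcard hG hd hE => ?_⟩
  obtain ⟨h1, h2⟩ := hn₀ _ hcard
  set n : ℝ := (Fintype.card V : ℝ) with hndef
  have q1 : 0 < 100 / ν ^ 3 := by positivity
  have q2 : 0 < 16 / ν := by positivity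
  have q3 : 0 < 2 / ρ := by positivity
  have q4 : 0 ≤ 256 * t ^ 2 / (ε ^ 2 * ν) := by positivity
  have r0 : 100 ≤ n := by linarith
  have r1 : 100 / ν ^ 3 ≤ n := by linarith
  have r2 : 16 / ν ≤ n := by linarith
  have r3 : 2 / ρ ≤ n := by linarith
  have r4 : 256 * t ^ 2 / (ε ^ 2 * ν) ≤ n := by linarith
  rw [div_le_iff₀ (by positivity)] at r1 r2 r3 r4
  set N : ℕ := ⌊ρ * n⌋₊ with hN
  have hN1 : (N : ℝ) ≤ ρ * n := Nat.floor_le (by positivity)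
  have hN2 : ρ * n - 1 < N := by have := Nat.lt_floor_add_one (ρ * n); linarith
  have hN3 : ρ * n / 2 ≤ N := by linarith
  have hN0 : 0 < N := by
    have : (0 : ℝ) < N := by linarith
    exact_mod_cast this
  set r : ℕ := ⌊ν / 8 * n⌋₊ with hr
  have hr1 : (r : ℝ) ≤ ν / 8 * n := Nat.floor_le (by positivity)
  have hr2 : ν / 8 * n - 1 < r := by have := Nat.lt_floor_add_one (ν / 8 * n); linarith
  have hr3 : ν / 16 * n ≤ r := by linarith
  have hr0' : (0 : ℝ) < r := by linarith
  have hr0 : 0 < r := by exact_mod_cast hr0'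
  have hNeZ : NeZero t := ⟨by omega⟩
  refine exists_isHamCycle_of_expander_aux (c := ε * r / (4 * t)) (L := L) (N := N) (r := r)
    (t := t) hν hν1 hG hd hE (by rw [hndef] at r0; exact_mod_cast r0) (by linarith) hL hN0 ?_ hr0
    hr1 (by positivity) ?_
  · rw [← hndef]
    push_cast
    have : K * N ≤ K * (ρ * n) := by gcongr
    have e : K * (ρ * n) = ν ^ 3 / 8 * n := by rw [hρ]; field_simp
    rw [e, hK] at this
    push_cast at this
    linarith
  · rw [← hndef, ← hκ, Real.log_pow]
    push_cast
    have e1 : t / r * (n * (ε * r / (4 * t)) + n * r / (ε * r / (4 * t))) =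
        ε * n / 4 + 4 * t ^ 2 * n / (ε * r) := by field_simp
    have e2 : n / t ≤ ε * n / 4 := by
      rw [div_le_iff₀ hε0] at ht1
      rw [div_le_iff₀ ht0]
      nlinarith
    have e3 : 4 * t ^ 2 * n / (ε * r) ≤ ε * n / 4 := by
      rw [div_le_iff₀ (by positivity)]
      have : ε * n / 4 * (ε * (ν / 16 * n)) ≤ ε * n / 4 * (ε * r) := by gcongr
      refine le_trans ?_ this
      have : 256 * (t : ℝ) ^ 2 * n ≤ n * (ε ^ 2 * ν) * n := by gcongr
      linarith
    have e4 : κ / 2 * (ρ * n / 2) ≤ κ / 2 * N := by gcongr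
    have e5 : κ / 2 * (ρ * n / 2) = 2 * ε * n := by rw [hε]; ring
    rw [e1]
    have : 0 < ε * n := by positivity
    linarith

end Core

section Core
open scoped Classical

variable {V : Type*} [Fintype V]

/-- The number of edges from `X` to `Y`. -/
noncomputable def ec (G : V → V → Prop) (X Y : Finset V) : ℕ := ∑ x ∈ X, (No G x ∩ Y).card

theorem ec_eq_sum (G : V → V → Prop) (X Y : Finset V) :
    ec G X Y = ∑ x ∈ X, ∑ y ∈ Y, if G x y then 1 else 0 := by
  refine Finset.sum_congr rfl fun x _ => ?_
  rw [← Finset.card_filter]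
  congr 1
  ext y
  simp [and_comm]

theorem ec_eq_sum_in (G : V → V → Prop) (X Y : Finset V) :
    ec G X Y = ∑ y ∈ Y, (Ni G y ∩ X).card := by
  rw [ec_eq_sum, Finset.sum_comm]
  refine Finset.sum_congr rfl fun y _ => ?_
  rw [← Finset.card_filter]
  congr 1
  ext x
  simp [and_comm]

theorem ec_add_ec_le {G : V → V → Prop} (hG : IsOriented G) (X Y : Finset V) :
    ec G X Y + ec G Y X ≤ X.card * Y.card := by
  rw [ec_eq_sum, ec_eq_sum, Finset.sum_comm (s := Y), ← Finset.sum_add_distrib]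
  calc _ ≤ ∑ x ∈ X, ∑ y ∈ Y, 1 := by
        refine Finset.sum_le_sum fun x _ => ?_
        rw [← Finset.sum_add_distrib]
        refine Finset.sum_le_sum fun y _ => ?_
        have := hG x y
        split_ifs <;> simp_all
    _ = _ := by simp

theorem two_mul_ec_self_add_le {G : V → V → Prop} (hG : IsOriented G) (X : Finset V) :
    2 * ec G X X + X.card ≤ X.card * X.card := by
  have h1 : X.card = ∑ x ∈ X, ∑ y ∈ X, if x = y then 1 else 0 := by simp
  calc 2 * ec G X X + X.card
      = ∑ x ∈ X, ∑ y ∈ X, ((if G x y then 1 else 0) + (if G y x then 1 else 0) +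
          if x = y then 1 else 0) := by
        simp only [Finset.sum_add_distrib]
        rw [← h1, ← ec_eq_sum, Finset.sum_comm, ← ec_eq_sum]
        ring
    _ ≤ ∑ x ∈ X, ∑ y ∈ X, 1 := by
        refine Finset.sum_le_sum fun x _ => Finset.sum_le_sum fun y _ => ?_
        have := hG x y
        by_cases h : x = y
        · subst h; have : ¬ G x x := fun h => hG _ _ h h
          simp [this]
        · split_ifs <;> simp_all
    _ = _ := by simp

/-- The fibres of a map to `Fin 4`. -/
noncomputable def cl (c : V → Fin 4) (i : Fin 4) : Finset V := Finset.univ.filter fun v => c v = i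

@[simp] theorem mem_cl {c : V → Fin 4} {i : Fin 4} {v : V} : v ∈ cl c i ↔ c v = i := by simp [cl]

theorem card_eq_sum_cl (c : V → Fin 4) (X : Finset V) :
    X.card = ∑ i, (X ∩ cl c i).card := by
  rw [Finset.card_eq_sum_card_fiberwise (f := c) (t := Finset.univ) (fun _ _ => by simp)]
  refine Finset.sum_congr rfl fun i _ => ?_
  congr 1
  ext v
  simp

theorem sum_card_cl (c : V → Fin 4) : ∑ i, (cl c i).card = Fintype.card V := by
  have := card_eq_sum_cl c Finset.univ
  simpa using this.symm

/-- The numerical relations between sizes of the four classes and edge counts between them. -/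
structure Counts (n d : ℝ) (a : Fin 4 → ℝ) (e : Fin 4 → Fin 4 → ℝ) : Prop where
  nonneg : ∀ i, 0 ≤ a i
  enonneg : ∀ i j, 0 ≤ e i j
  sum : a 0 + a 1 + a 2 + a 3 = n
  out : ∀ i, a i * d ≤ e i 0 + e i 1 + e i 2 + e i 3
  inn : ∀ i, a i * d ≤ e 0 i + e 1 i + e 2 i + e 3 i
  add : ∀ i j, e i j + e j i ≤ a i * a j
  self : ∀ i, 2 * e i i ≤ a i * (a i - 1)

theorem counts {G : V → V → Prop} (hG : IsOriented G) (c : V → Fin 4) {d : ℝ}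
    (hd : ∀ x, d ≤ (No G x).card ∧ d ≤ (Ni G x).card) :
    Counts (Fintype.card V) d (fun i => (cl c i).card) (fun i j => ec G (cl c i) (cl c j)) where
  nonneg i := by positivity
  enonneg i j := by positivity
  sum := by
    have := sum_card_cl c
    rw [Fin.sum_univ_four] at this
    exact_mod_cast this
  out i := by
    have h1 : (cl c i).card * d ≤ ∑ x ∈ cl c i, ((No G x).card : ℝ) := by
      rw [← nsmul_eq_mul]
      exact Finset.card_nsmul_le_sum _ _ _ fun x _ => (hd x).1
    refine h1.trans (le_of_eq ?_)
    have h2 : ∑ x ∈ cl c i, (No G x).card = ∑ j, ec G (cl c i) (cl c j) := by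
      unfold ec
      rw [Finset.sum_comm]
      exact Finset.sum_congr rfl fun x _ => card_eq_sum_cl c _
    rw [Fin.sum_univ_four] at h2
    exact_mod_cast h2
  inn i := by
    have h1 : (cl c i).card * d ≤ ∑ x ∈ cl c i, ((Ni G x).card : ℝ) := by
      rw [← nsmul_eq_mul]
      exact Finset.card_nsmul_le_sum _ _ _ fun x _ => (hd x).2
    refine h1.trans (le_of_eq ?_)
    have h2 : ∑ x ∈ cl c i, (Ni G x).card = ∑ j, ec G (cl c j) (cl c i) := by
      simp only [ec_eq_sum_in]
      rw [Finset.sum_comm]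
      exact Finset.sum_congr rfl fun x _ => card_eq_sum_cl c _
    rw [Fin.sum_univ_four] at h2
    exact_mod_cast h2
  add i j := by exact_mod_cast ec_add_ec_le hG _ _
  self i := by
    have : (2 * ec G (cl c i) (cl c i) + (cl c i).card : ℝ) ≤ (cl c i).card * (cl c i).card := by
      exact_mod_cast two_mul_ec_self_add_le hG (cl c i)
    linarith

theorem le_add_of_mul_le_mul_add_sq {a s x y : ℝ} (hs : 0 ≤ s) (ha : 0 < a) (hsa : s ≤ a)
    (h : a * x ≤ a * y + s * s) : x ≤ y + s := by
  have : a * x ≤ a * (y + s) := by nlinarith [mul_le_mul_of_nonneg_right hsa hs]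
  exact le_of_mul_le_mul_left this ha

/-- Numerical form of the stability argument. -/
theorem Counts.near {n d κ : ℝ} {a : Fin 4 → ℝ} {e : Fin 4 → Fin 4 → ℝ} (h : Counts n d a e)
    (hκ : 0 < κ) (hκ1 : κ ≤ 1 / 1000) (hn : 1 ≤ κ * n) (hd : 3 / 8 * n - 1 / 2 ≤ d)
    (he : e 0 2 + e 0 3 + e 3 2 + e 3 3 ≤ κ ^ 2 * n ^ 2)
    (hS : n ≤ 4 * (a 0 + a 3)) (hS' : 4 * (a 0 + a 3) ≤ 3 * n)
    (hT : a 1 ≤ a 3 + κ ^ 2 * n) :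
    ∀ i, n / 4 - 20 * κ * n ≤ a i ∧ a i ≤ n / 4 + 20 * κ * n := by
  obtain ⟨h0, he0, hsum, hout, hin, hadd, hself⟩ := h
  have hn0 : 0 < n := by
    by_contra hc
    push Not at hc
    nlinarith
  set s := κ * n with hs
  have hκκ : κ ^ 2 * n ≤ s / 1000 := by rw [hs]; nlinarith
  have hs1 : s ≤ n / 1000 := by rw [hs]; nlinarith
  have hsq : κ ^ 2 * n ^ 2 = s * s := by rw [hs]; ring
  rw [hsq] at he
  have a0 := h0 0
  have a1 := h0 1
  have a2 := h0 2
  have a3 := h0 3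
  have e02 := he0 0 2
  have e03 := he0 0 3
  have e32 := he0 3 2
  have e33 := he0 3 3
  have m : ∀ i, a i * (3 / 8 * n - 1 / 2) ≤ a i * d := fun i =>
    mul_le_mul_of_nonneg_left hd (h0 i)
  have m0 := m 0
  have m2 := m 2
  have m3 := m 3
  have o0 := hout 0
  have o3 := hout 3
  have i2 := hin 2
  have i3 := hin 3
  have s0 := hself 0
  have s2 := hself 2
  have d01 := hadd 0 1
  have d12 := hadd 1 2
  have d23 := hadd 2 3
  have d30 := hadd 3 0
  have d31 := hadd 3 1
  have p10 := he0 1 0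
  have p21 := he0 2 1
  have p31 := he0 3 1
  have p13 := he0 1 3
  have hs0 : 0 < s := by linarith
  have hA : s ≤ a 0 → 3 / 8 * n - 2 * s ≤ a 0 / 2 + a 1 := by
    intro hA
    have := le_add_of_mul_le_mul_add_sq hs0.le (by linarith) hA
      (x := 3 / 8 * n - 1 / 2) (y := a 0 / 2 + a 1) (by linarith)
    linarith
  have hC : s ≤ a 2 → 3 / 8 * n - 2 * s ≤ a 2 / 2 + a 1 := by
    intro hA
    have := le_add_of_mul_le_mul_add_sq hs0.le (by linarith) hA
      (x := 3 / 8 * n - 1 / 2) (y := a 2 / 2 + a 1) (by linarith)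
    linarith
  have hD : s ≤ a 3 → a 3 ≤ n / 4 + 3 * s := by
    intro hA
    have := le_add_of_mul_le_mul_add_sq hs0.le (by linarith) hA
      (x := 3 / 8 * n - 1 / 2) (y := (a 0 + a 1 + a 2) / 2) (by linarith)
    linarith
  have hd3 : s ≤ a 3 := by
    by_contra hc
    push Not at hc
    have := hA (by linarith)
    have := hC (by linarith)
    linarith
  have hd0 : s ≤ a 0 := by
    by_contra hc
    push Not at hc
    have := hD hd3
    have := le_add_of_mul_le_mul_add_sq hs0.le (by linarith) hd3
      (x := 3 / 8 * n - 1 / 2) (y := a 0 + a 1) (by linarith [he0 0 3])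
    linarith
  have hd2 : s ≤ a 2 := by
    by_contra hc
    push Not at hc
    have := hD hd3
    have := le_add_of_mul_le_mul_add_sq hs0.le (by linarith) hd3
      (x := 3 / 8 * n - 1 / 2) (y := a 2 + a 1) (by linarith)
    linarith
  have k1 := hA hd0
  have k2 := hC hd2
  have k3 := hD hd3
  have g1 : a 3 ≥ n / 4 - 6 * s := by linarith
  intro i
  have : 20 * κ * n = 20 * s := by rw [hs]; ring
  rw [this]
  fin_cases i <;> constructor <;> simp <;> linarith

/-- Numerical form of the edge distribution. -/
theorem Counts.dense {n d μ : ℝ} {a : Fin 4 → ℝ} {e : Fin 4 → Fin 4 → ℝ} (h : Counts n d a e)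
    (hμ : 0 < μ) (hμ1 : μ ≤ 1 / 2000) (hn : 1 ≤ μ * n) (hd : 3 / 8 * n - 1 / 2 ≤ d)
    (he : e 0 2 + e 0 3 + e 3 2 + e 3 3 ≤ μ * n ^ 2)
    (ha : ∀ i, n / 4 - μ * n ≤ a i ∧ a i ≤ n / 4 + μ * n) :
    (∀ i, a i * a (i + 1) - 6 * μ * n ^ 2 ≤ e i (i + 1)) ∧ n ^ 2 / 40 ≤ e 0 0 ∧
      n ^ 2 / 40 ≤ e 2 2 ∧ n ^ 2 / 40 ≤ e 1 3 ∧ n ^ 2 / 40 ≤ e 3 1 := by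
  obtain ⟨h0, he0, hsum, hout, hin, hadd, hself⟩ := h
  have hn0 : 0 < n := by
    by_contra hc
    push Not at hc
    nlinarith
  set s := μ * n with hs
  have hs1 : s ≤ n / 2000 := by rw [hs]; nlinarith
  have hsq : μ * n ^ 2 = s * n := by rw [hs]; ring
  have hsq' : 6 * μ * n ^ 2 = 6 * (s * n) := by rw [hs]; ring
  have hs0 : 0 < s := by linarith
  rw [hsq] at he
  rw [hsq']
  have e02 := he0 0 2
  have e03 := he0 0 3
  have e32 := he0 3 2
  have e33 := he0 3 3
  obtain ⟨l0, u0⟩ := ha 0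
  obtain ⟨l1, u1⟩ := ha 1
  obtain ⟨l2, u2⟩ := ha 2
  obtain ⟨l3, u3⟩ := ha 3
  have hsn : s * n ≤ n ^ 2 / 2000 := by nlinarith
  have low : ∀ i y, y - 3 * s ≤ d → a i * y - 2 * (s * n) ≤ a i * d := by
    intro i y hy
    have h1 := mul_le_mul_of_nonneg_left hy (h0 i)
    have h2 : a i * s ≤ n / 2 * s := mul_le_mul_of_nonneg_right (by linarith [(ha i).2]) hs0.le
    linarith
  have big : ∀ i y, n / 8 - 3 * s ≤ y → n ^ 2 / 32 - 2 * (s * n) ≤ a i * y := by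
    intro i y hy
    have h1 := mul_le_mul (by linarith [(ha i).1] : n / 4 - s ≤ a i) hy (by linarith) (h0 i)
    nlinarith [mul_nonneg hs0.le hs0.le]
  have o0 := hout 0
  have o3 := hout 3
  have i2 := hin 2
  have i3 := hin 3
  have s0 := hself 0
  have s2 := hself 2
  have d01 := hadd 0 1
  have d12 := hadd 1 2
  have d23 := hadd 2 3
  have d30 := hadd 3 0
  have d13 := hadd 1 3
  have p10 := he0 1 0
  have p21 := he0 2 1
  have p32 := he0 3 2
  have p03 := he0 0 3
  have p31 := he0 3 1
  have p13 := he0 1 3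
  have c0 := h0 0
  have c2 := h0 2
  refine ⟨?_, ?_, ?_, ?_, ?_⟩
  · intro i
    fin_cases i
    · show a 0 * a 1 - 6 * (s * n) ≤ e 0 1
      have := low 0 (a 0 / 2 + a 1) (by linarith)
      linarith
    · show a 1 * a 2 - 6 * (s * n) ≤ e 1 2
      have := low 2 (a 2 / 2 + a 1) (by linarith)
      linarith
    · show a 2 * a 3 - 6 * (s * n) ≤ e 2 3
      have := low 3 ((a 0 + a 1 + a 2) / 2) (by linarith)
      linarith
    · show a 3 * a 0 - 6 * (s * n) ≤ e 3 0
      have := low 3 ((a 0 + a 1 + a 2) / 2) (by linarith)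
      linarith
  · have := big 0 (d - a 1) (by linarith)
    linarith
  · have := big 2 (d - a 1) (by linarith)
    linarith
  · have := big 3 (d - a 2) (by linarith)
    linarith
  · have := big 3 (d - a 0) (by linarith)
    linarith

/-- Numerical form of the lower bound for the number of edges violating the partition. -/
theorem Counts.bad {n d q : ℝ} {a : Fin 4 → ℝ} {e : Fin 4 → Fin 4 → ℝ} (h : Counts n d a e)
    (hd : 3 / 8 * n - 1 / 2 ≤ d) (ha : ∀ i, n / 5 ≤ a i) (hq : 1 ≤ q) (hq' : a 3 = a 1 + q) :
    q * n / 60 ≤ e 0 2 + e 0 3 + e 3 2 + e 3 3 := by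
  obtain ⟨h0, he0, hsum, hout, hin, hadd, hself⟩ := h
  have e02 := he0 0 2
  have e03 := he0 0 3
  have e32 := he0 3 2
  have e33 := he0 3 3
  have o0 := hout 0
  have o3 := hout 3
  have i2 := hin 2
  have i3 := hin 3
  have s0 := hself 0
  have s2 := hself 2
  have d01 := hadd 0 1
  have d12 := hadd 1 2
  have d23 := hadd 2 3
  have d30 := hadd 3 0
  have d13 := hadd 1 3
  have p10 := he0 1 0
  have p21 := he0 2 1
  have p32 := he0 3 2
  have p31 := he0 3 1
  have p13 := he0 1 3
  have hA : a 0 * (d - a 1 - (a 0 - 1) / 2) ≤ e 0 2 + e 0 3 + e 3 2 + e 3 3 := by linarith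
  have hC : a 2 * (d - a 1 - (a 2 - 1) / 2) ≤ e 0 2 + e 0 3 + e 3 2 + e 3 3 := by linarith
  have hD : a 3 * (2 * d - n + a 3) ≤ 2 * (e 0 2 + e 0 3 + e 3 2 + e 3 3) := by
    rw [← hsum]; linarith
  have key : ∀ x y : ℝ, n / 5 ≤ x → q / 6 ≤ y → q * n / 30 ≤ x * y := by
    intro x y hx hy
    have : 0 ≤ n := by rw [← hsum]; linarith [h0 0, h0 1, h0 2, h0 3]
    calc q * n / 30 = n / 5 * (q / 6) := by ring
      _ ≤ _ := mul_le_mul hx hy (by linarith) (by linarith)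
  have hn0 : 0 ≤ q * n := mul_nonneg (by linarith)
    (by rw [← hsum]; linarith [h0 0, h0 1, h0 2, h0 3])
  by_cases c1 : q / 6 ≤ d - a 1 - (a 0 - 1) / 2
  · linarith [key _ _ (ha 0) c1]
  by_cases c2 : q / 6 ≤ d - a 1 - (a 2 - 1) / 2
  · linarith [key _ _ (ha 2) c2]
  by_cases c3 : q / 6 ≤ 2 * d - n + a 3
  · linarith [key _ _ (ha 3) c3]
  linarith

end Core

section Core
open scoped Classical

variable {V : Type*} [Fintype V]

/-- The four classes determined by two sets. -/
noncomputable def cls (S T : Finset V) (v : V) : Fin 4 :=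
  if v ∈ S then (if v ∈ T then 0 else 3) else (if v ∈ T then 1 else 2)

theorem mem_left_iff_cls {S T : Finset V} {v : V} : v ∈ S ↔ cls S T v = 0 ∨ cls S T v = 3 := by
  unfold cls; split_ifs <;> simp_all

theorem mem_right_iff_cls {S T : Finset V} {v : V} : v ∈ T ↔ cls S T v = 0 ∨ cls S T v = 1 := by
  unfold cls; split_ifs <;> simp_all

/-- The partition `c` together with the exceptional set `E` shows that `G` is close to the
extremal graph. -/
structure Near (η : ℝ) (G : V → V → Prop) (c : V → Fin 4) (E : Finset V) : Prop where
  size : ∀ i, Fintype.card V / 4 - η * Fintype.card V ≤ ((cl c i).card : ℝ) ∧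
    ((cl c i).card : ℝ) ≤ Fintype.card V / 4 + η * Fintype.card V
  exc : (E.card : ℝ) ≤ η * Fintype.card V
  out : ∀ v ∉ E, ((cl c (c v + 1) \ No G v).card : ℝ) ≤ η * Fintype.card V
  inn : ∀ v ∉ E, ((cl c (c v + 3) \ Ni G v).card : ℝ) ≤ η * Fintype.card V

theorem card_filter_lt_mul_le (f : V → ℕ) (x : ℝ) :
    ((Finset.univ.filter fun v => x < f v).card : ℝ) * x ≤ ∑ v, (f v : ℝ) := by
  calc ((Finset.univ.filter fun v => x < f v).card : ℝ) * x
      ≤ ∑ v ∈ Finset.univ.filter (fun v => x < f v), (f v : ℝ) := by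
        rw [← nsmul_eq_mul]
        exact Finset.card_nsmul_le_sum _ _ _ fun v hv => (Finset.mem_filter.1 hv).2.le
    _ ≤ _ := Finset.sum_le_sum_of_subset_of_nonneg (Finset.subset_univ _)
        fun _ _ _ => by positivity

theorem card_sdiff_eq_sub_inter (s t : Finset V) :
    ((s \ t).card : ℝ) = s.card - (t ∩ s).card := by
  have := Finset.card_sdiff_add_card_inter s t
  rw [Finset.inter_comm] at this
  have : ((s \ t).card : ℝ) + (t ∩ s).card = s.card := by exact_mod_cast this
  linarith

theorem sum_missing_out (G : V → V → Prop) (c : V → Fin 4) :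
    ∑ v, ((cl c (c v + 1) \ No G v).card : ℝ) =
      ∑ i, (((cl c i).card : ℝ) * (cl c (i + 1)).card - ec G (cl c i) (cl c (i + 1))) := by
  rw [← Finset.sum_fiberwise (s := Finset.univ) (g := c)]
  refine Finset.sum_congr rfl fun i _ => ?_
  calc _ = ∑ v ∈ cl c i, (((cl c (i + 1)).card : ℝ) - (No G v ∩ cl c (i + 1)).card) := by
        refine Finset.sum_congr rfl fun v hv => ?_
        rw [card_sdiff_eq_sub_inter, (Finset.mem_filter.1 hv).2]
    _ = _ := by
        rw [Finset.sum_sub_distrib, Finset.sum_const, nsmul_eq_mul, ec]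
        push_cast
        rfl

theorem sum_missing_in (G : V → V → Prop) (c : V → Fin 4) :
    ∑ v, ((cl c (c v + 3) \ Ni G v).card : ℝ) =
      ∑ i, (((cl c (i + 3)).card : ℝ) * (cl c i).card - ec G (cl c (i + 3)) (cl c i)) := by
  rw [← Finset.sum_fiberwise (s := Finset.univ) (g := c)]
  refine Finset.sum_congr rfl fun i _ => ?_
  calc _ = ∑ v ∈ cl c i, (((cl c (i + 3)).card : ℝ) - (Ni G v ∩ cl c (i + 3)).card) := by
        refine Finset.sum_congr rfl fun v hv => ?_
        rw [card_sdiff_eq_sub_inter, (Finset.mem_filter.1 hv).2]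
    _ = _ := by
        rw [Finset.sum_sub_distrib, Finset.sum_const, nsmul_eq_mul, ec_eq_sum_in, mul_comm]
        push_cast
        rfl

theorem ec_bad_eq (G : V → V → Prop) (S T : Finset V) :
    ec G S Tᶜ = ec G (cl (cls S T) 0) (cl (cls S T) 2) + ec G (cl (cls S T) 0) (cl (cls S T) 3) +
      ec G (cl (cls S T) 3) (cl (cls S T) 2) + ec G (cl (cls S T) 3) (cl (cls S T) 3) := by
  have hS : S = cl (cls S T) 0 ∪ cl (cls S T) 3 := by
    ext v; simp [mem_left_iff_cls (S := S) (T := T)]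
  have hT : ∀ X : Finset V, (X ∩ Tᶜ).card = (X ∩ cl (cls S T) 2).card +
      (X ∩ cl (cls S T) 3).card := by
    intro X
    rw [← Finset.card_union_of_disjoint]
    · congr 1
      ext v
      simp only [Finset.mem_inter, Finset.mem_compl, mem_right_iff_cls (S := S) (T := T),
        Finset.mem_union, mem_cl]
      generalize cls S T v = i
      fin_cases i <;> simp
    · rw [Finset.disjoint_left]
      intro v h1 h2
      simp only [Finset.mem_inter, mem_cl] at h1 h2
      rw [h1.2] at h2
      simp at h2
  calc ec G S Tᶜ = ∑ x ∈ S, ((No G x ∩ cl (cls S T) 2).card + (No G x ∩ cl (cls S T) 3).card) :=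
        Finset.sum_congr rfl fun x _ => hT _
    _ = ∑ x ∈ cl (cls S T) 0 ∪ cl (cls S T) 3,
        ((No G x ∩ cl (cls S T) 2).card + (No G x ∩ cl (cls S T) 3).card) := by rw [← hS]
    _ = _ := by
        rw [Finset.sum_union, Finset.sum_add_distrib, Finset.sum_add_distrib]
        · unfold ec; ring
        · rw [Finset.disjoint_left]
          intro v h1 h2
          simp only [mem_cl] at h1 h2
          rw [h1] at h2
          simp at h2

theorem card_left_eq (S T : Finset V) :
    S.card = (cl (cls S T) 0).card + (cl (cls S T) 3).card := by
  rw [← Finset.card_union_of_disjoint]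
  · congr 1
    ext v; simp [mem_left_iff_cls (S := S) (T := T)]
  · rw [Finset.disjoint_left]
    intro v h1 h2
    simp only [mem_cl] at h1 h2
    rw [h1] at h2
    simp at h2

theorem card_right_eq (S T : Finset V) :
    T.card = (cl (cls S T) 0).card + (cl (cls S T) 1).card := by
  rw [← Finset.card_union_of_disjoint]
  · congr 1
    ext v; simp [mem_right_iff_cls (S := S) (T := T)]
  · rw [Finset.disjoint_left]
    intro v h1 h2
    simp only [mem_cl] at h1 h2
    rw [h1] at h2
    simp at h2

theorem exists_near {G : V → V → Prop} (c : V → Fin 4) {η μ : ℝ} (hη : 0 < η)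
    (hη1 : η ≤ 1 / 100) (hn : 0 < (Fintype.card V : ℝ)) (hμ : μ = η ^ 2 / 100)
    (hsize : ∀ i, Fintype.card V / 4 - μ * Fintype.card V ≤ ((cl c i).card : ℝ) ∧
      ((cl c i).card : ℝ) ≤ Fintype.card V / 4 + μ * Fintype.card V)
    (hcyc : ∀ i, (cl c i).card * (cl c (i + 1)).card - 6 * μ * (Fintype.card V : ℝ) ^ 2 ≤
      (ec G (cl c i) (cl c (i + 1)) : ℝ))
    (h00 : (Fintype.card V : ℝ) ^ 2 / 40 ≤ ec G (cl c 0) (cl c 0))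
    (h22 : (Fintype.card V : ℝ) ^ 2 / 40 ≤ ec G (cl c 2) (cl c 2))
    (h13 : (Fintype.card V : ℝ) ^ 2 / 40 ≤ ec G (cl c 1) (cl c 3))
    (h31 : (Fintype.card V : ℝ) ^ 2 / 40 ≤ ec G (cl c 3) (cl c 1)) :
    ∃ E : Finset V, Near η G c E ∧
      ∀ i, (Fintype.card V : ℝ) ^ 2 / 50 ≤ ec G (cl c i) (cl c (-i)) := by
  set n : ℝ := (Fintype.card V : ℝ) with hndef
  have h31' : ∀ i : Fin 4, i + 3 + 1 = i := by decide
  have hη3 : η ^ 2 ≤ η := by nlinarith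
  have hsmall : μ * n ≤ η * n := by
    have : μ ≤ η := by linarith
    gcongr
  set E1 := Finset.univ.filter fun v => η * n < ((cl c (c v + 1) \ No G v).card : ℝ)
  set E2 := Finset.univ.filter fun v => η * n < ((cl c (c v + 3) \ Ni G v).card : ℝ)
  have hηn : 0 < η * n := by positivity
  have hE1 : (E1.card : ℝ) ≤ η / 2 * n := by
    have h1 := card_filter_lt_mul_le (fun v => (cl c (c v + 1) \ No G v).card) (η * n)
    rw [sum_missing_out] at h1
    have h2 : ∑ i, (((cl c i).card : ℝ) * (cl c (i + 1)).card - ec G (cl c i) (cl c (i + 1))) ≤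
        ∑ i : Fin 4, 6 * μ * n ^ 2 := Finset.sum_le_sum fun i _ => by linarith [hcyc i]
    simp only [Finset.sum_const, Finset.card_univ, Fintype.card_fin, nsmul_eq_mul, hμ] at h2
    refine le_of_mul_le_mul_right ((h1.trans h2).trans ?_) hηn
    push_cast
    nlinarith [mul_nonneg hηn.le hηn.le]
  have hE2 : (E2.card : ℝ) ≤ η / 2 * n := by
    have h1 := card_filter_lt_mul_le (fun v => (cl c (c v + 3) \ Ni G v).card) (η * n)
    rw [sum_missing_in] at h1
    have h2 : ∑ i, (((cl c (i + 3)).card : ℝ) * (cl c i).card - ec G (cl c (i + 3)) (cl c i)) ≤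
        ∑ i : Fin 4, 6 * μ * n ^ 2 := Finset.sum_le_sum fun i _ => by
      have := hcyc (i + 3)
      rw [h31' i] at this
      linarith
    simp only [Finset.sum_const, Finset.card_univ, Fintype.card_fin, nsmul_eq_mul, hμ] at h2
    refine le_of_mul_le_mul_right ((h1.trans h2).trans ?_) hηn
    push_cast
    nlinarith [mul_nonneg hηn.le hηn.le]
  refine ⟨E1 ∪ E2, ⟨?_, ?_, ?_, ?_⟩, ?_⟩
  · intro i
    have := hsize i
    constructor <;> linarith [this.1, this.2]
  · have : ((E1 ∪ E2).card : ℝ) ≤ E1.card + E2.card := by exact_mod_cast Finset.card_union_le _ _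
    linarith
  · intro v hv
    simp only [E1, Finset.mem_union, Finset.mem_filter, not_or, Finset.mem_univ, true_and,
      not_lt] at hv
    exact hv.1
  · intro v hv
    simp only [E2, Finset.mem_union, Finset.mem_filter, not_or, Finset.mem_univ, true_and,
      not_lt] at hv
    exact hv.2
  · intro i
    have : 0 ≤ n ^ 2 := by positivity
    fin_cases i
    · exact le_trans (by linarith) h00
    · exact le_trans (by linarith) h13
    · exact le_trans (by linarith) h22
    · exact le_trans (by linarith) h31

theorem near_of_not_expander {G : V → V → Prop} (hG : IsOriented G) (hd : DegCond G) {η : ℝ}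
    (hη : 0 < η) (hη1 : η ≤ 1 / 100) (hn : 2000 ≤ η ^ 2 * Fintype.card V)
    (hE : ¬ Expander ((η ^ 2 / 2000) ^ 2) G) :
    ∃ (S T E : Finset V), Near η G (cls S T) E ∧
      ∀ i, (Fintype.card V : ℝ) ^ 2 / 50 ≤ ec G (cl (cls S T) i) (cl (cls S T) (-i)) := by
  set n : ℝ := (Fintype.card V : ℝ) with hndef
  unfold Expander at hE
  push Not at hE
  obtain ⟨S, hS1, hS2, hS3⟩ := hE
  set κ : ℝ := η ^ 2 / 2000 with hκ
  set T := rn (κ ^ 2) G S with hT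
  have hn0 : 0 ≤ n := by positivity
  have hη2 : η ^ 2 ≤ 1 / 10000 := by nlinarith
  have hκ0 : 0 < κ := by positivity
  have hκn : 1 ≤ κ * n := by rw [hκ]; linarith
  have hcn := counts hG (cls S T) (d := 3 / 8 * n - 1 / 2) fun x => ⟨hd.out x, hd.inn x⟩
  have hbad : (ec G S Tᶜ : ℝ) ≤ κ ^ 2 * n ^ 2 := by
    rw [ec_eq_sum_in]
    push_cast
    calc ∑ y ∈ Tᶜ, ((Ni G y ∩ S).card : ℝ) ≤ ∑ y ∈ Tᶜ, κ ^ 2 * n := by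
          refine Finset.sum_le_sum fun y hy => ?_
          rw [hT, Finset.mem_compl, rn, Finset.mem_filter] at hy
          push Not at hy
          exact (hy (Finset.mem_univ _)).le
      _ = (Tᶜ.card : ℝ) * (κ ^ 2 * n) := by simp
      _ ≤ n * (κ ^ 2 * n) := by
          gcongr
          rw [hndef]
          exact_mod_cast Finset.card_le_univ _
      _ = _ := by ring
  rw [ec_bad_eq] at hbad
  push_cast at hbad
  have hSc : (S.card : ℝ) = (cl (cls S T) 0).card + (cl (cls S T) 3).card := by
    exact_mod_cast card_left_eq S T
  have hTc : (T.card : ℝ) = (cl (cls S T) 0).card + (cl (cls S T) 1).card := by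
    exact_mod_cast card_right_eq S T
  have hS1' : n ≤ 4 * S.card := by rw [hndef]; exact_mod_cast hS1
  have hS2' : 4 * (S.card : ℝ) ≤ 3 * n := by rw [hndef]; exact_mod_cast hS2
  rw [hSc] at hS1' hS2' hS3
  rw [hTc] at hS3
  have hsize := hcn.near hκ0 (by rw [hκ]; linarith) hκn le_rfl hbad hS1' hS2' (by linarith)
  have hμ : 20 * κ = η ^ 2 / 100 := by rw [hκ]; ring
  obtain ⟨hcyc, h00, h22, h13, h31⟩ := hcn.dense (μ := 20 * κ) (by positivity) (by linarith)
    (by linarith) le_rfl (hbad.trans (by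
      have : κ ^ 2 ≤ 20 * κ := by nlinarith
      gcongr)) hsize
  obtain ⟨E, hE⟩ := exists_near (G := G) (cls S T) hη hη1 (by nlinarith) hμ hsize hcyc h00 h22 h13 h31
  exact ⟨S, T, E, hE⟩

end Core

section Core
open scoped Classical

variable {V : Type*} [Fintype V]

/-- A path from a typical vertex of class `0` to a typical vertex of class `3`. -/
structure SuperPath (G : V → V → Prop) (c : V → Fin 4) (E : Finset V) (P : List V) : Prop where
  ne : P ≠ []
  chain : P.IsChain G
  head_notMem : P.head ne ∉ E
  head_cl : c (P.head ne) = 0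
  last_notMem : P.getLast ne ∉ E
  last_cl : c (P.getLast ne) = 3

theorem mul_card_filter_le_of_injective {ι α : Type*} {_ : Fintype ι} (p : ι → Prop)
    [DecidablePred p] (f : ι → α) (hf : Function.Injective f) (s : Finset α)
    (h : ∀ i, p i → f i ∈ s) {k m : ℕ} {x : ℝ} (hs : (s.card : ℝ) ≤ x) (hx : k * x ≤ m) :
    k * (Finset.univ.filter p).card ≤ m := by
  have h1 : (Finset.univ.filter p).card ≤ s.card := by
    rw [← Finset.card_image_of_injective _ hf]
    refine Finset.card_le_card fun x hx => ?_
    obtain ⟨i, hi, rfl⟩ := Finset.mem_image.1 hx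
    exact h i (Finset.mem_filter.1 hi).2
  have h2 : (k : ℝ) * (Finset.univ.filter p).card ≤ m := by
    refine le_trans ?_ hx
    gcongr
    exact le_trans (by exact_mod_cast h1) hs
  exact_mod_cast h2

theorem exists_isHamCycle_of_superPaths {G : V → V → Prop} {c : V → Fin 4} {E : Finset V} {η : ℝ}
    (hN : Near η G c E) (l : List (List V)) (hl : ∀ P ∈ l, SuperPath G c E P)
    (hnd : l.flatten.Nodup) (hall : ∀ v, v ∈ l.flatten) (h2 : 2 ≤ l.length)
    (hlen : 10 * (η * Fintype.card V) ≤ l.length) : ∃ σ : Equiv.Perm V, IsHamCycle G σ := by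
  have hP : ∀ i : Fin l.length, SuperPath G c E (l.get i) := fun i => hl _ (List.get_mem _ _)
  obtain ⟨hnd1, hnd2⟩ := List.nodup_flatten.1 hnd
  have hdis : ∀ i j : Fin l.length, i ≠ j → List.Disjoint (l.get i) (l.get j) := by
    intro i j hij
    rcases lt_or_gt_of_ne hij with h | h
    · exact List.pairwise_iff_get.1 hnd2 i j h
    · exact (List.pairwise_iff_get.1 hnd2 j i h).symm
  have hhead : Function.Injective fun i : Fin l.length => (l.get i).head (hP i).ne := by
    intro i j hij
    by_contra hne
    exact hdis i j hne (List.head_mem (hP i).ne) (by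
      have hij : (l.get i).head (hP i).ne = (l.get j).head (hP j).ne := hij
      rw [hij]; exact List.head_mem _)
  have hlast : Function.Injective fun i : Fin l.length => (l.get i).getLast (hP i).ne := by
    intro i j hij
    by_contra hne
    exact hdis i j hne (List.getLast_mem (hP i).ne) (by
      have hij : (l.get i).getLast (hP i).ne = (l.get j).getLast (hP j).ne := hij
      rw [hij]; exact List.getLast_mem _)
  have : Nonempty (Fin l.length) := ⟨⟨0, by omega⟩⟩
  obtain ⟨τ, hτ⟩ := exists_isHamCycle_of_few_missing
    (fun i j : Fin l.length => G ((l.get i).getLast (hP i).ne) ((l.get j).head (hP j).ne))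
    (fun i => by
      rw [Fintype.card_fin]
      refine mul_card_filter_le_of_injective _ _ hhead _ (fun j hj => ?_)
        (hN.out _ (hP i).last_notMem) (by exact_mod_cast hlen)
      rw [Finset.mem_sdiff, mem_cl, mem_No, (hP i).last_cl, (hP j).head_cl]
      exact ⟨rfl, hj⟩)
    (fun j => by
      rw [Fintype.card_fin]
      refine mul_card_filter_le_of_injective _ _ hlast _ (fun i hi => ?_)
        (hN.inn _ (hP j).head_notMem) (by exact_mod_cast hlen)
      rw [Finset.mem_sdiff, mem_cl, mem_Ni, (hP i).last_cl, (hP j).head_cl]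
      exact ⟨rfl, hi⟩)
  refine exists_isHamCycle_of_paths G l.get (fun i => (hP i).ne)
    (fun i => hnd1 _ (List.get_mem _ _)) (fun i => (hP i).chain) hdis (fun v => ?_)
    (by rwa [Fintype.card_fin]) τ hτ
  obtain ⟨P, hP1, hP2⟩ := List.mem_flatten.1 (hall v)
  obtain ⟨i, rfl⟩ := List.get_of_mem hP1
  exact ⟨i, hP2⟩

theorem exists_equiv_of_near {G : V → V → Prop} {c : V → Fin 4} {E : Finset V} {η : ℝ}
    (hN : Near η G c E) (R : Finset V) (hRE : Disjoint R E) (i : Fin 4)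
    (hcard : (R ∩ cl c i).card = (R ∩ cl c (i + 1)).card)
    (hlarge : 2 * (η * Fintype.card V) ≤ (R ∩ cl c i).card) :
    ∃ e : {v // v ∈ R ∩ cl c i} ≃ {v // v ∈ R ∩ cl c (i + 1)}, ∀ a, G a.1 (e a).1 := by
  have hE : ∀ v ∈ R, v ∉ E := fun v hv => Finset.disjoint_left.1 hRE hv
  have hi : ∀ i : Fin 4, i + 1 + 3 = i := by decide
  refine exists_equiv_of_few_missing
    (fun (a : {v // v ∈ R ∩ cl c i}) (b : {v // v ∈ R ∩ cl c (i + 1)}) => G a.1 b.1)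
    (by simpa only [Fintype.card_coe] using hcard) (fun a => ?_) (fun b => ?_)
  · have ha := Finset.mem_inter.1 a.2
    rw [Fintype.card_coe, ← hcard]
    refine mul_card_filter_le_of_injective _ _ Subtype.val_injective _ (fun b hb => ?_)
        (hN.out _ (hE _ ha.1)) (by exact_mod_cast hlarge)
    rw [Finset.mem_sdiff, mem_cl, mem_No, mem_cl.1 ha.2, mem_cl.1 (Finset.mem_inter.1 b.2).2]
    exact ⟨rfl, hb⟩
  · have hb := Finset.mem_inter.1 b.2
    rw [Fintype.card_coe]
    refine mul_card_filter_le_of_injective _ _ Subtype.val_injective _ (fun a ha => ?_)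
        (hN.inn _ (hE _ hb.1)) (by rw [← hcard]; exact_mod_cast hlarge)
    rw [Finset.mem_sdiff, mem_cl, mem_Ni, mem_cl.1 hb.2, mem_cl.1 (Finset.mem_inter.1 a.2).2, hi]
    exact ⟨rfl, ha⟩

theorem exists_isHamCycle_of_balanced {G : V → V → Prop} {c : V → Fin 4} {E : Finset V} {η : ℝ}
    (hN : Near η G c E) (hη1 : η ≤ 1 / 100) (hn : 100 ≤ Fintype.card V)
    (l : List (List V)) (hl : ∀ P ∈ l, SuperPath G c E P)
    (hnd : l.flatten.Nodup) (hE : ∀ v ∈ E, v ∈ l.flatten)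
    (hlen : (l.flatten.length : ℝ) ≤ Fintype.card V / 10)
    (hbal : ∀ k, (l.flatten.toFinsetᶜ ∩ cl c k).card = (l.flatten.toFinsetᶜ ∩ cl c 1).card) :
    ∃ σ : Equiv.Perm V, IsHamCycle G σ := by
  set n : ℝ := (Fintype.card V : ℝ) with hndef
  have hn' : (100 : ℝ) ≤ n := by rw [hndef]; exact_mod_cast hn
  set R := l.flatten.toFinsetᶜ with hR
  have hRE : Disjoint R E := by
    rw [Finset.disjoint_left]
    intro v hv hvE
    rw [hR, Finset.mem_compl, List.mem_toFinset] at hv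
    exact hv (hE v hvE)
  have hm : n / 10 ≤ ((R ∩ cl c 1).card : ℝ) := by
    have h1 := (hN.size 1).1
    have h2 := card_le_card_sdiff_add (cl c 1) l.flatten.toFinset
    have h3 : ((l.flatten.toFinset).card : ℝ) ≤ l.flatten.length := by
      exact_mod_cast List.toFinset_card_le _
    have h4 : cl c 1 \ l.flatten.toFinset = R ∩ cl c 1 := by
      ext v; simp [hR, and_comm]
    rw [h4] at h2
    have h5 : η * n ≤ 1 / 100 * n := by gcongr
    linarith
  have hηn : 10 * (η * n) ≤ (R ∩ cl c 1).card := by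
    have : η * n ≤ 1 / 100 * n := by gcongr
    linarith
  have hηn0 : 0 ≤ η * n := le_trans (by positivity) hN.exc
  obtain ⟨e0, he0⟩ := exists_equiv_of_near hN R hRE 0 (hbal 0) (by rw [hbal 0]; linarith)
  obtain ⟨e1, he1⟩ := exists_equiv_of_near hN R hRE 1 (hbal 2).symm (by linarith)
  obtain ⟨e2, he2⟩ := exists_equiv_of_near hN R hRE 2 ((hbal 2).trans (hbal 3).symm)
    (by rw [hbal 2]; linarith)
  let Q : {v // v ∈ R ∩ cl c 0} → List V := fun a =>
    [a.1, (e0 a).1, (e1 (e0 a)).1, (e2 (e1 (e0 a))).1]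
  have hQR : ∀ a, ∀ v ∈ Q a, v ∈ R := by
    intro a v hv
    simp only [Q, List.mem_cons, List.not_mem_nil, or_false] at hv
    rcases hv with rfl | rfl | rfl | rfl
    · exact (Finset.mem_inter.1 a.2).1
    · exact (Finset.mem_inter.1 (e0 a).2).1
    · exact (Finset.mem_inter.1 (e1 (e0 a)).2).1
    · exact (Finset.mem_inter.1 (e2 (e1 (e0 a))).2).1
  have c0 : ∀ a : {v // v ∈ R ∩ cl c 0}, c a.1 = 0 := fun a =>
    mem_cl.1 (Finset.mem_inter.1 a.2).2
  have c1 : ∀ a : {v // v ∈ R ∩ cl c (0 + 1)}, c a.1 = 1 := fun a =>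
    mem_cl.1 (Finset.mem_inter.1 a.2).2
  have c2 : ∀ a : {v // v ∈ R ∩ cl c (1 + 1)}, c a.1 = 2 := fun a =>
    mem_cl.1 (Finset.mem_inter.1 a.2).2
  have c3 : ∀ a : {v // v ∈ R ∩ cl c (2 + 1)}, c a.1 = 3 := fun a =>
    mem_cl.1 (Finset.mem_inter.1 a.2).2
  have hneq : ∀ {u v : V} {i j : Fin 4}, c u = i → c v = j → i ≠ j → u ≠ v := by
    rintro u v i j hu hv hij rfl
    exact hij (hu.symm.trans hv)
  have hQnd : ∀ a, (Q a).Nodup := by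
    intro a
    simp only [Q, List.nodup_cons, List.mem_cons, List.not_mem_nil, or_false, not_or]
    refine ⟨⟨hneq (c0 _) (c1 _) (by decide), hneq (c0 _) (c2 _) (by decide),
      hneq (c0 _) (c3 _) (by decide)⟩, ⟨hneq (c1 _) (c2 _) (by decide),
      hneq (c1 _) (c3 _) (by decide)⟩, hneq (c2 _) (c3 _) (by decide), not_false, List.nodup_nil⟩
  have hQdis : ∀ a b, a ≠ b → List.Disjoint (Q a) (Q b) := by
    intro a b hab v hva hvb
    simp only [Q, List.mem_cons, List.not_mem_nil, or_false] at hva hvb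
    rcases hva with h | h | h | h <;> rcases hvb with h' | h' | h' | h'
    · exact hab (Subtype.ext (h.symm.trans h'))
    · exact hneq (c0 _) (c1 _) (by decide) (h.symm.trans h')
    · exact hneq (c0 _) (c2 _) (by decide) (h.symm.trans h')
    · exact hneq (c0 _) (c3 _) (by decide) (h.symm.trans h')
    · exact hneq (c1 _) (c0 _) (by decide) (h.symm.trans h')
    · exact hab (e0.injective (Subtype.ext (h.symm.trans h')))
    · exact hneq (c1 _) (c2 _) (by decide) (h.symm.trans h')
    · exact hneq (c1 _) (c3 _) (by decide) (h.symm.trans h')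
    · exact hneq (c2 _) (c0 _) (by decide) (h.symm.trans h')
    · exact hneq (c2 _) (c1 _) (by decide) (h.symm.trans h')
    · exact hab (e0.injective (e1.injective (Subtype.ext (h.symm.trans h'))))
    · exact hneq (c2 _) (c3 _) (by decide) (h.symm.trans h')
    · exact hneq (c3 _) (c0 _) (by decide) (h.symm.trans h')
    · exact hneq (c3 _) (c1 _) (by decide) (h.symm.trans h')
    · exact hneq (c3 _) (c2 _) (by decide) (h.symm.trans h')
    · exact hab (e0.injective (e1.injective (e2.injective (Subtype.ext (h.symm.trans h')))))
  set L := (Finset.univ : Finset {v // v ∈ R ∩ cl c 0}).toList.map Q with hL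
  have hLlen : L.length = (R ∩ cl c 1).card := by
    rw [hL, List.length_map, Finset.length_toList, Finset.card_univ, Fintype.card_coe, hbal 0]
  have hmemL : ∀ v, v ∈ L.flatten ↔ ∃ a, v ∈ Q a := by
    intro v
    simp [hL, List.mem_flatten]
  refine exists_isHamCycle_of_superPaths hN (l ++ L) ?_ ?_ ?_ ?_ ?_
  · intro P hP
    rcases List.mem_append.1 hP with h | h
    · exact hl P h
    · rw [hL, List.mem_map] at h
      obtain ⟨a, -, rfl⟩ := h
      have hE' : ∀ v ∈ Q a, v ∉ E := fun v hv => Finset.disjoint_left.1 hRE (hQR a v hv)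
      refine ⟨by simp [Q], ?_, hE' _ (List.head_mem _), c0 a, hE' _ (List.getLast_mem _), ?_⟩
      · simp [Q, List.isChain_cons_cons, he0, he1, he2]
      · exact c3 (e2 (e1 (e0 a)))
  · rw [List.flatten_append, List.nodup_append]
    refine ⟨hnd, ?_, ?_⟩
    · rw [List.nodup_flatten]
      refine ⟨?_, ?_⟩
      · intro P hP
        rw [hL, List.mem_map] at hP
        obtain ⟨a, -, rfl⟩ := hP
        exact hQnd a
      · rw [hL, List.pairwise_map]
        exact (Finset.nodup_toList _).imp fun {a b} hab => hQdis a b hab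
    · rintro v hv w hw rfl
      obtain ⟨a, ha⟩ := (hmemL v).1 hw
      have := hQR a v ha
      rw [hR, Finset.mem_compl, List.mem_toFinset] at this
      exact this hv
  · intro v
    rw [List.flatten_append, List.mem_append, hmemL]
    by_cases hv : v ∈ l.flatten
    · exact Or.inl hv
    · right
      have hvR : v ∈ R := by rw [hR, Finset.mem_compl, List.mem_toFinset]; exact hv
      have hcv : c v = 0 ∨ c v = 1 ∨ c v = 2 ∨ c v = 3 := by
        generalize c v = i
        fin_cases i <;> simp
      rcases hcv with h | h | h | h
      · exact ⟨⟨v, Finset.mem_inter.2 ⟨hvR, mem_cl.2 h⟩⟩, by simp [Q]⟩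
      · refine ⟨e0.symm ⟨v, Finset.mem_inter.2 ⟨hvR, mem_cl.2 h⟩⟩, by simp [Q]⟩
      · refine ⟨e0.symm (e1.symm ⟨v, Finset.mem_inter.2 ⟨hvR, mem_cl.2 h⟩⟩), by simp [Q]⟩
      · refine ⟨e0.symm (e1.symm (e2.symm ⟨v, Finset.mem_inter.2 ⟨hvR, mem_cl.2 h⟩⟩)), by simp [Q]⟩
  · rw [List.length_append, hLlen]
    have : (2 : ℝ) ≤ (R ∩ cl c 1).card := by linarith
    have : 2 ≤ (R ∩ cl c 1).card := by exact_mod_cast this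
    omega
  · rw [List.length_append, hLlen]
    push_cast
    have : (0 : ℝ) ≤ l.length := by positivity
    linarith

end Core

section Core
open scoped Classical

variable {V : Type*}

/-- The difference between the numbers of vertices of class `k` and of class `1` in a list. -/
def dl (c : V → Fin 4) (k : Fin 4) (P : List V) : ℤ :=
  ((P.map c).count k : ℤ) - (P.map c).count 1

theorem dl_append (c : V → Fin 4) (k : Fin 4) (P Q : List V) :
    dl c k (P ++ Q) = dl c k P + dl c k Q := by
  simp only [dl, List.map_append, List.count_append]
  push_cast
  ring

theorem dl_nil (c : V → Fin 4) (k : Fin 4) : dl c k [] = 0 := by simp [dl]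

theorem dl_flatten {α : Type*} (c : V → Fin 4) (k : Fin 4) (good : α → List V → Prop) (b : α → ℤ)
    (hb : ∀ a P, good a P → dl c k P = b a) {items : List α} {l : List (List V)}
    (h : List.Forall₂ good items l) : dl c k l.flatten = (items.map b).sum := by
  induction h with
  | nil => simp [dl_nil]
  | cons h1 _ ih => rw [List.flatten_cons, dl_append, ih, hb _ _ h1, List.map_cons, List.sum_cons]

/-- Greedy choice of disjoint lists containing prescribed disjoint sublists. -/
theorem exists_disjoint_lists {α : Type*} (m : α → List V) (good : α → List V → Prop) (w L : ℕ)
    (items : List α)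
    (h : ∀ a ∈ items, ∀ W : Finset V, (∀ v ∈ m a, v ∈ W) → W.card ≤ w →
      ∃ P, good a P ∧ P.Nodup ∧ (∀ v ∈ m a, v ∈ P) ∧ (∀ v ∈ P, v ∈ W → v ∈ m a) ∧ P.length ≤ L)
    (hnd : (items.map m).flatten.Nodup) (W : Finset V)
    (hW : ∀ v ∈ (items.map m).flatten, v ∈ W) (hWw : W.card + L * items.length ≤ w) :
    ∃ l : List (List V), List.Forall₂ good items l ∧ l.flatten.Nodup ∧
      (∀ v ∈ (items.map m).flatten, v ∈ l.flatten) ∧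
      (∀ v ∈ l.flatten, v ∈ W → v ∈ (items.map m).flatten) ∧
      l.flatten.length ≤ L * items.length := by
  induction items generalizing W with
  | nil => exact ⟨[], List.Forall₂.nil, by simp, by simp, by simp, by simp⟩
  | cons a items ih =>
    simp only [List.map_cons, List.flatten_cons, List.nodup_append, List.mem_append,
      List.length_cons] at hnd hW hWw ⊢
    obtain ⟨hnd1, hnd2, hnd3⟩ := hnd
    have hWw' : W.card + L * items.length + L ≤ w := by rw [mul_add] at hWw; omega
    obtain ⟨P, hP1, hP2, hP3, hP4, hP5⟩ := h a (by simp) W (fun v hv => hW v (Or.inl hv)) (by omega)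
    obtain ⟨l, hl1, hl2, hl3, hl4, hl5⟩ := ih (fun a ha => h a (List.mem_cons_of_mem _ ha)) hnd2
      (W ∪ P.toFinset) (fun v hv => Finset.mem_union_left _ (hW v (Or.inr hv))) (by
        have h1 := Finset.card_union_le W P.toFinset
        have h2 := List.toFinset_card_le P
        omega)
    refine ⟨P :: l, List.Forall₂.cons hP1 hl1, ?_, ?_, ?_, ?_⟩
    · rw [List.flatten_cons, List.nodup_append]
      refine ⟨hP2, hl2, ?_⟩
      rintro v hv u hu rfl
      have h1 := hl4 v hu (Finset.mem_union_right _ (List.mem_toFinset.2 hv))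
      have h2 := hP4 v hv (hW v (Or.inr h1))
      exact hnd3 v h2 v h1 rfl
    · intro v hv
      rw [List.flatten_cons, List.mem_append]
      exact hv.imp (hP3 v) (hl3 v)
    · intro v hv hvW
      rw [List.flatten_cons, List.mem_append] at hv
      exact hv.imp (fun h => hP4 v h hvW) (fun h => hl4 v h (Finset.mem_union_left _ hvW))
    · rw [List.flatten_cons, List.length_append, mul_add]
      omega

variable [Fintype V]

theorem card_toFinset_inter_cl (c : V → Fin 4) (k : Fin 4) {L : List V} (hL : L.Nodup) :
    (L.toFinset ∩ cl c k).card = (L.map c).count k := by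
  have h1 : L.toFinset ∩ cl c k = (L.filter fun v => c v = k).toFinset := by
    ext v; simp
  rw [h1, List.toFinset_card_of_nodup (hL.filter _), ← List.countP_eq_length_filter,
    List.count, List.countP_map]
  refine List.countP_congr fun v _ => ?_
  simp

theorem card_compl_inter_cl (c : V → Fin 4) (k : Fin 4) {L : List V} (hL : L.Nodup) :
    ((L.toFinsetᶜ ∩ cl c k).card : ℤ) = (cl c k).card - (L.map c).count k := by
  rw [← card_toFinset_inter_cl c k hL]
  have h1 := Finset.card_sdiff_add_card_inter (cl c k) L.toFinset
  have h2 : cl c k \ L.toFinset = L.toFinsetᶜ ∩ cl c k := by ext v; simp [and_comm]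
  rw [h2, Finset.inter_comm (cl c k)] at h1
  omega

theorem exists_mem_of_card_lt {X Z : Finset V} (h : Z.card < X.card) : ∃ x ∈ X, x ∉ Z := by
  by_contra hc
  push Not at hc
  exact absurd (Finset.card_le_card hc) (by omega)

/-- An edge avoiding a small set. -/
theorem exists_edge_avoiding {G : V → V → Prop} (X Y Z : Finset V) {D : ℝ}
    (hX : ∀ x ∈ X, ((No G x ∩ Y).card : ℝ) ≤ D) (hY : ∀ y ∈ Y, ((Ni G y ∩ X).card : ℝ) ≤ D)
    (hD : 0 ≤ D) (h : 2 * Z.card * D < ec G X Y) :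
    ∃ x ∈ X, ∃ y ∈ Y, x ∉ Z ∧ y ∉ Z ∧ G x y := by
  by_contra hc
  push Not at hc
  have h1 : ec G X Y ≤ ec G (X ∩ Z) Y + ec G X (Y ∩ Z) := by
    have h2 : ec G (X ∩ Z) Y = ∑ x ∈ X, if x ∈ Z then (No G x ∩ Y).card else 0 := by
      rw [ec, ← Finset.filter_mem_eq_inter, Finset.sum_filter]
    rw [h2, ec, ec, ← Finset.sum_add_distrib]
    refine Finset.sum_le_sum fun x hx => ?_
    split_ifs with hxZ
    · omega
    · rw [zero_add]
      refine Finset.card_le_card fun y hy => ?_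
      rw [Finset.mem_inter, mem_No] at hy
      rw [Finset.mem_inter, Finset.mem_inter, mem_No]
      refine ⟨hy.1, hy.2, ?_⟩
      by_contra hyZ
      exact hc x hx y hy.2 hxZ hyZ hy.1
  have h3 : (ec G (X ∩ Z) Y : ℝ) ≤ Z.card * D := by
    rw [ec]
    push_cast
    calc _ ≤ ∑ x ∈ X ∩ Z, D := Finset.sum_le_sum fun x hx => hX x (Finset.mem_inter.1 hx).1
      _ = (X ∩ Z).card * D := by simp
      _ ≤ _ := by gcongr; exact Finset.inter_subset_right
  have h4 : (ec G X (Y ∩ Z) : ℝ) ≤ Z.card * D := by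
    rw [ec_eq_sum_in]
    push_cast
    calc _ ≤ ∑ y ∈ Y ∩ Z, D := Finset.sum_le_sum fun x hx => hY x (Finset.mem_inter.1 hx).1
      _ = (Y ∩ Z).card * D := by simp
      _ ≤ _ := by gcongr; exact Finset.inter_subset_right
  have h5 : (ec G X Y : ℝ) ≤ ec G (X ∩ Z) Y + ec G X (Y ∩ Z) := by exact_mod_cast h1
  linarith

/-- A continuation of a path ending in `x` to a typical vertex of class `3`. -/
structure PostPath (G : V → V → Prop) (c : V → Fin 4) (E W : Finset V) (x : V) (p : List V) :
    Prop where
  chain : (x :: p).IsChain G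
  nodup : p.Nodup
  avoid : ∀ v ∈ p, v ∉ W
  length : p.length ≤ 4
  last : ∀ v ∈ (x :: p).getLast?, v ∉ E ∧ c v = 3

/-- A path leading from a typical vertex of class `0` to `y`. -/
structure PrePath (G : V → V → Prop) (c : V → Fin 4) (E W : Finset V) (y : V) (p : List V) :
    Prop where
  chain : (p ++ [y]).IsChain G
  nodup : p.Nodup
  avoid : ∀ v ∈ p, v ∉ W
  length : p.length ≤ 4
  head : ∀ v ∈ (p ++ [y]).head?, v ∉ E ∧ c v = 0

theorem PostPath.cons {G : V → V → Prop} {c : V → Fin 4} {E W : Finset V} {x y : V} {p : List V}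
    (h : PostPath G c E (insert y W) y p) (hxy : G x y) (hy : y ∉ W) (hp : p.length ≤ 3) :
    PostPath G c E W x (y :: p) where
  chain := List.isChain_cons_cons.2 ⟨hxy, h.chain⟩
  nodup := List.nodup_cons.2 ⟨fun hy' => h.avoid y hy' (Finset.mem_insert_self _ _), h.nodup⟩
  avoid v hv := by
    rcases List.mem_cons.1 hv with rfl | hv
    · exact hy
    · exact fun hW => h.avoid v hv (Finset.mem_insert_of_mem hW)
  length := by simp; omega
  last := by simpa [List.getLast?_cons_cons] using h.last

theorem PrePath.concat {G : V → V → Prop} {c : V → Fin 4} {E W : Finset V} {x y : V} {p : List V}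
    (h : PrePath G c E (insert x W) x p) (hxy : G x y) (hx : x ∉ W) (hp : p.length ≤ 3) :
    PrePath G c E W y (p ++ [x]) where
  chain := by
    rw [List.isChain_append]
    refine ⟨h.chain, by simp, ?_⟩
    intro a ha b hb
    simp at ha hb
    subst ha; subst hb
    exact hxy
  nodup := by
    rw [List.nodup_append]
    refine ⟨h.nodup, by simp, ?_⟩
    intro a ha b hb hab
    rw [List.mem_singleton] at hb
    subst hab; subst hb
    exact h.avoid a ha (Finset.mem_insert_self _ _)
  avoid v hv := by
    rcases List.mem_append.1 hv with hv | hv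
    · exact fun hW => h.avoid v hv (Finset.mem_insert_of_mem hW)
    · rw [List.mem_singleton] at hv; rw [hv]; exact hx
  length := by simp; omega
  head := by
    intro v hv
    refine h.head v ?_
    have : ∀ q : List V, q ≠ [] → (q ++ [y]).head? = q.head? := by
      intro q hq; cases q <;> simp_all
    rwa [this _ (by simp)] at hv

theorem superPath_append {G : V → V → Prop} {c : V → Fin 4} {E W₁ W₂ : Finset V} {x y : V}
    {p m q : List V} (hp : PrePath G c E W₁ x p) (hq : PostPath G c E W₂ y q)
    (hx : m.head? = some x) (hy : m.getLast? = some y) (hm : m.IsChain G) :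
    SuperPath G c E (p ++ m ++ q) := by
  have hmne : m ≠ [] := by rintro rfl; simp at hx
  have hne : p ++ m ++ q ≠ [] := by simp [hmne]
  have h1 : (p ++ m ++ q).head? = (p ++ [x]).head? := by
    cases p
    · cases m <;> simp_all
    · simp
  have h2 : (p ++ m ++ q).getLast? = (y :: q).getLast? := by
    rcases List.eq_nil_or_concat q with rfl | ⟨q', b, rfl⟩
    · rw [List.append_nil, List.getLast?_append, hy]; simp
    · rw [List.concat_eq_append, ← List.append_assoc, ← List.cons_append, List.getLast?_concat,
        List.getLast?_concat]
  have h3 := hp.head ((p ++ m ++ q).head hne) (by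
    rw [← h1]; exact List.head?_eq_some_head hne)
  have h4 := hq.last ((p ++ m ++ q).getLast hne) (by
    rw [← h2]; exact List.getLast?_eq_some_getLast hne)
  refine ⟨hne, ?_, h3.1, h3.2, h4.1, h4.2⟩
  have c1 := (List.isChain_append.1 hp.chain)
  have c2 := (List.isChain_append.1 (show ([y] ++ q).IsChain G from hq.chain))
  rw [List.isChain_append, List.isChain_append]
  refine ⟨⟨c1.1, hm, ?_⟩, c2.2.1, ?_⟩
  · intro a ha b hb
    rw [hx] at hb
    exact c1.2.2 a ha b (by simpa using hb)
  · intro a ha b hb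
    rw [List.getLast?_append, hy] at ha
    exact c2.2.2 a (by simpa using ha) b hb

end Core

section Core
open scoped Classical

variable {V : Type*} [Fintype V]

theorem Near.exists_out {G : V → V → Prop} {c : V → Fin 4} {E : Finset V} {η : ℝ}
    (hN : Near η G c E) (hη1 : η ≤ 1 / 1000) {x : V} (hx : x ∉ E) {W : Finset V}
    (hW : (W.card : ℝ) ≤ Fintype.card V / 8) :
    ∃ y, y ∉ E ∧ y ∉ W ∧ c y = c x + 1 ∧ G x y := by
  have h1 := hN.out x hx
  have h2 := (hN.size (c x + 1)).1
  have h3 := hN.exc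
  have hn : 0 < (Fintype.card V : ℝ) := by
    have : Nonempty V := ⟨x⟩
    exact_mod_cast Fintype.card_pos
  obtain ⟨y, hy, hyZ⟩ := exists_mem_of_card_lt (X := cl c (c x + 1))
    (Z := (cl c (c x + 1) \ No G x) ∪ (E ∪ W)) (by
      have h4 := Finset.card_union_le (cl c (c x + 1) \ No G x) (E ∪ W)
      have h5 := Finset.card_union_le E W
      have h6 : (((cl c (c x + 1) \ No G x) ∪ (E ∪ W)).card : ℝ) ≤
        (cl c (c x + 1) \ No G x).card + (E.card + W.card) := by exact_mod_cast (by omega)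
      have h7 : η * Fintype.card V ≤ 1 / 1000 * Fintype.card V := by gcongr
      exact_mod_cast (show (((cl c (c x + 1) \ No G x) ∪ (E ∪ W)).card : ℝ) <
        (cl c (c x + 1)).card by linarith))
  simp only [Finset.mem_union, Finset.mem_sdiff, not_or, not_and, not_not, mem_No] at hyZ
  exact ⟨y, hyZ.2.1, hyZ.2.2, by simpa using hy, hyZ.1 hy⟩

theorem Near.exists_in {G : V → V → Prop} {c : V → Fin 4} {E : Finset V} {η : ℝ}
    (hN : Near η G c E) (hη1 : η ≤ 1 / 1000) {x : V} (hx : x ∉ E) {W : Finset V}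
    (hW : (W.card : ℝ) ≤ Fintype.card V / 8) :
    ∃ y, y ∉ E ∧ y ∉ W ∧ c y = c x + 3 ∧ G y x := by
  have h1 := hN.inn x hx
  have h2 := (hN.size (c x + 3)).1
  have h3 := hN.exc
  have hn : 0 < (Fintype.card V : ℝ) := by
    have : Nonempty V := ⟨x⟩
    exact_mod_cast Fintype.card_pos
  obtain ⟨y, hy, hyZ⟩ := exists_mem_of_card_lt (X := cl c (c x + 3))
    (Z := (cl c (c x + 3) \ Ni G x) ∪ (E ∪ W)) (by
      have h4 := Finset.card_union_le (cl c (c x + 3) \ Ni G x) (E ∪ W)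
      have h5 := Finset.card_union_le E W
      have h6 : (((cl c (c x + 3) \ Ni G x) ∪ (E ∪ W)).card : ℝ) ≤
        (cl c (c x + 3) \ Ni G x).card + (E.card + W.card) := by exact_mod_cast (by omega)
      have h7 : η * Fintype.card V ≤ 1 / 1000 * Fintype.card V := by gcongr
      exact_mod_cast (show (((cl c (c x + 3) \ Ni G x) ∪ (E ∪ W)).card : ℝ) <
        (cl c (c x + 3)).card by linarith))
  simp only [Finset.mem_union, Finset.mem_sdiff, not_or, not_and, not_not, mem_Ni] at hyZ
  exact ⟨y, hyZ.2.1, hyZ.2.2, by simpa using hy, hyZ.1 hy⟩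

/-- The classes above `i`, in increasing order. -/
def above (i : Fin 4) : List (Fin 4) := (List.finRange 4).filter (i < ·)

/-- The classes below `i`, in increasing order. -/
def below (i : Fin 4) : List (Fin 4) := (List.finRange 4).filter (· < i)

theorem Near.exists_postPath {G : V → V → Prop} {c : V → Fin 4} {E : Finset V} {η : ℝ}
    (hN : Near η G c E) (hη1 : η ≤ 1 / 1000) (k : ℕ) {x : V} (hx : x ∉ E)
    (hk : (c x).val + k = 3) {W : Finset V} (hW : (W.card : ℝ) + k ≤ Fintype.card V / 8) :
    ∃ p, PostPath G c E W x p ∧ p.map c = above (c x) ∧ p.length = k := by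
  induction k generalizing x W with
  | zero =>
    have h3 : c x = 3 := Fin.ext hk
    refine ⟨[], ⟨by simp, by simp, by simp, by simp, ?_⟩, ?_, rfl⟩
    · intro v hv
      simp at hv
      subst hv
      exact ⟨hx, h3⟩
    · rw [h3]; exact (by decide : ([] : List (Fin 4)) = above 3)
  | succ k ih =>
    push_cast at hW
    obtain ⟨y, hyE, hyW, hyc, hxy⟩ := hN.exists_out hη1 hx (W := W) (by
      have : (0 : ℝ) ≤ k := by positivity
      linarith)
    have hval : ∀ i : Fin 4, i.val < 3 → (i + 1).val = i.val + 1 ∧ above i = (i + 1) :: above (i + 1) := by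
      decide
    obtain ⟨hv1, hv2⟩ := hval (c x) (by omega)
    obtain ⟨p, hp1, hp2, hp3⟩ := ih hyE (by rw [hyc]; omega) (W := insert y W) (by
      have : ((insert y W).card : ℝ) ≤ W.card + 1 := by exact_mod_cast Finset.card_insert_le y W
      linarith)
    exact ⟨y :: p, hp1.cons hxy hyW (by omega), by rw [List.map_cons, hp2, hv2, hyc],
      by simp [hp3]⟩

theorem Near.exists_prePath {G : V → V → Prop} {c : V → Fin 4} {E : Finset V} {η : ℝ}
    (hN : Near η G c E) (hη1 : η ≤ 1 / 1000) (k : ℕ) {x : V} (hx : x ∉ E)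
    (hk : (c x).val = k) {W : Finset V} (hW : (W.card : ℝ) + k ≤ Fintype.card V / 8) :
    ∃ p, PrePath G c E W x p ∧ p.map c = below (c x) ∧ p.length = k := by
  induction k generalizing x W with
  | zero =>
    have h3 : c x = 0 := Fin.ext hk
    refine ⟨[], ⟨by simp, by simp, by simp, by simp, ?_⟩, ?_, rfl⟩
    · intro v hv
      simp at hv
      subst hv
      exact ⟨hx, h3⟩
    · rw [h3]; exact (by decide : ([] : List (Fin 4)) = below 0)
  | succ k ih =>
    push_cast at hW
    obtain ⟨y, hyE, hyW, hyc, hxy⟩ := hN.exists_in hη1 hx (W := W) (by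
      have : (0 : ℝ) ≤ k := by positivity
      linarith)
    have hval : ∀ i : Fin 4, 0 < i.val →
        (i + 3).val + 1 = i.val ∧ below i = below (i + 3) ++ [i + 3] := by
      decide
    obtain ⟨hv1, hv2⟩ := hval (c x) (by omega)
    obtain ⟨p, hp1, hp2, hp3⟩ := ih hyE (by rw [hyc]; omega) (W := insert y W) (by
      have : ((insert y W).card : ℝ) ≤ W.card + 1 := by exact_mod_cast Finset.card_insert_le y W
      linarith)
    have := (c x).isLt
    exact ⟨p ++ [y], hp1.concat hxy hyW (by omega), by
      rw [List.map_append, hp2, List.map_cons, List.map_nil, hv2, hyc], by simp [hp3]⟩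

/-- The class of a vertex whose typical outneighbours lie in the class `0` or `1`. -/
def OutLow (i : Fin 4) : Prop := i = 0 ∨ i = 3

/-- The class `0` or `1`. -/
def Low (i : Fin 4) : Prop := i = 0 ∨ i = 1

instance : DecidablePred OutLow := fun i => inferInstanceAs (Decidable (i = 0 ∨ i = 3))

instance : DecidablePred Low := fun i => inferInstanceAs (Decidable (i = 0 ∨ i = 1))

/-- Every vertex has many neighbours along edges consistent with the partition. -/
structure Good (γ : ℝ) (G : V → V → Prop) (c : V → Fin 4) : Prop where
  out : ∀ x, γ * Fintype.card V ≤
    (((No G x).filter fun y => Low (c y) ↔ OutLow (c x)).card : ℝ)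
  inn : ∀ y, γ * Fintype.card V ≤
    (((Ni G y).filter fun x => OutLow (c x) ↔ Low (c y)).card : ℝ)

theorem Good.exists_postPath {G : V → V → Prop} {c : V → Fin 4} {E : Finset V} {η γ : ℝ}
    (hG : Good γ G c) (hN : Near η G c E) (hη1 : η ≤ 1 / 1000) (x : V) {W : Finset V}
    (hW : (W.card : ℝ) + 4 ≤ Fintype.card V / 8)
    (hW' : (W.card : ℝ) < (γ - η) * Fintype.card V) :
    ∃ p, PostPath G c E W x p ∧ dl c 3 p = if OutLow (c x) then 0 else 1 := by
  obtain ⟨z, hz, hzZ⟩ := exists_mem_of_card_lt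
    (X := (No G x).filter fun y => Low (c y) ↔ OutLow (c x)) (Z := E ∪ W) (by
      have h1 := hG.out x
      have h2 := hN.exc
      have h3 : ((E ∪ W).card : ℝ) ≤ E.card + W.card := by exact_mod_cast Finset.card_union_le _ _
      rw [sub_mul] at hW'
      exact_mod_cast (show ((E ∪ W).card : ℝ) <
        (((No G x).filter fun y => Low (c y) ↔ OutLow (c x)).card : ℝ) by linarith))
  rw [Finset.mem_union, not_or] at hzZ
  rw [Finset.mem_filter, mem_No] at hz
  obtain ⟨p, hp1, hp2, hp3⟩ := hN.exists_postPath hη1 (3 - (c z).val) hzZ.1 (by omega)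
    (W := insert z W) (by
      have h1 : ((insert z W).card : ℝ) ≤ W.card + 1 := by exact_mod_cast Finset.card_insert_le z W
      have h2 : ((3 - (c z).val : ℕ) : ℝ) ≤ 3 := by exact_mod_cast Nat.sub_le _ _
      linarith)
  refine ⟨z :: p, hp1.cons hz.1 hzZ.2 (by omega), ?_⟩
  have key : ∀ i : Fin 4, (((i :: above i).count 3 : ℕ) : ℤ) - ((i :: above i).count 1 : ℕ) =
      if Low i then 0 else 1 := by decide
  rw [dl, List.map_cons, hp2, key]
  exact if_congr hz.2 rfl rfl

theorem Good.exists_prePath {G : V → V → Prop} {c : V → Fin 4} {E : Finset V} {η γ : ℝ}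
    (hG : Good γ G c) (hN : Near η G c E) (hη1 : η ≤ 1 / 1000) (x : V) {W : Finset V}
    (hW : (W.card : ℝ) + 4 ≤ Fintype.card V / 8)
    (hW' : (W.card : ℝ) < (γ - η) * Fintype.card V) :
    ∃ p, PrePath G c E W x p ∧ dl c 3 p = if Low (c x) then 0 else -1 := by
  obtain ⟨z, hz, hzZ⟩ := exists_mem_of_card_lt
    (X := (Ni G x).filter fun y => OutLow (c y) ↔ Low (c x)) (Z := E ∪ W) (by
      have h1 := hG.inn x
      have h2 := hN.exc
      have h3 : ((E ∪ W).card : ℝ) ≤ E.card + W.card := by exact_mod_cast Finset.card_union_le _ _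
      rw [sub_mul] at hW'
      exact_mod_cast (show ((E ∪ W).card : ℝ) <
        (((Ni G x).filter fun y => OutLow (c y) ↔ Low (c x)).card : ℝ) by linarith))
  rw [Finset.mem_union, not_or] at hzZ
  rw [Finset.mem_filter, mem_Ni] at hz
  obtain ⟨p, hp1, hp2, hp3⟩ := hN.exists_prePath hη1 (c z).val hzZ.1 rfl
    (W := insert z W) (by
      have h1 : ((insert z W).card : ℝ) ≤ W.card + 1 := by exact_mod_cast Finset.card_insert_le z W
      have h2 : ((c z).val : ℝ) ≤ 3 := by exact_mod_cast Nat.le_of_lt_succ (c z).isLt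
      linarith)
  have := (c z).isLt
  refine ⟨p ++ [z], hp1.concat hz.1 hzZ.2 (by omega), ?_⟩
  have key : ∀ i : Fin 4, (((below i ++ [i]).count 3 : ℕ) : ℤ) - ((below i ++ [i]).count 1 : ℕ) =
      if OutLow i then 0 else -1 := by decide
  rw [dl, List.map_append, hp2, List.map_cons, List.map_nil, key]
  exact if_congr hz.2 rfl rfl

/-- The result of gluing an initial piece, a given path and a final piece. -/
theorem exists_superPath_append {G : V → V → Prop} {c : V → Fin 4} {E W : Finset V} {x y : V}
    {p m q : List V} (hp : PrePath G c E W x p) (hq : PostPath G c E (W ∪ p.toFinset) y q)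
    (hx : m.head? = some x) (hy : m.getLast? = some y) (hm : m.IsChain G) (hmn : m.Nodup)
    (hmW : ∀ v ∈ m, v ∈ W) (hm2 : m.length ≤ 2) :
    SuperPath G c E (p ++ m ++ q) ∧ (p ++ m ++ q).Nodup ∧ (∀ v ∈ m, v ∈ p ++ m ++ q) ∧
      (∀ v ∈ p ++ m ++ q, v ∈ W → v ∈ m) ∧ (p ++ m ++ q).length ≤ 10 := by
  refine ⟨superPath_append hp hq hx hy hm, ?_, ?_, ?_, ?_⟩
  · rw [List.nodup_append, List.nodup_append]
    refine ⟨⟨hp.nodup, hmn, ?_⟩, hq.nodup, ?_⟩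
    · rintro a ha b hb rfl
      exact hp.avoid a ha (hmW a hb)
    · rintro a ha b hb rfl
      refine hq.avoid a hb ?_
      rcases List.mem_append.1 ha with h | h
      · exact Finset.mem_union_right _ (List.mem_toFinset.2 h)
      · exact Finset.mem_union_left _ (hmW a h)
  · intro v hv
    simp [hv]
  · intro v hv hvW
    rw [List.mem_append, List.mem_append] at hv
    rcases hv with (h | h) | h
    · exact absurd hvW (hp.avoid v h)
    · exact h
    · exact absurd (Finset.mem_union_left _ hvW) (hq.avoid v h)
  · have := hp.length
    have := hq.length
    simp only [List.length_append]
    omega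

/-- A path that can be extended to a superpath with a controlled class count. -/
def Item (G : V → V → Prop) (c : V → Fin 4) (m : List V) : Prop :=
  (∃ v, m = [v]) ∨ ∃ x y, m = [x, y] ∧ x ≠ y ∧ G x y ∧ OutLow (c x) ∧ ¬ Low (c y)

theorem Good.exists_superPath {G : V → V → Prop} {c : V → Fin 4} {E : Finset V} {η γ : ℝ}
    (hG : Good γ G c) (hN : Near η G c E) (hη1 : η ≤ 1 / 1000) {m : List V} (hm : Item G c m)
    {W : Finset V} (hmW : ∀ v ∈ m, v ∈ W) (hW : (W.card : ℝ) + 8 ≤ Fintype.card V / 8)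
    (hW' : (W.card : ℝ) + 4 < (γ - η) * Fintype.card V) :
    ∃ P, (SuperPath G c E P ∧ dl c 3 P = m.length - 1) ∧ P.Nodup ∧ (∀ v ∈ m, v ∈ P) ∧
      (∀ v ∈ P, v ∈ W → v ∈ m) ∧ P.length ≤ 10 := by
  have main : ∀ x y, m.head? = some x → m.getLast? = some y → m.IsChain G → m.Nodup →
      m.length ≤ 2 → (if Low (c x) then (0 : ℤ) else -1) + dl c 3 m +
        (if OutLow (c y) then (0 : ℤ) else 1) = m.length - 1 →
      ∃ P, (SuperPath G c E P ∧ dl c 3 P = m.length - 1) ∧ P.Nodup ∧ (∀ v ∈ m, v ∈ P) ∧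
      (∀ v ∈ P, v ∈ W → v ∈ m) ∧ P.length ≤ 10 := by
    intro x y hx hy hc hnd hlen hdl
    obtain ⟨p, hp1, hp2⟩ := hG.exists_prePath hN hη1 x (W := W) (by linarith) (by linarith)
    have hWc : ((W ∪ p.toFinset).card : ℝ) ≤ W.card + 4 := by
      have h1 := Finset.card_union_le W p.toFinset
      have h2 := List.toFinset_card_le p
      have h3 := hp1.length
      exact_mod_cast (by omega)
    obtain ⟨q, hq1, hq2⟩ := hG.exists_postPath hN hη1 y (W := W ∪ p.toFinset) (by linarith)
      (by linarith)
    obtain ⟨h1, h2⟩ := exists_superPath_append hp1 hq1 hx hy hc hnd hmW hlen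
    refine ⟨p ++ m ++ q, ⟨h1, ?_⟩, h2⟩
    rw [dl_append, dl_append, hp2, hq2, hdl]
  rcases hm with ⟨v, rfl⟩ | ⟨x, y, rfl, hne, hxy, hx, hy⟩
  · refine main v v rfl rfl (by simp) (by simp) (by simp) ?_
    have key : ∀ i : Fin 4, (if Low i then (0 : ℤ) else -1) +
        ((([i].count 3 : ℕ) : ℤ) - ([i].count 1 : ℕ)) + (if OutLow i then (0 : ℤ) else 1) = 0 := by
      decide
    simp only [dl, List.map_cons, List.map_nil, List.length_singleton]
    exact key (c v)
  · refine main x y rfl rfl (by simpa using hxy) (by simpa using hne) (by simp) ?_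
    have key : ∀ i j : Fin 4, OutLow i → ¬ Low j →
        (if Low i then (0 : ℤ) else -1) +
        ((([i, j].count 3 : ℕ) : ℤ) - ([i, j].count 1 : ℕ)) +
        (if OutLow j then (0 : ℤ) else 1) = 1 := by
      decide
    simp only [dl, List.map_cons, List.map_nil, List.length_cons, List.length_nil]
    exact key (c x) (c y) hx hy

/-- The sequence of classes along a superpath using an edge from class `i` to class `-i`. -/
def word (i : Fin 4) : List (Fin 4) := below i ++ [i, -i] ++ above (-i)

theorem Near.exists_superPath {G : V → V → Prop} (hO : IsOriented G) {c : V → Fin 4} {E : Finset V} {η : ℝ}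
    (hN : Near η G c E) (hη1 : η ≤ 1 / 1000)
    (hd : ∀ i, (Fintype.card V : ℝ) ^ 2 / 60 ≤ ec G (cl c i) (cl c (-i))) (i : Fin 4)
    {W : Finset V} (hEW : E ⊆ W) (hW : (W.card : ℝ) + 8 ≤ Fintype.card V / 125)
    (hn : 0 < (Fintype.card V : ℝ)) :
    ∃ P, (SuperPath G c E P ∧ P.map c = word i) ∧ P.Nodup ∧
      (∀ v ∈ P, v ∉ W) ∧ P.length ≤ 10 := by
  set n : ℝ := (Fintype.card V : ℝ) with hndef
  obtain ⟨x, hx, y, hy, hxW, hyW, hxy⟩ := exists_edge_avoiding (G := G) (cl c i) (cl c (-i)) W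
    (D := n) (fun x _ => by rw [hndef]; exact_mod_cast Finset.card_le_univ _)
    (fun x _ => by rw [hndef]; exact_mod_cast Finset.card_le_univ _) hn.le (by
      refine lt_of_lt_of_le ?_ (hd i)
      have : (W.card : ℝ) * n < n / 125 * n := by gcongr; linarith
      nlinarith)
  rw [mem_cl] at hx hy
  have hne : x ≠ y := by
    rintro rfl
    exact hO x x hxy hxy
  have hW1 : ((insert x (insert y W)).card : ℝ) ≤ W.card + 2 := by
    have h1 := Finset.card_insert_le y W
    have h2 := Finset.card_insert_le x (insert y W)
    exact_mod_cast (by omega)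
  have hW0 : (0 : ℝ) ≤ W.card := by positivity
  have hv3 : ∀ i : Fin 4, (i.val : ℝ) ≤ 3 := fun i => by exact_mod_cast Nat.le_of_lt_succ i.isLt
  obtain ⟨p, hp1, hp2, hp3⟩ := hN.exists_prePath hη1 (c x).val (fun h => hxW (hEW h)) rfl
    (W := insert x (insert y W)) (by rw [← hndef]; linarith [hv3 (c x)])
  have hW2 : ((insert x (insert y W) ∪ p.toFinset).card : ℝ) ≤ W.card + 5 := by
    have h1 := Finset.card_union_le (insert x (insert y W)) p.toFinset
    have h2 := List.toFinset_card_le p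
    have h3 : p.length ≤ 3 := by have := (c x).isLt; omega
    have h4 : ((insert x (insert y W) ∪ p.toFinset).card : ℝ) ≤
      (insert x (insert y W)).card + 3 := by exact_mod_cast (by omega)
    linarith
  obtain ⟨q, hq1, hq2, hq3⟩ := hN.exists_postPath hη1 (3 - (c y).val) (fun h => hyW (hEW h))
    (by have := (c y).isLt; omega) (W := insert x (insert y W) ∪ p.toFinset) (by
      have h2 : ((3 - (c y).val : ℕ) : ℝ) ≤ 3 := by exact_mod_cast Nat.sub_le _ _
      rw [← hndef]
      linarith)
  obtain ⟨h1, h2, h3, h4, h5⟩ := exists_superPath_append (m := [x, y]) hp1 hq1 rfl rfl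
    (by simpa using hxy) (by simpa using hne) (by simp) (by simp)
  refine ⟨p ++ [x, y] ++ q, ⟨h1, ?_⟩, h2, ?_, h5⟩
  · rw [List.map_append, List.map_append, hp2, hq2, word, hx, hy]
    simp [hx, hy]
  · intro v hv hvW
    have := h4 v hv (by simp [hvW])
    simp only [List.mem_cons, List.not_mem_nil, or_false] at this
    rcases this with rfl | rfl
    · exact hxW hvW
    · exact hyW hvW

end Core

section Core
open scoped Classical

theorem forall_mem_of_forall₂ {α β : Type*} {R : α → β → Prop} {Q : β → Prop} {l : List α}
    {l' : List β} (h : List.Forall₂ R l l') (hR : ∀ a b, R a b → Q b) : ∀ b ∈ l', Q b := by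
  induction h with
  | nil => simp
  | cons h1 _ ih =>
    intro b hb
    rcases List.mem_cons.1 hb with rfl | hb
    · exact hR _ _ h1
    · exact ih b hb

/-- A list of edge types with prescribed effect on the class sizes. -/
theorem exists_types (x y : ℤ) : ∃ l : List (Fin 4), l.length = x.natAbs + y.natAbs ∧
    (l.map fun i => ((word i).count 0 : ℤ) - (word i).count 1).sum = x ∧
    (l.map fun i => ((word i).count 2 : ℤ) - (word i).count 1).sum = y ∧
    (l.map fun i => ((word i).count 3 : ℤ) - (word i).count 1).sum = 0 := by
  have k0 : ∀ i : Fin 4, ((word i).count 0 : ℤ) - (word i).count 1 = ![1, 0, 0, -1] i := by decide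
  have k2 : ∀ i : Fin 4, ((word i).count 2 : ℤ) - (word i).count 1 = ![0, -1, 1, 0] i := by decide
  have k3 : ∀ i : Fin 4, ((word i).count 3 : ℤ) - (word i).count 1 = 0 := by decide
  refine ⟨List.replicate x.toNat 0 ++ List.replicate (-x).toNat 3 ++ List.replicate y.toNat 2 ++
    List.replicate (-y).toNat 1, ?_, ?_, ?_, ?_⟩
  · simp only [List.length_append, List.length_replicate]
    omega
  · simp only [k0, List.map_append, List.sum_append, List.map_replicate, List.sum_replicate]
    simp
    omega
  · simp only [k2, List.map_append, List.sum_append, List.map_replicate, List.sum_replicate]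
    simp
    omega
  · simp only [k3]
    simp

variable {V : Type*} [Fintype V]

theorem exists_isHamCycle_of_good {G : V → V → Prop} (hO : IsOriented G) {c : V → Fin 4}
    {E : Finset V} {η γ : ℝ} (hN : Near η G c E) (hη : 0 < η) (hη1 : η ≤ 1 / 1000000)
    (hγ : 50 * η ≤ γ) (hn : 100 ≤ η * Fintype.card V)
    (hd : ∀ i, (Fintype.card V : ℝ) ^ 2 / 60 ≤ ec G (cl c i) (cl c (-i))) (hG : Good γ G c)
    (bad : List (V × V))
    (hb : ∀ e ∈ bad, G e.1 e.2 ∧ OutLow (c e.1) ∧ ¬ Low (c e.2))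
    (hnd : (bad.map fun e => [e.1, e.2]).flatten.Nodup)
    (hq : (cl c 3).card = (cl c 1).card + bad.length) :
    ∃ σ : Equiv.Perm V, IsHamCycle G σ := by
  set n : ℝ := (Fintype.card V : ℝ) with hndef
  have hn1 : 1000000 * (η * n) ≤ n := by nlinarith
  have hγn : 50 * (η * n) ≤ γ * n := by rw [← mul_assoc]; gcongr
  set B := (bad.map fun e => [e.1, e.2]).flatten with hB
  have hBlen : B.length = 2 * bad.length := by
    rw [hB]
    clear * -
    induction bad with
    | nil => rfl
    | cons e l ih => simp only [List.map_cons, List.flatten_cons, List.length_append, ih,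
        List.length_cons, List.length_nil]; omega
  have hq1 : (bad.length : ℝ) ≤ 2 * (η * n) := by
    have h1 := (hN.size 3).2
    have h2 := (hN.size 1).1
    rw [hq] at h1
    push_cast at h1
    linarith
  set items : List (List V) :=
    bad.map (fun e => [e.1, e.2]) ++ (E \ B.toFinset).toList.map (fun v => [v]) with hitems
  have hflat : items.flatten = B ++ (E \ B.toFinset).toList := by
    rw [hitems, List.flatten_append, ← hB]
    congr 1
    generalize (E \ B.toFinset).toList = l
    induction l with
    | nil => rfl
    | cons a l ih => simp [ih]
  have hmap : items.map id = items := List.map_id _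
  have hitlen : (items.length : ℝ) ≤ 3 * (η * n) := by
    have h1 : items.length ≤ bad.length + E.card := by
      rw [hitems, List.length_append, List.length_map, List.length_map, Finset.length_toList]
      have := Finset.card_le_card (Finset.sdiff_subset (s := E) (t := B.toFinset))
      omega
    have h2 : (items.length : ℝ) ≤ bad.length + E.card := by exact_mod_cast h1
    linarith [hN.exc]
  have hWcard : ((E ∪ B.toFinset).card : ℝ) ≤ 5 * (η * n) := by
    have h1 := Finset.card_union_le E B.toFinset
    have h2 := List.toFinset_card_le B
    have h3 : ((E ∪ B.toFinset).card : ℝ) ≤ E.card + 2 * bad.length := by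
      exact_mod_cast (by omega)
    linarith [hN.exc]
  have hItem : ∀ m ∈ items, Item G c m := by
    intro m hm
    rcases List.mem_append.1 hm with hm | hm
    · obtain ⟨e, he, rfl⟩ := List.mem_map.1 hm
      obtain ⟨h1, h2, h3⟩ := hb e he
      refine Or.inr ⟨e.1, e.2, rfl, ?_, h1, h2, h3⟩
      intro h
      rw [h] at h1
      exact hO _ _ h1 h1
    · obtain ⟨v, _, rfl⟩ := List.mem_map.1 hm
      exact Or.inl ⟨v, rfl⟩
  obtain ⟨l₁, hl1, hl1nd, hl1m, -, hl1len⟩ := exists_disjoint_lists (fun m : List V => m)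
    (fun m P => SuperPath G c E P ∧ dl c 3 P = m.length - 1)
    ((E ∪ B.toFinset).card + 10 * items.length) 10 items (by
      intro m hm W hmW hW
      have h1 : (W.card : ℝ) ≤ (E ∪ B.toFinset).card + 10 * items.length := by exact_mod_cast hW
      refine hG.exists_superPath hN (by linarith) (hItem m hm) hmW ?_ ?_
      · rw [← hndef]; linarith
      · rw [← hndef, sub_mul]; linarith) (by
      rw [List.map_id', hflat, List.nodup_append]
      refine ⟨hnd, Finset.nodup_toList _, ?_⟩
      rintro v hv u hu rfl
      rw [Finset.mem_toList, Finset.mem_sdiff, List.mem_toFinset] at hu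
      exact hu.2 hv) (E ∪ B.toFinset) (by
      intro v hv
      rw [List.map_id', hflat, List.mem_append, Finset.mem_toList, Finset.mem_sdiff] at hv
      rw [Finset.mem_union, List.mem_toFinset]
      tauto) le_rfl
  rw [List.map_id', hflat] at hl1m
  have hl1E : ∀ v ∈ E, v ∈ l₁.flatten := by
    intro v hv
    refine hl1m v ?_
    rw [List.mem_append, Finset.mem_toList, Finset.mem_sdiff, List.mem_toFinset]
    tauto
  have hdl1 : dl c 3 l₁.flatten = bad.length := by
    rw [dl_flatten c 3 _ (fun m : List V => (m.length : ℤ) - 1) (fun a P h => h.2) hl1, hitems,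
      List.map_append, List.sum_append, List.map_map, List.map_map]
    simp [Function.comp_def]
  have hl1len' : (l₁.flatten.length : ℝ) ≤ 30 * (η * n) := by
    have : (l₁.flatten.length : ℝ) ≤ 10 * items.length := by exact_mod_cast hl1len
    linarith
  set x : ℤ := (cl c 0).card - (cl c 1).card - dl c 0 l₁.flatten with hx
  set y : ℤ := (cl c 2).card - (cl c 1).card - dl c 2 l₁.flatten with hy
  have hbound : ∀ k, (((((cl c k).card : ℤ) - (cl c 1).card - dl c k l₁.flatten).natAbs : ℕ) : ℝ) ≤
      32 * (η * n) := by
    intro k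
    rw [Nat.cast_natAbs, Int.cast_abs, abs_le, dl]
    have h1 := hN.size k
    have h2 := hN.size 1
    have h3 : (((l₁.flatten.map c).count k : ℕ) : ℝ) ≤ l₁.flatten.length := by
      have := List.count_le_length (a := k) (l := l₁.flatten.map c)
      rw [List.length_map] at this
      exact_mod_cast this
    have h4 : (((l₁.flatten.map c).count 1 : ℕ) : ℝ) ≤ l₁.flatten.length := by
      have := List.count_le_length (a := 1) (l := l₁.flatten.map c)
      rw [List.length_map] at this
      exact_mod_cast this
    have h5 : (0 : ℝ) ≤ ((l₁.flatten.map c).count k : ℕ) := by positivity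
    have h6 : (0 : ℝ) ≤ ((l₁.flatten.map c).count 1 : ℕ) := by positivity
    push_cast
    rw [← hndef] at h1 h2
    constructor <;> linarith [h1.1, h1.2, h2.1, h2.2]
  obtain ⟨ty, hty, hty0, hty2, hty3⟩ := exists_types x y
  have htylen : (ty.length : ℝ) ≤ 64 * (η * n) := by
    rw [hty]
    push_cast
    linarith [hbound 0, hbound 2]
  set W₂ := E ∪ l₁.flatten.toFinset with hW2
  have hW2card : (W₂.card : ℝ) ≤ 31 * (η * n) := by
    have h1 := Finset.card_union_le E l₁.flatten.toFinset
    have h2 := List.toFinset_card_le l₁.flatten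
    have h3 : (W₂.card : ℝ) ≤ E.card + l₁.flatten.length := by
      rw [hW2]; exact_mod_cast (by omega)
    linarith [hN.exc]
  have hmnil : (ty.map fun _ => ([] : List V)).flatten = [] := by simp
  obtain ⟨l₂, hl2, hl2nd, -, hl2W, hl2len⟩ := exists_disjoint_lists
    (fun _ : Fin 4 => ([] : List V)) (fun i P => SuperPath G c E P ∧ P.map c = word i)
    (W₂.card + 10 * ty.length) 10 ty (by
      intro i _ W _ hW
      have h1 : (W.card : ℝ) ≤ W₂.card + 10 * ty.length := by exact_mod_cast hW
      have h2 : ((W ∪ E).card : ℝ) ≤ W.card + E.card := by exact_mod_cast Finset.card_union_le _ _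
      obtain ⟨P, hP1, hP2, hP3, hP4⟩ := hN.exists_superPath hO (by linarith) hd i (W := W ∪ E)
        Finset.subset_union_right (by rw [← hndef]; linarith [hN.exc]) (by rw [← hndef]; linarith)
      exact ⟨P, hP1, hP2, by simp,
        fun v hv hvW => absurd (Finset.mem_union_left _ hvW) (hP3 v hv), hP4⟩)
    (by rw [hmnil]; simp) W₂ (by rw [hmnil]; simp) le_rfl
  rw [hmnil] at hl2W
  have hdl2 : ∀ k, dl c k l₂.flatten =
      (ty.map fun i => ((word i).count k : ℤ) - (word i).count 1).sum := fun k =>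
    dl_flatten c k _ _ (fun a P h => by rw [dl, h.2]) hl2
  have hndL : (l₁ ++ l₂).flatten.Nodup := by
    rw [List.flatten_append, List.nodup_append]
    refine ⟨hl1nd, hl2nd, ?_⟩
    rintro v hv u hu rfl
    have := hl2W v hu (Finset.mem_union_right _ (List.mem_toFinset.2 hv))
    simp at this
  refine exists_isHamCycle_of_balanced hN (by linarith) ?_ (l₁ ++ l₂) ?_ hndL ?_ ?_ ?_
  · have : (100 : ℝ) ≤ n := by linarith
    rw [hndef] at this
    exact_mod_cast this
  · intro P hP
    rcases List.mem_append.1 hP with h | h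
    · exact forall_mem_of_forall₂ hl1 (fun _ _ h => h.1) P h
    · exact forall_mem_of_forall₂ hl2 (fun _ _ h => h.1) P h
  · intro v hv
    rw [List.flatten_append]
    exact List.mem_append_left _ (hl1E v hv)
  · have h1 : (l₂.flatten.length : ℝ) ≤ 10 * ty.length := by exact_mod_cast hl2len
    rw [List.flatten_append, List.length_append]
    push_cast
    rw [← hndef]
    linarith
  · have key : ∀ k, (((l₁ ++ l₂).flatten.toFinsetᶜ ∩ cl c k).card : ℤ) -
        ((l₁ ++ l₂).flatten.toFinsetᶜ ∩ cl c 1).card =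
        (cl c k).card - (cl c 1).card - dl c k l₁.flatten - dl c k l₂.flatten := by
      intro k
      rw [card_compl_inter_cl c k hndL, card_compl_inter_cl c 1 hndL]
      have := dl_append c k l₁.flatten l₂.flatten
      rw [← List.flatten_append] at this
      rw [sub_sub _ (dl c k l₁.flatten), ← this, dl]
      ring
    have h0 := key 0
    have h2 := key 2
    have h3 := key 3
    rw [hdl2] at h0 h2 h3
    rw [hty0] at h0
    rw [hty2] at h2
    rw [hty3, hdl1, hq] at h3
    intro k
    fin_cases k
    · show ((l₁ ++ l₂).flatten.toFinsetᶜ ∩ cl c 0).card = _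
      omega
    · rfl
    · show ((l₁ ++ l₂).flatten.toFinsetᶜ ∩ cl c 2).card = _
      omega
    · show ((l₁ ++ l₂).flatten.toFinsetᶜ ∩ cl c 3).card = _
      push_cast at h3
      omega

end Core

section Core
open scoped Classical

variable {V : Type*} [Fintype V]

theorem outLow_cls {S T : Finset V} {v : V} : OutLow (cls S T v) ↔ v ∈ S := mem_left_iff_cls.symm

theorem low_cls {S T : Finset V} {v : V} : Low (cls S T v) ↔ v ∈ T := mem_right_iff_cls.symm

theorem cls_congr {S T S' T' : Finset V} {v : V} (hS : v ∈ S' ↔ v ∈ S) (hT : v ∈ T' ↔ v ∈ T) :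
    cls S' T' v = cls S T v := by
  simp only [cls, hS, hT]

theorem cls_compl (S T : Finset V) (v : V) : cls Sᶜ Tᶜ v = cls S T v + 2 := by
  simp only [cls, Finset.mem_compl]
  split_ifs <;> rfl

theorem cl_cls_compl (S T : Finset V) (i : Fin 4) : cl (cls Sᶜ Tᶜ) i = cl (cls S T) (i + 2) := by
  have h : ∀ j i : Fin 4, j + 2 = i ↔ j = i + 2 := by decide
  ext v
  rw [mem_cl, mem_cl, cls_compl, h]

theorem Near.compl {G : V → V → Prop} {S T E : Finset V} {η : ℝ} (hN : Near η G (cls S T) E) :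
    Near η G (cls Sᶜ Tᶜ) E where
  size i := by rw [cl_cls_compl]; exact hN.size _
  exc := hN.exc
  out v hv := by
    rw [cl_cls_compl, cls_compl]
    have h : ∀ j : Fin 4, j + 2 + 1 + 2 = j + 1 := by decide
    rw [h]
    exact hN.out v hv
  inn v hv := by
    rw [cl_cls_compl, cls_compl]
    have h : ∀ j : Fin 4, j + 2 + 3 + 2 = j + 3 := by decide
    rw [h]
    exact hN.inn v hv

theorem card_le_card_add_of_subset_union {X Y Z : Finset V} (h : X ⊆ Y ∪ Z) :
    (X.card : ℝ) ≤ Y.card + Z.card := by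
  exact_mod_cast (Finset.card_le_card h).trans (Finset.card_union_le Y Z)

theorem subset_cl_union {c c' : V → Fin 4} {E : Finset V} (h : ∀ v ∉ E, c' v = c v) (i : Fin 4) :
    cl c i ⊆ cl c' i ∪ E := by
  intro v hv
  rw [mem_cl] at hv
  rw [Finset.mem_union, mem_cl]
  by_cases hE : v ∈ E
  · exact Or.inr hE
  · exact Or.inl ((h v hE).trans hv)

theorem Near.congr {G : V → V → Prop} {c c' : V → Fin 4} {E E' : Finset V} {η : ℝ}
    (hN : Near η G c E) (hEE : E ⊆ E') (hE' : (E'.card : ℝ) ≤ 5 * (η * Fintype.card V))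
    (hc : ∀ v ∉ E', c' v = c v) : Near (10 * η) G c' E' := by
  have h0 : 0 ≤ η * Fintype.card V := (Nat.cast_nonneg _).trans hN.exc
  have hc' : ∀ v ∉ E', c v = c' v := fun v hv => (hc v hv).symm
  refine ⟨fun i => ?_, by linarith, fun v hv => ?_, fun v hv => ?_⟩
  · have h1 := card_le_card_add_of_subset_union (subset_cl_union hc i)
    have h2 := card_le_card_add_of_subset_union (subset_cl_union hc' i)
    have h3 := hN.size i
    constructor <;> linarith [h3.1, h3.2]
  · have h1 : cl c' (c' v + 1) \ No G v ⊆ (cl c (c v + 1) \ No G v) ∪ E' := by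
      rw [hc v hv]
      intro u hu
      have := subset_cl_union hc' (c v + 1) (Finset.mem_sdiff.1 hu).1
      rw [Finset.mem_sdiff] at hu
      rw [Finset.mem_union] at this
      rw [Finset.mem_union, Finset.mem_sdiff]
      tauto
    have h2 := card_le_card_add_of_subset_union h1
    have h3 := hN.out v fun h => hv (hEE h)
    linarith
  · have h1 : cl c' (c' v + 3) \ Ni G v ⊆ (cl c (c v + 3) \ Ni G v) ∪ E' := by
      rw [hc v hv]
      intro u hu
      have := subset_cl_union hc' (c v + 3) (Finset.mem_sdiff.1 hu).1
      rw [Finset.mem_sdiff] at hu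
      rw [Finset.mem_union] at this
      rw [Finset.mem_union, Finset.mem_sdiff]
      tauto
    have h2 := card_le_card_add_of_subset_union h1
    have h3 := hN.inn v fun h => hv (hEE h)
    linarith

theorem ec_le_of_subset_union (G : V → V → Prop) {X Y X' Y' Z : Finset V} (hX : X ⊆ X' ∪ Z)
    (hY : Y ⊆ Y' ∪ Z) : (ec G X Y : ℝ) ≤ ec G X' Y' + 2 * (Z.card * Fintype.card V) := by
  have h1 : ec G X Y ≤ ec G X' Y + ec G Z Y := by
    calc ec G X Y ≤ ∑ x ∈ X' ∪ Z, (No G x ∩ Y).card := Finset.sum_le_sum_of_subset hX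
      _ ≤ _ := by
        rw [ec, ec, ← Finset.sum_union_inter]
        exact Nat.le_add_right _ _
  have h2 : ec G X' Y ≤ ec G X' Y' + ec G X' Z := by
    rw [ec, ec, ec, ← Finset.sum_add_distrib]
    refine Finset.sum_le_sum fun x _ => ?_
    refine (Finset.card_le_card (Finset.inter_subset_inter_left hY)).trans ?_
    rw [Finset.inter_union_distrib_left]
    exact Finset.card_union_le _ _
  have h3 : ec G Z Y ≤ Z.card * Fintype.card V := by
    rw [ec, ← smul_eq_mul]
    exact Finset.sum_le_card_nsmul _ _ _ fun x _ => Finset.card_le_univ _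
  have h4 : ec G X' Z ≤ Z.card * Fintype.card V := by
    rw [ec_eq_sum_in, ← smul_eq_mul]
    exact Finset.sum_le_card_nsmul _ _ _ fun x _ => Finset.card_le_univ _
  have h5 : ec G X Y ≤ ec G X' Y' + 2 * (Z.card * Fintype.card V) := by omega
  exact_mod_cast h5

/-- The pair `S`, `T` is compatible with the adjacencies of `G` to the pair `S₀`, `T₀`. -/
structure Placed (β : ℝ) (G : V → V → Prop) (S₀ T₀ S T : Finset V) : Prop where
  out_mem : ∀ v ∈ S, β * Fintype.card V ≤ ((No G v ∩ T₀).card : ℝ)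
  out_notMem : ∀ v ∉ S, β * Fintype.card V ≤ ((No G v ∩ T₀ᶜ).card : ℝ)
  in_mem : ∀ v ∈ T, β * Fintype.card V ≤ ((Ni G v ∩ S₀).card : ℝ)
  in_notMem : ∀ v ∉ T, β * Fintype.card V ≤ ((Ni G v ∩ S₀ᶜ).card : ℝ)

theorem Placed.compl {G : V → V → Prop} {S₀ T₀ S T : Finset V} {β : ℝ}
    (h : Placed β G S₀ T₀ S T) : Placed β G S₀ᶜ T₀ᶜ Sᶜ Tᶜ where
  out_mem v hv := h.out_notMem v (Finset.mem_compl.1 hv)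
  out_notMem v hv := by
    rw [compl_compl]
    exact h.out_mem v (by simpa using hv)
  in_mem v hv := h.in_notMem v (Finset.mem_compl.1 hv)
  in_notMem v hv := by
    rw [compl_compl]
    exact h.in_mem v (by simpa using hv)

theorem Placed.good {G : V → V → Prop} {S₀ T₀ S T E : Finset V} {β ε γ : ℝ}
    (h : Placed β G S₀ T₀ S T) (hE : (E.card : ℝ) ≤ ε * Fintype.card V) (hγ : γ + ε ≤ β)
    (hS : ∀ v ∉ E, v ∈ S ↔ v ∈ S₀) (hT : ∀ v ∉ E, v ∈ T ↔ v ∈ T₀) : Good γ G (cls S T) := by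
  have hγ' : γ * Fintype.card V + ε * Fintype.card V ≤ β * Fintype.card V := by
    rw [← add_mul]; gcongr
  have key : ∀ (X Y : Finset V) (P : V → Prop) {_ : DecidablePred P}, β * Fintype.card V ≤ ((X ∩ Y).card : ℝ) →
      (∀ v ∉ E, v ∈ Y → P v) → γ * Fintype.card V ≤ ((X.filter P).card : ℝ) := by
    intro X Y P _ h1 h2
    have h3 : X ∩ Y ⊆ X.filter P ∪ E := by
      intro v hv
      rw [Finset.mem_inter] at hv
      rw [Finset.mem_union, Finset.mem_filter]
      by_cases hvE : v ∈ E
      · exact Or.inr hvE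
      · exact Or.inl ⟨hv.1, h2 v hvE hv.2⟩
    have h4 := card_le_card_add_of_subset_union h3
    linarith
  constructor
  · intro x
    simp only [outLow_cls, low_cls]
    by_cases hx : x ∈ S
    · refine key _ _ _ (h.out_mem x hx) fun v hvE hv => ?_
      simpa [hx, hT v hvE] using hv
    · refine key _ _ _ (h.out_notMem x hx) fun v hvE hv => ?_
      simpa [hx, hT v hvE] using hv
  · intro x
    simp only [outLow_cls, low_cls]
    by_cases hx : x ∈ T
    · refine key _ _ _ (h.in_mem x hx) fun v hvE hv => ?_
      simpa [hx, hS v hvE] using hv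
    · refine key _ _ _ (h.in_notMem x hx) fun v hvE hv => ?_
      simpa [hx, hS v hvE] using hv

theorem exists_subsets_card {α : Type*} (A B : Finset α) (q : ℕ) :
    ∃ A' ⊆ A, ∃ B' ⊆ B, A'.card + B'.card ≤ q ∧ (A'.card + B'.card = q ∨ A' = A ∧ B' = B) := by
  rcases le_total q A.card with h | h
  · obtain ⟨A', hA, hc⟩ := Finset.exists_subset_card_eq h
    exact ⟨A', hA, ∅, by simp, by simp [hc], by simp [hc]⟩
  · rcases le_total (q - A.card) B.card with h' | h'
    · obtain ⟨B', hB, hc⟩ := Finset.exists_subset_card_eq h'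
      exact ⟨A, subset_rfl, B', hB, by omega, Or.inl (by omega)⟩
    · exact ⟨A, subset_rfl, B, subset_rfl, by omega, Or.inr ⟨rfl, rfl⟩⟩

/-- Vertex-disjoint edges from `S` to the complement of `T`. -/
theorem exists_disjoint_edges {G : V → V → Prop} (hO : IsOriented G) {X Y : Finset V} {q : ℕ}
    {D : ℝ} (hD : 0 ≤ D) (hX : ∀ x ∈ X, ((No G x ∩ Y).card : ℝ) ≤ D)
    (hY : ∀ y ∈ Y, ((Ni G y ∩ X).card : ℝ) ≤ D) (h : 4 * q * D < ec G X Y) :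
    ∃ bad : List (V × V), bad.length = q ∧ (∀ e ∈ bad, G e.1 e.2 ∧ e.1 ∈ X ∧ e.2 ∈ Y) ∧
      (bad.map fun e => [e.1, e.2]).flatten.Nodup := by
  rcases isEmpty_or_nonempty V with hV | ⟨⟨v₀⟩⟩
  · have h1 : ec G X Y = 0 := by rw [ec]; simp [Finset.eq_empty_of_isEmpty]
    rw [h1, Nat.cast_zero] at h
    have : (0 : ℝ) ≤ 4 * q * D := by positivity
    linarith
  have : Inhabited (V × V) := ⟨(v₀, v₀)⟩
  obtain ⟨f, hf, hdis⟩ := exists_disjoint_family (fun e : V × V => {e.1, e.2}) 2 q ∅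
    (fun _ e => G e.1 e.2 ∧ e.1 ∈ X ∧ e.2 ∈ Y) (by
      intro i _ W' _ hW'
      have h1 : (W'.card : ℝ) ≤ q * 2 := by
        rw [Finset.card_empty, zero_add] at hW'
        exact_mod_cast hW'
      obtain ⟨x, hx, y, hy, hxW, hyW, hxy⟩ := exists_edge_avoiding X Y W' hX hY hD
        (lt_of_le_of_lt (by nlinarith) h)
      refine ⟨(x, y), ⟨hxy, hx, hy⟩, ?_, Finset.card_le_two⟩
      simp [hxW, hyW])
  refine ⟨(List.range q).map f, by simp, ?_, ?_⟩
  · intro e he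
    obtain ⟨i, hi, rfl⟩ := List.mem_map.1 he
    exact (hf i (List.mem_range.1 hi)).1
  · rw [List.map_map, List.nodup_flatten]
    constructor
    · intro l hl
      obtain ⟨i, hi, rfl⟩ := List.mem_map.1 hl
      have h1 := (hf i (List.mem_range.1 hi)).1.1
      have h2 : (f i).1 ≠ (f i).2 := fun h => by rw [h] at h1; exact hO _ _ h1 h1
      simpa using h2
    · rw [List.pairwise_map]
      refine List.Pairwise.imp_of_mem ?_ (List.nodup_range (n := q))
      intro i j hi hj hij
      have h1 := hdis i (List.mem_range.1 hi) j (List.mem_range.1 hj) hij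
      rw [List.disjoint_left]
      rw [Finset.disjoint_left] at h1
      intro v hv hv'
      exact h1 (a := v) (by simpa using hv) (by simpa using hv')

end Core

section Core
open scoped Classical

variable {V : Type*} [Fintype V]

theorem exists_isHamCycle_of_placed_of_le {G : V → V → Prop} (hO : IsOriented G) (hd : DegCond G)
    {S₀ T₀ S T E : Finset V} {η : ℝ} (hη : 0 < η) (hη1 : η ≤ 1 / 10000000)
    (hn : 100 ≤ η * Fintype.card V) (hN : Near η G (cls S₀ T₀) E)
    (hdense : ∀ i, (Fintype.card V : ℝ) ^ 2 / 50 ≤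
      ec G (cl (cls S₀ T₀) i) (cl (cls S₀ T₀) (-i)))
    (hP : Placed (1 / 1000) G S₀ T₀ S T) (hS : ∀ v ∉ E, v ∈ S ↔ v ∈ S₀)
    (hT : ∀ v ∉ E, v ∈ T ↔ v ∈ T₀) (hST : T.card ≤ S.card) :
    ∃ σ : Equiv.Perm V, IsHamCycle G σ := by
  set n : ℝ := (Fintype.card V : ℝ) with hndef
  have hηn : 10000000 * (η * n) ≤ n := by nlinarith
  set A := S.filter fun v => 1 / 1000 * n ≤ ((No G v ∩ T₀ᶜ).card : ℝ) with hA
  set B := Tᶜ.filter fun v => 1 / 1000 * n ≤ ((Ni G v ∩ S₀).card : ℝ) with hB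
  obtain ⟨A', hA', B', hB', hle, hor⟩ := exists_subsets_card A B (S.card - T.card)
  have hA'S : A' ⊆ S := hA'.trans (Finset.filter_subset _ _)
  have hB'T : Disjoint T B' := by
    rw [Finset.disjoint_left]
    intro v hv hvB
    exact Finset.mem_compl.1 (Finset.mem_filter.1 (hB' hvB)).1 hv
  set S₂ := S \ A' with hS2
  set T₂ := T ∪ B' with hT2
  set E₂ := E ∪ (A' ∪ B') with hE2
  have hS2c : S₂.card + A'.card = S.card := Finset.card_sdiff_add_card_eq_card hA'S
  have hT2c : T₂.card = T.card + B'.card := Finset.card_union_of_disjoint hB'T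
  have hEc := hN.exc
  have hST4 : (S.card : ℝ) - T.card ≤ 4 * (η * n) := by
    have h1 : S ⊆ S₀ ∪ E := fun v hv => by
      rw [Finset.mem_union]
      by_cases hE : v ∈ E
      · exact Or.inr hE
      · exact Or.inl ((hS v hE).1 hv)
    have h2 : T₀ ⊆ T ∪ E := fun v hv => by
      rw [Finset.mem_union]
      by_cases hE : v ∈ E
      · exact Or.inr hE
      · exact Or.inl ((hT v hE).2 hv)
    have h3 := card_le_card_add_of_subset_union h1
    have h4 := card_le_card_add_of_subset_union h2
    have h5 : (S₀.card : ℝ) = (cl (cls S₀ T₀) 0).card + (cl (cls S₀ T₀) 3).card := by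
      exact_mod_cast card_left_eq S₀ T₀
    have h6 : (T₀.card : ℝ) = (cl (cls S₀ T₀) 0).card + (cl (cls S₀ T₀) 1).card := by
      exact_mod_cast card_right_eq S₀ T₀
    have h7 := (hN.size 3).2
    have h8 := (hN.size 1).1
    linarith
  have hE2c : (E₂.card : ℝ) ≤ 5 * (η * n) := by
    have h1 : E₂.card ≤ E.card + (A' ∪ B').card := Finset.card_union_le _ _
    have h2 := Finset.card_union_le A' B'
    have h3 : E₂.card + T.card ≤ E.card + S.card := by omega
    have h4 : (E₂.card : ℝ) + T.card ≤ E.card + S.card := by exact_mod_cast h3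
    linarith
  have hEE2 : E ⊆ E₂ := Finset.subset_union_left
  have hS2' : ∀ v ∉ E₂, v ∈ S₂ ↔ v ∈ S₀ := by
    intro v hv
    simp only [hE2, Finset.mem_union, not_or] at hv
    rw [hS2, Finset.mem_sdiff, hS v hv.1]
    tauto
  have hT2' : ∀ v ∉ E₂, v ∈ T₂ ↔ v ∈ T₀ := by
    intro v hv
    simp only [hE2, Finset.mem_union, not_or] at hv
    rw [hT2, Finset.mem_union, hT v hv.1]
    tauto
  have hcls : ∀ v ∉ E₂, cls S₂ T₂ v = cls S₀ T₀ v := fun v hv => cls_congr (hS2' v hv) (hT2' v hv)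
  have hN2 : Near (10 * η) G (cls S₂ T₂) E₂ := hN.congr hEE2 hE2c hcls
  have hdense2 : ∀ i, n ^ 2 / 60 ≤ ec G (cl (cls S₂ T₂) i) (cl (cls S₂ T₂) (-i)) := by
    intro i
    have h1 := ec_le_of_subset_union G (subset_cl_union hcls i) (subset_cl_union hcls (-i))
    have h2 := hdense i
    have h3 : (E₂.card : ℝ) * n ≤ 5 * (η * n) * n := by gcongr
    have h4 : 10000000 * (η * n) * n ≤ n * n := by gcongr
    rw [← hndef] at h1
    nlinarith
  have hP2 : Placed (1 / 1000) G S₀ T₀ S₂ T₂ := by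
    refine ⟨fun v hv => hP.out_mem v (Finset.mem_sdiff.1 hv).1, fun v hv => ?_, fun v hv => ?_,
      fun v hv => hP.in_notMem v fun h => hv (Finset.mem_union_left _ h)⟩
    · by_cases hvS : v ∈ S
      · have : v ∈ A' := by
          by_contra h
          exact hv (Finset.mem_sdiff.2 ⟨hvS, h⟩)
        exact (Finset.mem_filter.1 (hA' this)).2
      · exact hP.out_notMem v hvS
    · rcases Finset.mem_union.1 hv with h | h
      · exact hP.in_mem v h
      · exact (Finset.mem_filter.1 (hB' h)).2
  have hgood : Good (1 / 2000) G (cls S₂ T₂) :=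
    hP2.good (E := E₂) (ε := 5 * η) (by rw [← hndef]; linarith) (by linarith) hS2' hT2'
  have hleft := card_left_eq S₂ T₂
  have hright := card_right_eq S₂ T₂
  have hfin : ∀ bad : List (V × V), bad.length = S₂.card - T₂.card →
      (∀ e ∈ bad, G e.1 e.2 ∧ e.1 ∈ S₂ ∧ e.2 ∈ T₂ᶜ) →
      (bad.map fun e => [e.1, e.2]).flatten.Nodup → ∃ σ : Equiv.Perm V, IsHamCycle G σ := by
    intro bad hlen hb hnd
    refine exists_isHamCycle_of_good hO hN2 (by linarith) (by linarith) (by linarith)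
      (by rw [← hndef]; linarith) hdense2 hgood bad (fun e he => ?_) hnd (by omega)
    rw [outLow_cls, low_cls, ← Finset.mem_compl]
    exact hb e he
  rcases Nat.eq_zero_or_pos (S₂.card - T₂.card) with h0 | h0
  · exact hfin [] (by simp [h0]) (by simp) (by simp)
  obtain ⟨rfl, rfl⟩ : A' = A ∧ B' = B := hor.resolve_left fun h => by omega
  have hcn := counts hO (cls S₂ T₂) (d := 3 / 8 * n - 1 / 2) fun x => ⟨hd.out x, hd.inn x⟩
  have hbad := hcn.bad (q := ((S₂.card - T₂.card : ℕ) : ℝ)) le_rfl (fun i => by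
    have := (hN2.size i).1
    rw [← hndef] at this
    linarith) (by exact_mod_cast h0) (by
    have : (cl (cls S₂ T₂) 3).card = (cl (cls S₂ T₂) 1).card + (S₂.card - T₂.card) := by omega
    exact_mod_cast this)
  have hbad' : ((S₂.card - T₂.card : ℕ) : ℝ) * n / 60 ≤ ec G S₂ T₂ᶜ := by
    rw [ec_bad_eq]
    push_cast
    exact hbad
  have hsub : ∀ (X Y Z : Finset V), Y ⊆ Z ∪ E₂ → ((X ∩ Z).card : ℝ) < 1 / 1000 * n →
      ((X ∩ Y).card : ℝ) ≤ 1 / 500 * n := by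
    intro X Y Z h1 h2
    have h3 : X ∩ Y ⊆ X ∩ Z ∪ E₂ := by
      intro v hv
      rw [Finset.mem_inter] at hv
      have := h1 hv.2
      rw [Finset.mem_union] at this
      rw [Finset.mem_union, Finset.mem_inter]
      tauto
    have h4 := card_le_card_add_of_subset_union h3
    linarith
  have hn0 : 0 < n := by linarith
  obtain ⟨bad, hb1, hb2, hb3⟩ := exists_disjoint_edges hO (X := S₂) (Y := T₂ᶜ)
    (q := S₂.card - T₂.card) (D := 1 / 500 * n) (by positivity) (fun x hx => by
      refine hsub _ _ T₀ᶜ (fun v hv => ?_) ?_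
      · rw [Finset.mem_union, Finset.mem_compl]
        by_cases hE : v ∈ E₂
        · exact Or.inr hE
        · exact Or.inl fun h => Finset.mem_compl.1 hv ((hT2' v hE).2 h)
      · rw [hS2, hA, Finset.mem_sdiff, Finset.mem_filter] at hx
        have := hx.2
        push Not at this
        exact this hx.1) (fun y hy => by
      refine hsub _ _ S₀ (fun v hv => ?_) ?_
      · rw [Finset.mem_union]
        by_cases hE : v ∈ E₂
        · exact Or.inr hE
        · exact Or.inl ((hS2' v hE).1 hv)
      · rw [hT2, hB, Finset.mem_compl, Finset.mem_union, Finset.mem_filter, not_or,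
          Finset.mem_compl] at hy
        have := hy.2
        push Not at this
        exact this hy.1) (by
      have hq : (1 : ℝ) ≤ ((S₂.card - T₂.card : ℕ) : ℝ) := by exact_mod_cast h0
      have : n ≤ ((S₂.card - T₂.card : ℕ) : ℝ) * n := le_mul_of_one_le_left hn0.le hq
      refine lt_of_lt_of_le ?_ hbad'
      linarith)
  exact hfin bad hb1 hb2 hb3

theorem exists_isHamCycle_of_placed {G : V → V → Prop} (hO : IsOriented G) (hd : DegCond G)
    {S₀ T₀ S T E : Finset V} {η : ℝ} (hη : 0 < η) (hη1 : η ≤ 1 / 10000000)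
    (hn : 100 ≤ η * Fintype.card V) (hN : Near η G (cls S₀ T₀) E)
    (hdense : ∀ i, (Fintype.card V : ℝ) ^ 2 / 50 ≤
      ec G (cl (cls S₀ T₀) i) (cl (cls S₀ T₀) (-i)))
    (hP : Placed (1 / 1000) G S₀ T₀ S T) (hS : ∀ v ∉ E, v ∈ S ↔ v ∈ S₀)
    (hT : ∀ v ∉ E, v ∈ T ↔ v ∈ T₀) :
    ∃ σ : Equiv.Perm V, IsHamCycle G σ := by
  rcases le_total T.card S.card with h | h
  · exact exists_isHamCycle_of_placed_of_le hO hd hη hη1 hn hN hdense hP hS hT h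
  · refine exists_isHamCycle_of_placed_of_le hO hd hη hη1 hn hN.compl (fun i => ?_) hP.compl
      (fun v hv => ?_) (fun v hv => ?_) ?_
    · have h4 : ∀ i : Fin 4, -i + 2 = -(i + 2) := by decide
      rw [cl_cls_compl, cl_cls_compl, h4]
      exact hdense (i + 2)
    · rw [Finset.mem_compl, Finset.mem_compl, hS v hv]
    · rw [Finset.mem_compl, Finset.mem_compl, hT v hv]
    · rw [Finset.card_compl, Finset.card_compl]
      omega

theorem exists_placed {G : V → V → Prop} (hd : DegCond G) {S₀ T₀ E : Finset V} {η : ℝ}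
    (hη1 : η ≤ 1 / 1000) (hn : 100 ≤ Fintype.card V) (hN : Near η G (cls S₀ T₀) E) :
    ∃ S T, Placed (1 / 1000) G S₀ T₀ S T ∧ (∀ v ∉ E, v ∈ S ↔ v ∈ S₀) ∧
      ∀ v ∉ E, v ∈ T ↔ v ∈ T₀ := by
  set n : ℝ := (Fintype.card V : ℝ) with hndef
  have hn' : (100 : ℝ) ≤ n := by rw [hndef]; exact_mod_cast hn
  have hηn : η * n ≤ 1 / 1000 * n := by gcongr
  have hout : ∀ v ∉ E, ∀ Z : Finset V, (∀ u, cls S₀ T₀ u = cls S₀ T₀ v + 1 → u ∈ Z) →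
      1 / 1000 * n ≤ ((No G v ∩ Z).card : ℝ) := by
    intro v hv Z hZ
    have h1 := hN.out v hv
    have h2 := (hN.size (cls S₀ T₀ v + 1)).1
    have h3 : cl (cls S₀ T₀) (cls S₀ T₀ v + 1) ⊆ (No G v ∩ Z) ∪
        (cl (cls S₀ T₀) (cls S₀ T₀ v + 1) \ No G v) := by
      intro u hu
      have := hZ u (mem_cl.1 hu)
      rw [Finset.mem_union, Finset.mem_inter, Finset.mem_sdiff]
      tauto
    have h4 := card_le_card_add_of_subset_union h3
    rw [← hndef] at h1 h2
    linarith
  have hinn : ∀ v ∉ E, ∀ Z : Finset V, (∀ u, cls S₀ T₀ u = cls S₀ T₀ v + 3 → u ∈ Z) →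
      1 / 1000 * n ≤ ((Ni G v ∩ Z).card : ℝ) := by
    intro v hv Z hZ
    have h1 := hN.inn v hv
    have h2 := (hN.size (cls S₀ T₀ v + 3)).1
    have h3 : cl (cls S₀ T₀) (cls S₀ T₀ v + 3) ⊆ (Ni G v ∩ Z) ∪
        (cl (cls S₀ T₀) (cls S₀ T₀ v + 3) \ Ni G v) := by
      intro u hu
      have := hZ u (mem_cl.1 hu)
      rw [Finset.mem_union, Finset.mem_inter, Finset.mem_sdiff]
      tauto
    have h4 := card_le_card_add_of_subset_union h3
    rw [← hndef] at h1 h2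
    linarith
  have hcompl : ∀ X Z : Finset V, 3 / 8 * n - 1 / 2 ≤ X.card →
      ¬ 1 / 1000 * n ≤ ((X ∩ Z).card : ℝ) → 1 / 1000 * n ≤ ((X ∩ Zᶜ).card : ℝ) := by
    intro X Z h1 h2
    have h3 : X ⊆ X ∩ Z ∪ X ∩ Zᶜ := by
      rw [← Finset.inter_union_distrib_left, Finset.union_compl, Finset.inter_univ]
    have h4 := card_le_card_add_of_subset_union h3
    linarith
  have f1 : ∀ i j : Fin 4, i = 0 ∨ i = 3 → j = i + 1 → j = 0 ∨ j = 1 := by decide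
  have f2 : ∀ i j : Fin 4, ¬ (i = 0 ∨ i = 3) → j = i + 1 → ¬ (j = 0 ∨ j = 1) := by decide
  have f3 : ∀ i j : Fin 4, i = 0 ∨ i = 1 → j = i + 3 → j = 0 ∨ j = 3 := by decide
  have f4 : ∀ i j : Fin 4, ¬ (i = 0 ∨ i = 1) → j = i + 3 → ¬ (j = 0 ∨ j = 3) := by decide
  set S := Finset.univ.filter fun v =>
    if v ∈ E then 1 / 1000 * n ≤ ((No G v ∩ T₀).card : ℝ) else v ∈ S₀ with hS
  set T := Finset.univ.filter fun v =>
    if v ∈ E then 1 / 1000 * n ≤ ((Ni G v ∩ S₀).card : ℝ) else v ∈ T₀ with hT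
  refine ⟨S, T, ⟨fun v hv => ?_, fun v hv => ?_, fun v hv => ?_, fun v hv => ?_⟩,
    fun v hv => ?_, fun v hv => ?_⟩
  · simp only [hS, Finset.mem_filter, Finset.mem_univ, true_and] at hv
    split_ifs at hv with hE
    · exact hv
    · exact hout v hE _ fun u hu => mem_right_iff_cls.2 (f1 _ _ (mem_left_iff_cls.1 hv) hu)
  · simp only [hS, Finset.mem_filter, Finset.mem_univ, true_and] at hv
    split_ifs at hv with hE
    · exact hcompl _ _ (hd.out v) hv
    · exact hout v hE _ fun u hu => Finset.mem_compl.2 fun h =>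
        f2 _ _ (fun h' => hv (mem_left_iff_cls.2 h')) hu (mem_right_iff_cls.1 h)
  · simp only [hT, Finset.mem_filter, Finset.mem_univ, true_and] at hv
    split_ifs at hv with hE
    · exact hv
    · exact hinn v hE _ fun u hu => mem_left_iff_cls.2 (f3 _ _ (mem_right_iff_cls.1 hv) hu)
  · simp only [hT, Finset.mem_filter, Finset.mem_univ, true_and] at hv
    split_ifs at hv with hE
    · exact hcompl _ _ (hd.inn v) hv
    · exact hinn v hE _ fun u hu => Finset.mem_compl.2 fun h =>
        f4 _ _ (fun h' => hv (mem_right_iff_cls.2 h')) hu (mem_left_iff_cls.1 h)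
  · simp [hS, hv]
  · simp [hT, hv]

theorem exists_isHamCycle_of_degCond : ∃ n₀ : ℕ, ∀ (V : Type) [Fintype V] (G : V → V → Prop),
    n₀ ≤ Fintype.card V → IsOriented G → DegCond G → ∃ σ : Equiv.Perm V, IsHamCycle G σ := by
  set η : ℝ := 1 / 10000000 with hη
  obtain ⟨n₁, hn1⟩ := exists_isHamCycle_of_expander (ν := (η ^ 2 / 2000) ^ 2) (by positivity)
    (by rw [hη]; norm_num)
  refine ⟨max n₁ (10 ^ 18), fun V _ G hn hO hd => ?_⟩
  have hn2 : (10 : ℝ) ^ 18 ≤ Fintype.card V := by exact_mod_cast (le_max_right _ _).trans hn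
  by_cases hE : Expander ((η ^ 2 / 2000) ^ 2) G
  · exact hn1 V G ((le_max_left _ _).trans hn) (fun x h => hO x x h h) hd hE
  · obtain ⟨S₀, T₀, E, hN, hdense⟩ := near_of_not_expander hO hd (η := η) (by positivity)
      (by rw [hη]; norm_num) (by rw [hη]; linarith) hE
    obtain ⟨S, T, hP, hS, hT⟩ := exists_placed hd (by rw [hη]; norm_num) (by
      have : (100 : ℝ) ≤ Fintype.card V := by linarith
      exact_mod_cast this) hN
    exact exists_isHamCycle_of_placed (η := η) hO hd (by positivity) le_rfl (by rw [hη]; linarith) hN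
      hdense hP hS hT

end Core

theorem degCond_of_minSemiDeg {n : ℕ} {G : Fin n → Fin n → Prop}
    (h : ⌈(3 * (n : ℚ) - 4) / 8⌉ ≤ (minSemiDeg G : ℤ)) : DegCond G := by
  have h1 : (3 * (n : ℚ) - 4) / 8 ≤ (minSemiDeg G : ℤ) := Int.ceil_le.1 h
  have h2 : 3 * n ≤ 8 * minSemiDeg G + 4 := by
    have : 3 * (n : ℚ) ≤ 8 * (minSemiDeg G : ℕ) + 4 := by
      push_cast at h1
      linarith
    exact_mod_cast this
  intro x
  have h3 : minSemiDeg G ≤ (No G x).card := by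
    have h5 : minOutDeg G ≤ outDeg G x := Nat.sInf_le (Set.mem_range_self x)
    refine (min_le_left _ _).trans (h5.trans_eq ?_)
    rw [outDeg, ← Set.ncard_coe_finset]
    congr 1
    ext y
    simp [outN]
  have h4 : minSemiDeg G ≤ (Ni G x).card := by
    have h5 : minInDeg G ≤ inDeg G x := Nat.sInf_le (Set.mem_range_self x)
    refine (min_le_right _ _).trans (h5.trans_eq ?_)
    rw [inDeg, ← Set.ncard_coe_finset]
    congr 1
    ext y
    simp [inN]
  rw [Fintype.card_fin]
  omega

/-- **Theorem 1 (Keevash–Kühn–Osthus).**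
There exists `n₀` such that every oriented graph `G` on `n ≥ n₀` vertices with minimum
semi-degree `δ⁰(G) ≥ ⌈(3n-4)/8⌉` contains a Hamilton cycle. -/
theorem exact_min_semidegree_hamilton :
    ∃ n₀ : ℕ, 0 < n₀ ∧ ∀ n : ℕ, n₀ ≤ n →
      ∀ G : Fin n → Fin n → Prop, IsOriented G →
        (⌈(3 * (n : ℚ) - 4) / 8⌉ ≤ (minSemiDeg G : ℤ)) →
        ∃ σ : Equiv.Perm (Fin n), IsHamCycle G σ := by
  obtain ⟨n₀, h⟩ := exists_isHamCycle_of_degCond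
  exact ⟨n₀ + 1, Nat.succ_pos _, fun n hn G hO hG =>
    h (Fin n) G (by rw [Fintype.card_fin]; omega) hO (degCond_of_minSemiDeg hG)⟩

end ArxivOG
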